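/- arXiv:1207.2936 — 5 statements merged into one kernel-verified Lean document; each statement's English description precedes it below -/
import Mathlib

section
/- For q = 8, for q = 9, and for every prime power q ≥ 16, there exist real constants κ > 0 and τ > 0 and an infinite sequence of (n_j, t_j, 2, n_j − t_j)-arithmetic secret sharing schemes C_j for F_q^{k_j} over F_q with uniformity, such that n_j → ∞, k_j ≥ κ·n_j, and t_j ≥ τ·n_j for all j. -/
open Filter

/-- An `n`-code for `F_q^k` over `F_q`: an `F_q`-subspace `C ⊆ F_q^k × F_q^n` such that
the secret component takes all values and the shares determine the secret. -/
def IsNCode {F : Type} [Field F] {k n : ℕ}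
    (C : Submodule F ((Fin k → F) × (Fin n → F))) : Prop :=
  (∀ s : Fin k → F, ∃ c ∈ C, c.1 = s) ∧ (∀ c ∈ C, c.2 = 0 → c.1 = 0)

/-- `r`-reconstructing: any `r` shares determine the secret. -/
def IsReconstructing {F : Type} [Field F] {k n : ℕ} (r : ℕ)
    (C : Submodule F ((Fin k → F) × (Fin n → F))) : Prop :=
  ∀ A : Finset (Fin n), A.card = r → ∀ c ∈ C, (∀ i ∈ A, c.2 i = 0) → c.1 = 0

/-- `t`-disconnected: for any set `A` of `t` share-coordinates, the projection
`C → F_q^k × π_A(C)` is surjective. -/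
def IsDisconnected {F : Type} [Field F] {k n : ℕ} (t : ℕ)
    (C : Submodule F ((Fin k → F) × (Fin n → F))) : Prop :=
  t = 0 ∨ (1 ≤ t ∧ t < n ∧ ∀ A : Finset (Fin n), A.card = t →
    ∀ s : Fin k → F, ∀ v ∈ C, ∃ c ∈ C, c.1 = s ∧ ∀ i ∈ A, c.2 i = v.2 i)

/-- `t`-uniform: the projection `C → F_q^k × F_q^A` is surjective for all `A` with `|A| = t`. -/
def IsUniform {F : Type} [Field F] {k n : ℕ} (t : ℕ)
    (C : Submodule F ((Fin k → F) × (Fin n → F))) : Prop :=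
  ∀ A : Finset (Fin n), A.card = t → ∀ s : Fin k → F, ∀ f : Fin n → F,
    ∃ c ∈ C, c.1 = s ∧ ∀ i ∈ A, c.2 i = f i

/-- The `d`-th power `C^{*d}`: the span of all coordinatewise products of `d` elements of `C`. -/
def codePow {F : Type} [Field F] {k n : ℕ} (d : ℕ)
    (C : Submodule F ((Fin k → F) × (Fin n → F))) :
    Submodule F ((Fin k → F) × (Fin n → F)) :=
  Submodule.span F
    {x | ∃ f : Fin d → ((Fin k → F) × (Fin n → F)), (∀ i, f i ∈ C) ∧ x = ∏ i, f i}

/-- An `(n,t,d,r)`-arithmetic secret sharing scheme for `F_q^k` over `F_q`. -/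
def IsASSS {F : Type} [Field F] {k n : ℕ} (t d r : ℕ)
    (C : Submodule F ((Fin k → F) × (Fin n → F))) : Prop :=
  IsNCode C ∧ 1 ≤ t ∧ 2 ≤ d ∧ IsDisconnected t C ∧
    IsNCode (codePow d C) ∧ IsReconstructing r (codePow d C)

theorem FiniteField.exists_sq_add_sq {K : Type*} [Field K] [Finite K] (z : K) :
    ∃ a b : K, z = a ^ 2 + b ^ 2 := by
  cases nonempty_fintype K
  by_cases h2 : ringChar K = 2
  · obtain ⟨a, ha⟩ := FiniteField.isSquare_of_char_two h2 z
    exact ⟨a, 0, by rw [ha]; ring⟩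
  · have hodd : Fintype.card K % 2 = 1 := FiniteField.odd_card_of_char_ne_two h2
    open Polynomial in
    obtain ⟨a, b, hab⟩ := FiniteField.exists_root_sum_quadratic
      (f := (X ^ 2 : K[X])) (g := X ^ 2 - C z) (by simp)
      (by rw [degree_sub_C] <;> simp) hodd
    simp at hab
    exact ⟨a, b, by linear_combination -hab⟩

/-- On a quadratic extension of finite fields every symmetric form `lam (x * y)` is
diagonalisable, in every characteristic. -/
theorem exists_diagonal_quadratic {F K : Type*} [Field F] [Field K] [Algebra F K] [Finite K]
    (h2 : Module.finrank F K = 2) (lam : K →ₗ[F] F) :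
    ∃ (e : K ≃ₗ[F] (Fin 2 → F)) (β : Fin 2 → F),
      ∀ x y, lam (x * y) = ∑ i, β i * (e x i * e y i) := by
  have : Module.Finite F K := Module.finite_of_finrank_pos (by omega)
  by_cases hlam : lam = 0
  · refine ⟨(Module.finBasisOfFinrankEq F K h2).equivFun, 0, ?_⟩
    simp [hlam]
  obtain ⟨v, hv⟩ : ∃ v, lam (v * v) ≠ 0 := by
    by_contra! hcon
    refine hlam (LinearMap.ext fun z => ?_)
    obtain ⟨a, b, rfl⟩ := FiniteField.exists_sq_add_sq z
    simp [pow_two, hcon]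
  obtain ⟨w, hw0, hw⟩ : ∃ w ≠ 0, lam (v * w) = 0 := by
    have hlt : Module.finrank F F < Module.finrank F K := by simp [h2]
    obtain ⟨w, hw, hw0⟩ := (Submodule.ne_bot_iff _).1
      (LinearMap.ker_ne_bot_of_finrank_lt (f := lam ∘ₗ LinearMap.mulLeft F v) hlt)
    exact ⟨w, hw0, by simpa using hw⟩
  have hli : LinearIndependent F ![v, w] := by
    rw [LinearIndependent.pair_iff]
    intro a b hab
    have ha : a = 0 := by
      have := congrArg (fun z => lam (v * z)) hab
      simpa [mul_add, hw, hv] using this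
    subst ha
    simpa [hw0] using hab
  let B := basisOfLinearIndependentOfCardEqFinrank hli (by simp [h2])
  refine ⟨B.equivFun, ![lam (v * v), lam (w * w)], fun x y => ?_⟩
  have hB (x : K) : x = B.equivFun x 0 • v + B.equivFun x 1 • w := by
    conv_lhs => rw [← B.sum_equivFun x]
    simp [B, Fin.sum_univ_two]
  conv_lhs => rw [hB x, hB y]
  have hw' : lam (w * v) = 0 := by rw [mul_comm, hw]
  simp [mul_add, add_mul, hw, hw', Fin.sum_univ_two]
  ring

theorem exists_diagonal_quartic {F K E : Type*} [Field F] [Field K] [Field E] [Algebra F K]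
    [Algebra K E] [Algebra F E] [IsScalarTower F K E] [Finite E]
    (h2 : Module.finrank F K = 2) (h2' : Module.finrank K E = 2) (lam : K →ₗ[F] F)
    (mu : E →ₗ[K] K) :
    ∃ (e : E ≃ₗ[F] (Fin 2 × Fin 2 → F)) (β : Fin 2 × Fin 2 → F),
      ∀ x y, lam (mu (x * y)) = ∑ i, β i * (e x i * e y i) := by
  have : Finite K := Finite.of_injective _ (algebraMap K E).injective
  obtain ⟨e, β, h⟩ := exists_diagonal_quadratic h2' mu
  choose e' β' h' using fun i =>
    exists_diagonal_quadratic h2 (lam ∘ₗ LinearMap.mulLeft F (β i))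
  refine ⟨e.restrictScalars F ≪≫ₗ LinearEquiv.piCongrRight e' ≪≫ₗ
    (LinearEquiv.curry F F (Fin 2) (Fin 2)).symm, fun i => β' i.1 i.2, fun x y => ?_⟩
  rw [h, map_sum, Fintype.sum_prod_type]
  exact Finset.sum_congr rfl fun i _ => by simpa using h' i (e x i) (e y i)

theorem exists_quartic_extension (F : Type) [Field F] [Finite F] :
    ∃ (E : Type) (_ : Field E) (_ : Algebra F E) (_ : Fintype E) (lam : E →ₗ[F] F),
      Nat.card E = Nat.card F ^ 4 ∧ lam ≠ 0 ∧
      ∀ b : E, ∃ (e : E ≃ₗ[F] (Fin 2 × Fin 2 → F)) (β : Fin 2 × Fin 2 → F),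
        ∀ x y, lam (b * (x * y)) = ∑ i, β i * (e x i * e y i) := by
  obtain ⟨p, hp⟩ := CharP.exists F
  have : Fact p.Prime := ⟨CharP.char_is_prime F p⟩
  let K := FiniteField.Extension F p 2
  have hKp : CharP K p := charP_of_injective_algebraMap (algebraMap F K).injective p
  let E := FiniteField.Extension K p 2
  let : Algebra F E := ((algebraMap K E).comp (algebraMap F K)).toAlgebra
  have : IsScalarTower F K E := .of_algebraMap_eq' rfl
  have h2 : Module.finrank F K = 2 := FiniteField.finrank_extension F p 2
  have h2' : Module.finrank K E = 2 := FiniteField.finrank_extension K p 2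
  obtain ⟨lam, hlam⟩ := exists_ne (0 : Module.Dual F K)
  obtain ⟨mu, hmu⟩ := exists_ne (0 : Module.Dual K E)
  refine ⟨E, inferInstance, inferInstance, Fintype.ofFinite E, lam ∘ₗ mu.restrictScalars F,
    ?_, ?_, fun b => ?_⟩
  · rw [FiniteField.natCard_extension K p 2, FiniteField.natCard_extension F p 2, ← pow_mul]
  · obtain ⟨x, hx⟩ : ∃ x, mu x ≠ 0 := by
      by_contra! h
      exact hmu (LinearMap.ext h)
    obtain ⟨y, hy⟩ : ∃ y, lam y ≠ 0 := by
      by_contra! h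
      exact hlam (LinearMap.ext h)
    intro h
    have := LinearMap.congr_fun h ((y / mu x) • x)
    simp only [LinearMap.comp_apply, LinearMap.coe_restrictScalars, map_smul, smul_eq_mul,
      div_mul_cancel₀ _ hx, LinearMap.zero_apply] at this
    exact hy this
  · exact exists_diagonal_quartic h2 h2' lam (mu ∘ₗ LinearMap.mulLeft K b)

open Finset in
theorem card_ker_mul {F E : Type*} [Field F] [Field E] [Algebra F E] [Fintype F] [Fintype E]
    [DecidableEq F] {lam : E →ₗ[F] F} (hlam : lam ≠ 0) {h : E} (hh : h ≠ 0) :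
    #{x : E | lam (x * h) = 0} * Fintype.card F = Fintype.card E := by
  let f := lam ∘ₗ LinearMap.mulRight F h
  have hf : Function.Surjective f := by
    rw [LinearMap.surjective_iff_ne_zero]
    intro h0
    refine hlam (LinearMap.ext fun x => ?_)
    have := LinearMap.congr_fun h0 (x * h⁻¹)
    simpa [f, hh] using this
  have h1 := Submodule.card_eq_card_quotient_mul_card (LinearMap.ker f)
  rw [Nat.card_congr (f.quotKerEquivOfSurjective hf).toEquiv] at h1
  simp only [← Nat.card_eq_fintype_card]
  rw [h1]
  congr 1
  exact (Nat.subtype_card _ (by simp [f])).symm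

open Finset in
theorem exists_multiplier {F E S : Type*} [Field F] [Field E] [Algebra F E] [Fintype F] [Fintype E]
    [DecidableEq F] [DecidableEq E] [Fintype S] [DecidableEq S] {lam : E →ₗ[F] F} (hlam : lam ≠ 0)
    (H : Finset (S → E)) (t z : ℕ) (hz : ∀ h ∈ H, #{P | h P = 0} ≤ z)
    (hcount : #H * 2 ^ Fintype.card S < Fintype.card F ^ (Fintype.card S - t - z)) :
    ∃ b : S → E, ∀ h ∈ H, t < #{P | lam (b P * h P) ≠ 0} := by
  by_contra! hbad
  set q := Fintype.card F with hq
  have hq1 : 1 ≤ q := Fintype.card_pos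
  set m := Fintype.card S - t - z with hm
  let B (h : S → E) (A : Finset S) : Finset (S → E) :=
    Fintype.piFinset fun P => univ.filter fun x => P ∈ A ∨ lam (x * h P) = 0
  have hB (h : S → E) (hh : h ∈ H) (A : Finset S) (hA : #A ≤ t) :
      #(B h A) * q ^ m ≤ Fintype.card (S → E) := by
    have h1 : m ≤ #{P | ¬ (P ∈ A ∨ h P = 0)} := by
      have h2 : #{P | P ∈ A ∨ h P = 0} ≤ t + z := by
        rw [filter_or]
        refine (card_union_le _ _).trans (add_le_add ?_ (hz h hh))
        simpa using hA
      have h3 := card_filter_add_card_filter_not (s := (univ : Finset S)) (fun P => P ∈ A ∨ h P = 0)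
      rw [card_univ] at h3
      omega
    calc #(B h A) * q ^ m ≤ #(B h A) * q ^ #{P | ¬ (P ∈ A ∨ h P = 0)} := by gcongr
      _ = ∏ P, (#(univ.filter fun x => P ∈ A ∨ lam (x * h P) = 0) *
            if ¬ (P ∈ A ∨ h P = 0) then q else 1) := by
          rw [prod_mul_distrib, Fintype.card_piFinset, prod_ite, prod_const, prod_const_one,
            mul_one]
      _ ≤ ∏ _P : S, Fintype.card E := by
          refine prod_le_prod' fun P _ => ?_
          split_ifs with hP
          · simpa using card_le_univ _
          · push Not at hP
            simp only [hP.1, false_or]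
            exact (card_ker_mul hlam hP.2).le
      _ = Fintype.card (S → E) := by simp
  have hcover : (univ : Finset (S → E)) ⊆
      H.biUnion fun h => (univ.filter fun A : Finset S => #A ≤ t).biUnion (B h) := by
    intro b _
    obtain ⟨h, hh, hb⟩ := hbad b
    simp only [mem_biUnion, mem_filter, mem_univ, true_and]
    refine ⟨h, hh, _, hb, ?_⟩
    simp only [B, Fintype.mem_piFinset, mem_filter, mem_univ, true_and]
    exact fun P => by tauto
  have hle : Fintype.card (S → E) * q ^ m ≤ #H * 2 ^ Fintype.card S * Fintype.card (S → E) := by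
    calc Fintype.card (S → E) * q ^ m
        ≤ (∑ h ∈ H, ∑ A ∈ univ.filter (fun A : Finset S => #A ≤ t), #(B h A)) * q ^ m := by
          gcongr
          rw [← card_univ]
          refine (card_le_card hcover).trans (card_biUnion_le.trans (sum_le_sum fun h _ => ?_))
          exact card_biUnion_le
      _ = ∑ h ∈ H, ∑ A ∈ univ.filter (fun A : Finset S => #A ≤ t), #(B h A) * q ^ m := by
          simp only [sum_mul]
      _ ≤ ∑ h ∈ H, ∑ A ∈ univ.filter (fun A : Finset S => #A ≤ t), Fintype.card (S → E) := by
          refine sum_le_sum fun h hh => sum_le_sum fun A hA => hB h hh A ?_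
          simpa using hA
      _ ≤ ∑ h ∈ H, ∑ A : Finset S, Fintype.card (S → E) := by
          refine sum_le_sum fun h hh => ?_
          exact sum_le_sum_of_subset (filter_subset _ _)
      _ = #H * 2 ^ Fintype.card S * Fintype.card (S → E) := by simp [mul_assoc]
  have hpos : 0 < Fintype.card (S → E) := Fintype.card_pos
  rw [mul_comm] at hle
  exact absurd (Nat.le_of_mul_le_mul_right hle hpos) (not_le.2 hcount)

open Finset in
theorem exists_isASSS_of_codes {F E S : Type} [Field F] [Field E] [Algebra F E] [Fintype F]
    [Fintype E] [Fintype S] (lam : E →ₗ[F] F) (hlam : lam ≠ 0)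
    (hdiag : ∀ b : E, ∃ (e : E ≃ₗ[F] (Fin 2 × Fin 2 → F)) (β : Fin 2 × Fin 2 → F),
        ∀ x y, lam (b * (x * y)) = ∑ i, β i * (e x i * e y i))
    {M t z : ℕ} (L1 L2 : Submodule E (Fin M ⊕ S → E))
    (hmul : ∀ f ∈ L1, ∀ g ∈ L1, f * g ∈ L2)
    (hsurj : ∀ A : Finset (Fin M ⊕ S), #A ≤ M + t → ∀ g : Fin M ⊕ S → E,
      ∃ f ∈ L1, ∀ P ∈ A, f P = g P)
    (hzero : ∀ h ∈ L2, h ≠ 0 → ∀ A : Finset (Fin M ⊕ S), (∀ P ∈ A, h P = 0) → #A ≤ z)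
    (hcount : Nat.card L2 * 2 ^ Fintype.card S < Fintype.card F ^ (Fintype.card S - t - z))
    (ht : 1 ≤ t) (htS : t < Fintype.card S) :
    ∃ C : Submodule F ((Fin M → F) × (Fin (Fintype.card S * 4) → F)),
      IsASSS t 2 (Fintype.card S * 4 - t) C ∧ IsUniform t C := by
  classical
  set s := Fintype.card S with hs
  have hn : t < s * 4 := by omega
  have hzs : z < s := by
    by_contra! hcon
    rw [show s - t - z = 0 by omega, pow_zero] at hcount
    have : 0 < Nat.card L2 * 2 ^ s := Nat.mul_pos Nat.card_pos (by positivity)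
    omega
  have hzero' (h : Fin M ⊕ S → E) (hh : h ∈ L2) (h0 : h ≠ 0) :
      #{P : S | h (.inr P) = 0} ≤ z := by
    rw [← card_map Function.Embedding.inr]
    exact hzero h hh h0 _ (by simp)
  obtain ⟨b, hb⟩ : ∃ b : S → E, ∀ h ∈ L2, h ≠ 0 →
      t < #{P : S | lam (b P * h (.inr P)) ≠ 0} := by
    let H : Finset (S → E) :=
      (univ.filter fun h : Fin M ⊕ S → E => h ∈ L2 ∧ h ≠ 0).image fun h P => h (.inr P)
    have hH : #H ≤ Nat.card L2 := by
      refine card_image_le.trans ?_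
      have h1 : Nat.card L2 = #(univ.filter fun h : Fin M ⊕ S → E => h ∈ L2) :=
        Nat.subtype_card _ (by simp)
      rw [h1]
      exact card_le_card fun h => by simp +contextual
    obtain ⟨b, hb⟩ := exists_multiplier hlam H t z (by
      intro h hh
      obtain ⟨h', hh', rfl⟩ := mem_image.1 hh
      simp only [mem_filter, mem_univ, true_and] at hh'
      exact hzero' h' hh'.1 hh'.2) ((Nat.mul_le_mul_right _ hH).trans_lt hcount)
    exact ⟨b, fun h hh h0 => hb _ (mem_image.2 ⟨h, by simp [hh, h0], rfl⟩)⟩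
  choose e β heβ using fun P => hdiag (b P)
  obtain ⟨σ⟩ : Nonempty (Fin (s * 4) ≃ S × (Fin 2 × Fin 2)) :=
    ⟨(Fintype.equivFinOfCardEq (by simp [hs])).symm⟩
  let C : Submodule F ((Fin M → F) × (Fin (s * 4) → F)) :=
    { carrier := {c | ∃ f ∈ L1, (∀ i, f (.inl i) = algebraMap F E (c.1 i)) ∧
        ∀ P i, e P (f (.inr P)) i = c.2 (σ.symm (P, i))}
      add_mem' := by
        rintro c c' ⟨f, hf, h1, h2⟩ ⟨f', hf', h1', h2'⟩
        exact ⟨f + f', add_mem hf hf', by simp [h1, h1'], by simp [h2, h2']⟩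
      zero_mem' := ⟨0, zero_mem _, by simp, by simp⟩
      smul_mem' := by
        rintro a c ⟨f, hf, h1, h2⟩
        refine ⟨algebraMap F E a • f, Submodule.smul_mem _ _ hf, by simp [h1], fun P i => ?_⟩
        simp [← h2, ← Algebra.smul_def] }
  have huni : IsUniform t C := by
    intro A hA sec v
    obtain ⟨f, hf, hfg⟩ := hsurj (univ.image Sum.inl ∪ A.image fun j => Sum.inr (σ j).1) (by
      refine (card_union_le _ _).trans (add_le_add (card_image_le.trans (by simp)) ?_)
      exact card_image_le.trans hA.le) (Sum.elim (fun i => algebraMap F E (sec i))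
        fun P => (e P).symm fun i => v (σ.symm (P, i)))
    refine ⟨(sec, fun j => e (σ j).1 (f (.inr (σ j).1)) (σ j).2), ⟨f, hf, fun i => ?_, by simp⟩,
      rfl, fun j hj => ?_⟩
    · simpa using hfg (.inl i) (by simp)
    · have := hfg (.inr (σ j).1) (by simp only [mem_union, mem_image]; exact .inr ⟨j, hj, rfl⟩)
      simp [this]
  have hone : ∀ sec : Fin M → F, ∃ c ∈ C, c.1 = sec := fun sec => by
    obtain ⟨A, -, hA⟩ := exists_subset_card_eq (s := (univ : Finset (Fin (s * 4)))) (n := t)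
      (by simpa using hn.le)
    obtain ⟨c, hc, h, -⟩ := huni A hA sec 0
    exact ⟨c, hc, h⟩
  have hpow : ∀ c ∈ codePow 2 C, ∃ h ∈ L2, (∀ i, h (.inl i) = algebraMap F E (c.1 i)) ∧
      ∀ P, lam (b P * h (.inr P)) = ∑ i, β P i * c.2 (σ.symm (P, i)) := by
    intro c hc
    refine Submodule.span_induction ?_ ?_ ?_ ?_ hc
    · rintro c ⟨f, hf, rfl⟩
      obtain ⟨f0, hf0, h1, h2⟩ := hf 0
      obtain ⟨f1, hf1, h1', h2'⟩ := hf 1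
      refine ⟨f0 * f1, hmul _ hf0 _ hf1, fun i => by simp [h1, h1'], fun P => ?_⟩
      simp [heβ, h2, h2']
    · exact ⟨0, zero_mem _, by simp, by simp⟩
    · rintro c c' - - ⟨f, hf, h1, h2⟩ ⟨f', hf', h1', h2'⟩
      exact ⟨f + f', add_mem hf hf', by simp [h1, h1'],
        by simp [h2, h2', mul_add, sum_add_distrib]⟩
    · rintro a c - ⟨f, hf, h1, h2⟩
      refine ⟨algebraMap F E a • f, Submodule.smul_mem _ _ hf, by simp [h1], fun P => ?_⟩
      simp only [Pi.smul_apply, smul_eq_mul, ← Algebra.smul_def, mul_smul_comm, map_smul, h2,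
        Prod.smul_snd, mul_sum]
      exact sum_congr rfl fun i _ => by ring
  have hrec : IsReconstructing (s * 4 - t) (codePow 2 C) := by
    intro A hA c hc hcA
    obtain ⟨h, hh, h1, h2⟩ := hpow c hc
    by_cases h0 : h = 0
    · subst h0
      ext i
      simpa using (h1 i).symm
    exfalso
    have hlt := hb h hh h0
    have hsub : ({P : S | lam (b P * h (.inr P)) ≠ 0} : Finset S) ⊆
        Aᶜ.image fun j => (σ j).1 := by
      intro P hP
      simp only [mem_filter, mem_univ, true_and, h2] at hP
      obtain ⟨i, -, hi⟩ := exists_ne_zero_of_sum_ne_zero hP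
      refine mem_image.2 ⟨σ.symm (P, i), ?_, by simp⟩
      rw [mem_compl]
      intro hmem
      simp [hcA _ hmem] at hi
    have := (card_le_card hsub).trans card_image_le
    rw [card_compl, hA, Fintype.card_fin] at this
    omega
  have hrec' : ∀ c ∈ codePow 2 C, c.2 = 0 → c.1 = 0 := by
    intro c hc h0
    obtain ⟨A, -, hA⟩ := exists_subset_card_eq (s := (univ : Finset (Fin (s * 4))))
      (n := s * 4 - t) (by simp)
    exact hrec A hA c hc (by simp [h0])
  refine ⟨C, ⟨⟨hone, ?_⟩, ht, le_rfl, .inr ⟨ht, hn, fun A hA sec v _ => huni A hA sec v.2⟩,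
    ⟨fun sec => ?_, hrec'⟩, hrec⟩, huni⟩
  · rintro c ⟨f, hf, h1, h2⟩ h0
    have hf0 : ∀ P, f (.inr P) = 0 := by
      intro P
      have : e P (f (.inr P)) = 0 := funext fun i => by simp [h2, h0]
      simpa using this
    have hff : f * f = 0 := by
      by_contra hne
      have := hzero' _ (hmul f hf f hf) hne
      simp [hf0, ← hs] at this
      omega
    ext i
    have := congrFun hff (.inl i)
    simpa [h1] using this
  · obtain ⟨c, hc, rfl⟩ := hone sec
    obtain ⟨c', hc', h'⟩ := hone 1
    refine ⟨c * c', Submodule.subset_span ⟨![c, c'], ?_, by simp⟩, by simp [h']⟩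
    intro i
    fin_cases i <;> simpa

/-- Evaluation spaces `L₁`, `L₂` on a finite set of points with `L₁ * L₁ ⊆ L₂`, where `L₁`
interpolates at `u` points and nonzero elements of `L₂` have at most `z` zeros. -/
structure EvaluationPair (k P : Type) [Field k] (u z : ℕ) where
  L₁ : Submodule k (P → k)
  L₂ : Submodule k (P → k)
  mul_mem : ∀ f ∈ L₁, ∀ g ∈ L₁, f * g ∈ L₂
  interpolate : ∀ A : Finset P, A.card ≤ u → ∀ g : P → k, ∃ f ∈ L₁, ∀ x ∈ A, f x = g x
  card_zeros_le : ∀ h ∈ L₂, h ≠ 0 → ∀ A : Finset P, (∀ x ∈ A, h x = 0) → A.card ≤ z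
  finrank_le : Module.finrank k L₂ ≤ z + 1

def EvaluationPair.congr {k P Q : Type} [Field k] {u z : ℕ} (D : EvaluationPair k P u z)
    (σ : Q ≃ P) : EvaluationPair k Q u z where
  L₁ := D.L₁.map (LinearEquiv.funCongrLeft k k σ).toLinearMap
  L₂ := D.L₂.map (LinearEquiv.funCongrLeft k k σ).toLinearMap
  mul_mem := by
    rintro _ ⟨f, hf, rfl⟩ _ ⟨g, hg, rfl⟩
    exact ⟨f * g, D.mul_mem f hf g hg, rfl⟩
  interpolate A hA g := by
    obtain ⟨f, hf, h⟩ := D.interpolate (A.map σ.toEmbedding) (by simpa) (g ∘ σ.symm)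
    exact ⟨_, ⟨f, hf, rfl⟩, fun x hx => by simpa [hx] using h (σ x)⟩
  card_zeros_le := by
    rintro _ ⟨h, hh, rfl⟩ h0 A hA
    rw [← Finset.card_map σ.toEmbedding]
    exact D.card_zeros_le h hh (by rintro rfl; simp at h0) _ fun x hx => by
      obtain ⟨y, hy, rfl⟩ := Finset.mem_map.1 hx
      exact hA y hy
  finrank_le := by
    rw [LinearEquiv.finrank_map_eq]
    exact D.finrank_le

theorem two_pow_mul_lt {q s a b : ℕ} (hq : 8 ≤ q) (h : s + 3 * a < 3 * b) :
    q ^ a * 2 ^ s < q ^ b := by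
  refine lt_of_pow_lt_pow_left₀ 3 (by positivity) ?_
  calc (q ^ a * 2 ^ s) ^ 3 = q ^ (3 * a) * 8 ^ s := by
        rw [mul_pow, ← pow_mul, ← pow_mul, mul_comm a, mul_comm s 3, pow_mul 2 3]; norm_num
    _ ≤ q ^ (3 * a) * q ^ s := by gcongr
    _ = q ^ (s + 3 * a) := by rw [← pow_add, add_comm]
    _ < q ^ (3 * b) := Nat.pow_lt_pow_right (by omega) h
    _ = (q ^ b) ^ 3 := by rw [← pow_mul, mul_comm]

open Filter in
theorem exists_isASSS_sequence (F : Type) [Field F] [Fintype F] (hq : 8 ≤ Fintype.card F)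
    (hcurve : ∀ (k : Type) [Field k] [Fintype k] (l : ℕ), 3 ≤ l → Fintype.card k = l ^ 2 →
      ∀ m : ℕ, ∃ (P : Type) (_ : Fintype P),
      Fintype.card P = (l ^ 2 - l) * l ^ m ∧
      Nonempty (EvaluationPair k P (2 * l ^ m) ((4 * l + 16) * l ^ m))) :
    ∃ (κ τ : ℝ), 0 < κ ∧ 0 < τ ∧
      ∃ (n k t : ℕ → ℕ)
        (C : ∀ j, Submodule F ((Fin (k j) → F) × (Fin (n j) → F))),
        Tendsto n atTop atTop ∧
        ∀ j, IsASSS (t j) 2 (n j - t j) (C j) ∧ IsUniform (t j) (C j) ∧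
          κ * (n j : ℝ) ≤ (k j : ℝ) ∧ τ * (n j : ℝ) ≤ (t j : ℝ) := by
  obtain ⟨E, _, _, _, lam, hcard, hlam, hdiag⟩ := exists_quartic_extension F
  rw [Nat.card_eq_fintype_card, Nat.card_eq_fintype_card] at hcard
  set q := Fintype.card F with hqdef
  set l := q ^ 2 with hl
  have hl64 : 64 ≤ l := by nlinarith
  have hEl : Fintype.card E = l ^ 2 := by rw [hcard, hl, ← pow_mul]
  obtain ⟨c, hc⟩ : ∃ c, c = l ^ 2 - l - 1 := ⟨_, rfl⟩
  have hl2 : l ^ 2 = c + l + 1 := by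
    have : 64 * l ≤ l ^ 2 := by nlinarith
    omega
  have hcbig : 60 * l + 255 < 2 * c := by nlinarith
  have key (j : ℕ) : ∃ C : Submodule F ((Fin (l ^ j) → F) × (Fin (c * l ^ j * 4) → F)),
      IsASSS (l ^ j) 2 (c * l ^ j * 4 - l ^ j) C ∧ IsUniform (l ^ j) C := by
    obtain ⟨P, _, hP, ⟨D⟩⟩ := hcurve E l (by omega) hEl j
    set M := l ^ j with hM
    have hM1 : 1 ≤ M := Nat.one_le_pow _ _ (by omega)
    rw [show l ^ 2 - l = 1 + c by omega, add_mul, one_mul] at hP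
    obtain ⟨σ⟩ : Nonempty (Fin M ⊕ Fin (c * M) ≃ P) :=
      Fintype.card_eq.1 (by simp [hP])
    let D' := D.congr σ
    have hcM : (60 * l + 255) * M < 2 * c * M := Nat.mul_lt_mul_of_pos_right hcbig hM1
    obtain ⟨lM, hlM⟩ : ∃ x, x = l * M := ⟨_, rfl⟩
    obtain ⟨cM, hcM'⟩ : ∃ x, x = c * M := ⟨_, rfl⟩
    have hz : (4 * l + 16) * M = 4 * lM + 16 * M := by rw [hlM]; ring
    have hcM2 : 60 * lM + 255 * M < 2 * cM := by rw [hlM, hcM']; linarith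
    have h := exists_isASSS_of_codes lam hlam hdiag (M := M) (t := M) D'.L₁ D'.L₂ D'.mul_mem
      (fun A hA => D'.interpolate A (by omega)) D'.card_zeros_le
      (by
        rw [Module.natCard_eq_pow_finrank (K := E), Nat.card_eq_fintype_card, hcard, ← pow_mul]
        simp only [Fintype.card_fin, ← hqdef, ← hcM', hz]
        have hf := D'.finrank_le
        exact two_pow_mul_lt hq (by omega)) hM1 (by simp only [Fintype.card_fin]; omega)
    rw [Fintype.card_fin] at h
    exact h
  choose C hC using key
  have hc0 : 0 < c := by omega
  refine ⟨1 / (4 * c), 1 / (4 * c), by positivity, by positivity, fun j => c * l ^ j * 4,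
    fun j => l ^ j, fun j => l ^ j, C, ?_, fun j => ⟨(hC j).1, (hC j).2, ?_, ?_⟩⟩
  · refine tendsto_atTop_mono (fun j => ?_) (tendsto_pow_atTop_atTop_of_one_lt
      (show 1 < l by omega))
    nlinarith [Nat.zero_le (l ^ j)]
  all_goals
    push_cast
    refine le_of_eq ?_
    field_simp

/-- A domain over `k` filtered by pole order at a single rational place, with at most `g` gaps,
together with a surjective evaluation map at finitely many points. -/
structure OrderDomain (k P O : Type) [Field k] [CommRing O] [IsDomain O] [Algebra k O]
    (g : ℕ) where
  V : ℤ → Submodule k O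
  mono : Monotone V
  eq_zero : ∀ f ∈ V (-1), f = 0
  exists_mem : ∀ f, ∃ n : ℕ, f ∈ V n
  mul_mem : ∀ {a b f f'}, f ∈ V a → f' ∈ V b → f * f' ∈ V (a + b)
  mul_notMem : ∀ {a b f f'}, f ∉ V a → f' ∉ V b → f * f' ∉ V (a + b + 1)
  lead : ℤ → O →ₗ[k] k
  lead_spec : ∀ {n f}, f ∈ V n → lead n f = 0 → f ∈ V (n - 1)
  exists_linearIndependent : ∀ n : ℕ, ∃ (ι : Type) (_ : Fintype ι) (b : ι → O),
    n + 1 ≤ Fintype.card ι + g ∧ LinearIndependent k b ∧ ∀ i, b i ∈ V n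
  ev : O →ₐ[k] (P → k)
  ev_surjective : Function.Surjective ev

namespace OrderDomain

variable {k P O : Type} [Field k] [CommRing O] [IsDomain O] [Algebra k O] {g : ℕ}
  (X : OrderDomain k P O g)

include X

theorem exists_smul_sub_mem {n : ℤ} {f h : O} (hf : f ∈ X.V n) (hh : h ∈ X.V n)
    (hh' : h ∉ X.V (n - 1)) : ∃ c : k, f - c • h ∈ X.V (n - 1) := by
  have h0 : X.lead n h ≠ 0 := fun h0 => hh' (X.lead_spec hh h0)
  refine ⟨X.lead n f / X.lead n h, X.lead_spec (sub_mem hf (Submodule.smul_mem _ _ hh)) ?_⟩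
  simp [h0]

theorem finite_and_finrank_le (W : Submodule k O) (n : ℕ) :
    Module.Finite k ↥(W ⊓ X.V n) ∧ Module.finrank k ↥(W ⊓ X.V n) ≤
      {s : Fin (n + 1) | ∃ f ∈ W, f ∈ X.V s ∧ f ∉ X.V (s - 1 : ℤ)}.ncard := by
  classical
  set S := {s : Fin (n + 1) | ∃ f ∈ W, f ∈ X.V s ∧ f ∉ X.V (s - 1 : ℤ)} with hS
  let L : ↥(W ⊓ X.V n) →ₗ[k] (S → k) :=
    LinearMap.pi fun s => X.lead (s.1 : ℕ) ∘ₗ Submodule.subtype _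
  have hL : Function.Injective L := by
    rw [← LinearMap.ker_eq_bot, LinearMap.ker_eq_bot']
    rintro ⟨f, hfW, hfV⟩ hf
    have key : ∀ j : ℕ, j ≤ n + 1 → f ∈ X.V (n - j) := by
      intro j
      induction j with
      | zero => intro _; simpa using hfV
      | succ j ih =>
        intro hj
        have hm := ih (by omega)
        have he : (n : ℤ) - j = ((⟨n - j, by omega⟩ : Fin (n + 1)) : ℕ) := by simp; omega
        have he' : (n : ℤ) - (j + 1 : ℕ) = ((⟨n - j, by omega⟩ : Fin (n + 1)) : ℕ) - 1 := by
          rw [← he]; push_cast; ring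
        rw [he] at hm
        rw [he']
        by_contra hcon
        have hs : (⟨n - j, by omega⟩ : Fin (n + 1)) ∈ S := ⟨f, hfW, hm, hcon⟩
        exact hcon (X.lead_spec hm (congrFun hf ⟨_, hs⟩))
    exact Subtype.ext (X.eq_zero f (by simpa using key (n + 1) le_rfl))
  have hfin : Module.Finite k ↥(W ⊓ X.V n) := Module.Finite.of_injective L hL
  refine ⟨hfin, (LinearMap.finrank_le_finrank_of_injective hL).trans ?_⟩
  rw [Module.finrank_fintype_fun_eq_card, ← Nat.card_eq_fintype_card]
  rfl

theorem finite_V (n : ℕ) : Module.Finite k (X.V n) := by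
  have := (X.finite_and_finrank_le ⊤ n).1
  rwa [top_inf_eq] at this

theorem gap (n : ℕ) : n + 1 ≤ Module.finrank k (X.V n) + g := by
  obtain ⟨ι, _, b, hn, hb, hmem⟩ := X.exists_linearIndependent n
  have := X.finite_V n
  have hb' : LinearIndependent k fun i => (⟨b i, hmem i⟩ : X.V n) :=
    LinearIndependent.of_comp (X.V n).subtype hb
  exact hn.trans (Nat.add_le_add_right hb'.fintype_card_le_finrank g)

theorem finrank_V_le (n : ℕ) : Module.finrank k (X.V n) ≤ n + 1 := by
  have := (X.finite_and_finrank_le ⊤ n).2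
  rw [top_inf_eq] at this
  refine this.trans ((Set.ncard_le_ncard (Set.subset_univ _)).trans ?_)
  simp [Set.ncard_univ]

theorem finrank_V_eq {W : Type} [AddCommGroup W] [Module k W] (T : O →ₗ[k] W) (n : ℕ) :
    Module.finrank k (X.V n) = Module.finrank k ((X.V n).map T) +
      Module.finrank k ↥(LinearMap.ker T ⊓ X.V n) := by
  have := X.finite_V n
  have h := LinearMap.finrank_range_add_finrank_ker (T.domRestrict (X.V n))
  rw [LinearMap.range_domRestrict, LinearMap.ker_domRestrict] at h
  rw [← h, ← Submodule.finrank_map_subtype_eq, inf_comm,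
    ← Submodule.map_comap_subtype]

theorem finrank_V_add_le (n d : ℕ) :
    Module.finrank k (X.V (n + d : ℕ)) ≤ Module.finrank k (X.V n) + d := by
  induction d with
  | zero => simp
  | succ d ih =>
    have h1 := X.finrank_V_eq (X.lead (n + d + 1 : ℕ)) (n + d + 1)
    have h2 := Submodule.finrank_le ((X.V (n + d + 1 : ℕ)).map (X.lead (n + d + 1 : ℕ)))
    rw [Module.finrank_self] at h2
    have := X.finite_V (n + d)
    have h3 : Module.finrank k
        ↥(LinearMap.ker (X.lead (n + d + 1 : ℕ)) ⊓ X.V (n + d + 1 : ℕ)) ≤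
        Module.finrank k (X.V (n + d : ℕ)) := by
      refine Submodule.finrank_mono fun f hf => ?_
      have := X.lead_spec hf.2 hf.1
      push_cast at this ⊢
      rwa [add_sub_cancel_right] at this
    rw [← add_assoc n d 1]
    omega

def evOn (A : Finset P) : O →ₗ[k] (A → k) :=
  LinearMap.funLeft k k (Subtype.val : A → P) ∘ₗ X.ev.toLinearMap

theorem finrank_le_ker_add (A : Finset P) (n : ℕ) :
    Module.finrank k (X.V n) ≤
      Module.finrank k ↥(LinearMap.ker (X.evOn A) ⊓ X.V n) + A.card := by
  have h := X.finrank_V_eq (X.evOn A) n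
  have h1 : Module.finrank k ((X.V n).map (X.evOn A)) ≤ A.card := by
    simpa using Submodule.finrank_le ((X.V n).map (X.evOn A))
  omega

/-- Every pole order at least `2 * g + |A|` occurs among the elements vanishing on `A`. -/
theorem exists_pole_order (A : Finset P) (e : ℕ) (he : 2 * g + A.card ≤ e) :
    ∃ f ∈ LinearMap.ker (X.evOn A), f ∈ X.V e ∧ f ∉ X.V (e - 1 : ℤ) := by
  classical
  let S (W : Submodule k O) : Set (Fin (e + 1)) :=
    {s | ∃ f ∈ W, f ∈ X.V s ∧ f ∉ X.V (s - 1 : ℤ)}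
  have h1 : e + 1 ≤ (S ⊤).ncard + g := by
    have : Module.finrank k ↥(⊤ ⊓ X.V e) ≤ (S ⊤).ncard := (X.finite_and_finrank_le ⊤ e).2
    rw [top_inf_eq] at this
    have := X.gap e
    omega
  have h2 : e + 1 ≤ (S (LinearMap.ker (X.evOn A))).ncard + g + A.card := by
    have : _ ≤ (S (LinearMap.ker (X.evOn A))).ncard :=
      (X.finite_and_finrank_le (LinearMap.ker (X.evOn A)) e).2
    have := X.gap e
    have := X.finrank_le_ker_add A e
    omega
  have h3 : ((Fin.rev '' S ⊤) ∩ S (LinearMap.ker (X.evOn A))).Nonempty := by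
    by_contra hcon
    rw [Set.not_nonempty_iff_eq_empty, ← Set.disjoint_iff_inter_eq_empty] at hcon
    have h4 := Set.ncard_union_eq hcon
    rw [Set.ncard_image_of_injective _ Fin.rev_injective] at h4
    have h5 := Set.ncard_le_ncard (Set.subset_univ
      (Fin.rev '' S ⊤ ∪ S (LinearMap.ker (X.evOn A))))
    rw [Set.ncard_univ, Nat.card_eq_fintype_card, Fintype.card_fin] at h5
    omega
  obtain ⟨_, ⟨s, ⟨f, -, hf, hf'⟩, rfl⟩, ⟨h, hh, hhV, hhV'⟩⟩ := h3
  have hs : (s : ℕ) + (Fin.rev s : ℕ) = e := by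
    have := s.2
    simp only [Fin.val_rev]
    omega
  refine ⟨f * h, ?_, ?_, ?_⟩
  · rw [LinearMap.mem_ker] at hh ⊢
    ext x
    have := congrFun hh x
    simp only [evOn, LinearMap.comp_apply, LinearMap.funLeft_apply, AlgHom.toLinearMap_apply,
      map_mul, Pi.mul_apply] at this ⊢
    rw [this]
    exact mul_zero _
  · have := X.mul_mem hf hhV
    rw [← hs]
    exact_mod_cast this
  · have := X.mul_notMem hf' hhV'
    rw [← hs]
    push_cast at this ⊢
    convert this using 2
    ring_nf

theorem interpolate (A : Finset P) (n : ℕ) (hn : 2 * g + A.card ≤ n) (t : P → k) :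
    ∃ f ∈ X.V n, ∀ x ∈ A, X.ev f x = t x := by
  classical
  have key : ∀ x ∈ A, ∃ f ∈ X.V n, X.ev f x = 1 ∧ ∀ y ∈ A, y ≠ x → X.ev f y = 0 := by
    intro x hx
    have hex : ∃ m : ℕ, ∃ f ∈ X.V m, X.ev f x ≠ 0 ∧ ∀ y ∈ A, y ≠ x → X.ev f y = 0 := by
      obtain ⟨f, hf⟩ := X.ev_surjective (Pi.single x 1)
      obtain ⟨m, hm⟩ := X.exists_mem f
      exact ⟨m, f, hm, by simp [hf], fun y _ hy => by simp [hf, hy]⟩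
    obtain ⟨f, hf, hfx, hfy⟩ := Nat.find_spec hex
    set e := Nat.find hex with he
    have hen : e ≤ n := by
      by_contra! hcon
      obtain ⟨h, hh, hhV, hhV'⟩ := X.exists_pole_order A e (by omega)
      obtain ⟨c, hc⟩ := X.exists_smul_sub_mem hf hhV hhV'
      have hhA : ∀ y ∈ A, X.ev h y = 0 := fun y hy => congrFun hh ⟨y, hy⟩
      refine Nat.find_min hex (m := e - 1) (by omega) ⟨f - c • h, ?_, ?_, fun y hy hyx => ?_⟩
      · rwa [Nat.cast_sub (by omega), Nat.cast_one]
      · simpa [hhA x hx] using hfx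
      · simp [hhA y hy, hfy y hy hyx]
    refine ⟨(X.ev f x)⁻¹ • f, Submodule.smul_mem _ _ (X.mono (by exact_mod_cast hen) hf),
      by simp [hfx], fun y hy hyx => by simp [hfy y hy hyx]⟩
  choose! f hf hfx hfy using key
  refine ⟨∑ x ∈ A, t x • f x, sum_mem fun x hx => Submodule.smul_mem _ _ (hf x hx),
    fun y hy => ?_⟩
  rw [map_sum, Finset.sum_apply, Finset.sum_eq_single_of_mem y hy]
  · simp [hfx y hy]
  · intro x hx hxy
    simp [hfy x hx y hy hxy.symm]

theorem card_zeros_le {d : ℕ} {f : O} (hf : f ∈ X.V d) (hf0 : f ≠ 0) (A : Finset P)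
    (hA : ∀ x ∈ A, X.ev f x = 0) : A.card ≤ d := by
  classical
  set n := 2 * g + A.card with hn
  have := X.finite_V n
  have := X.finite_V (n + d)
  have h1 := X.finrank_V_add_le n d
  have h2 := X.finrank_V_eq (X.evOn A) (n + d)
  have h3 : (X.V (n + d : ℕ)).map (X.evOn A) = ⊤ := by
    refine eq_top_iff.2 fun t _ => ?_
    obtain ⟨h, hh, ht⟩ := X.interpolate A (n + d) (by omega)
      (fun x => if hx : x ∈ A then t ⟨x, hx⟩ else 0)
    refine ⟨h, hh, funext fun x => ?_⟩
    exact (ht x x.2).trans (by simp)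
  rw [h3, finrank_top, Module.finrank_fintype_fun_eq_card, Fintype.card_coe] at h2
  have h4 : Module.finrank k (X.V n) ≤
      Module.finrank k ↥(LinearMap.ker (X.evOn A) ⊓ X.V (n + d : ℕ)) := by
    have := (X.finite_and_finrank_le (LinearMap.ker (X.evOn A)) (n + d)).1
    have hmem (h : O) (hh : h ∈ X.V n) :
        f * h ∈ LinearMap.ker (X.evOn A) ⊓ X.V (n + d : ℕ) := by
      refine ⟨funext fun x => ?_, ?_⟩
      · have : X.ev f x * X.ev h x = 0 := by rw [hA x x.2, zero_mul]
        exact (congrFun (map_mul X.ev f h) x).trans this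
      · have := X.mul_mem hf hh
        rw [add_comm] at this
        exact_mod_cast this
    refine LinearMap.finrank_le_finrank_of_injective
      (f := (LinearMap.mulLeft k f).restrict hmem) fun a b hab => Subtype.ext ?_
    exact mul_left_cancel₀ hf0 (congrArg Subtype.val hab)
  omega

def evaluationPair (u : ℕ) : EvaluationPair k P u (2 * (2 * g + u)) where
  L₁ := (X.V (2 * g + u : ℕ)).map X.ev.toLinearMap
  L₂ := (X.V (2 * (2 * g + u) : ℕ)).map X.ev.toLinearMap
  mul_mem := by
    rintro _ ⟨f, hf, rfl⟩ _ ⟨h, hh, rfl⟩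
    refine ⟨f * h, ?_, by simp⟩
    have := X.mul_mem hf hh
    rw [← two_mul] at this
    exact_mod_cast this
  interpolate A hA t := by
    obtain ⟨f, hf, h⟩ := X.interpolate A (2 * g + u) (by omega) t
    exact ⟨_, ⟨f, hf, rfl⟩, h⟩
  card_zeros_le := by
    rintro _ ⟨f, hf, rfl⟩ h0 A hA
    exact X.card_zeros_le hf (by rintro rfl; simp at h0) A hA
  finrank_le := by
    have := X.finite_V (2 * (2 * g + u))
    exact (Submodule.finrank_map_le _ _).trans (X.finrank_V_le _)

end OrderDomain

open Polynomial Finset in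
/-- The map `y ↦ y ^ l + y` over a field with `l ^ 2` elements: it is `l`-to-one onto the
fixed points of the `l`-power map. -/
theorem card_fiber_add_pow {k : Type} [Field k] [Fintype k] [DecidableEq k] {l : ℕ} (hl : 2 ≤ l)
    (hk : Fintype.card k = l ^ 2) (hadd : ∀ a b : k, (a + b) ^ l = a ^ l + b ^ l) {c : k}
    (hc : c ^ l = c) : #{y : k | y ^ l + y = c} = l := by
  have hroot (p q : k[X]) (hpq : q.natDegree < p.natDegree) (hp : p.natDegree = l) (S : Finset k)
      (hS : ∀ y ∈ S, p.eval y + q.eval y = 0) : #S ≤ l := by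
    have hdeg : (p + q).natDegree = l := by rw [natDegree_add_eq_left_of_natDegree_lt hpq, hp]
    have h0 : p + q ≠ 0 := by rintro h0; simp [h0] at hdeg; omega
    rw [← hdeg]
    refine (card_le_card fun y hy => ?_).trans
      ((Multiset.toFinset_card_le _).trans (card_roots' (p + q)))
    rw [Multiset.mem_toFinset, mem_roots h0, IsRoot.def, eval_add]
    exact hS y hy
  have hfib (c : k) : #{y : k | y ^ l + y = c} ≤ l := by
    refine hroot (X ^ l) (X - C c) (by rw [natDegree_X_sub_C, natDegree_X_pow]; omega)
      (natDegree_X_pow _) _ fun y hy => ?_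
    simp only [mem_filter, mem_univ, true_and] at hy
    simp [← hy]
  have hfix : #{c : k | c ^ l = c} ≤ l := by
    refine hroot (X ^ l) (-X) (by rw [natDegree_neg, natDegree_X, natDegree_X_pow]; omega)
      (natDegree_X_pow _) _ fun y hy => ?_
    simp only [mem_filter, mem_univ, true_and] at hy
    simp [hy]
  have hmaps : ∀ y ∈ (univ : Finset k), y ^ l + y ∈ (univ.filter fun c : k => c ^ l = c) := by
    intro y _
    simp only [mem_filter, mem_univ, true_and]
    rw [hadd, ← pow_mul, ← sq, ← hk, FiniteField.pow_card, add_comm]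
  have hsum := card_eq_sum_card_fiberwise hmaps
  rw [card_univ, hk] at hsum
  refine le_antisymm (hfib c) ?_
  by_contra! hlt
  have hmem : c ∈ (univ.filter fun c : k => c ^ l = c) := by simpa using hc
  have := sum_lt_sum (f := fun c : k => #{y : k | y ^ l + y = c}) (g := fun _ => l)
    (fun c _ => hfib c) ⟨c, hmem, hlt⟩
  rw [sum_const, smul_eq_mul, ← hsum] at this
  nlinarith

theorem exists_char_pow_of_card {k : Type} [Field k] [Fintype k] {l : ℕ}
    (hk : Fintype.card k = l ^ 2) :
    ∃ p e : ℕ, p.Prime ∧ CharP k p ∧ l = p ^ e := by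
  obtain ⟨p, hp⟩ := CharP.exists k
  obtain ⟨n, hpp, hn⟩ := FiniteField.card k p
  obtain ⟨e, -, he⟩ := (Nat.dvd_prime_pow hpp).1 (show l ∣ p ^ (n : ℕ) from
    hn ▸ hk ▸ dvd_pow_self l two_ne_zero)
  exact ⟨p, e, hpp, hp, he⟩

theorem add_pow_of_card {k A : Type} [Field k] [Fintype k] {l : ℕ}
    (hk : Fintype.card k = l ^ 2) [CommRing A] [Nontrivial A] [Algebra k A] (a b : A) :
    (a + b) ^ l = a ^ l + b ^ l := by
  obtain ⟨p, e, hp, hchar, rfl⟩ := exists_char_pow_of_card hk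
  have : Fact p.Prime := ⟨hp⟩
  have : CharP A p := charP_of_injective_algebraMap (algebraMap k A).injective p
  exact add_pow_char_pow a b p e

theorem sub_pow_of_card {k A : Type} [Field k] [Fintype k] {l : ℕ}
    (hk : Fintype.card k = l ^ 2) [CommRing A] [Nontrivial A] [Algebra k A] (a b : A) :
    (a - b) ^ l = a ^ l - b ^ l := by
  have := add_pow_of_card hk (a - b) b
  rw [sub_add_cancel] at this
  rw [this, add_sub_cancel_right]

open Polynomial Finset in
theorem add_pow_eq_prod {k A : Type} [Field k] [Fintype k] [DecidableEq k] {l : ℕ} (hl : 2 ≤ l)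
    (hk : Fintype.card k = l ^ 2) [Field A] [Algebra k A] (y : A) :
    y ^ l + y = ∏ w : k with w ^ l + w = 0, (y - algebraMap k A w) := by
  have h1 : (X ^ l + X : k[X]) = ∏ w : k with w ^ l + w = 0, (X - C w) := by
    have hdeg : (X ^ l + X : k[X]).natDegree = l := by
      rw [natDegree_add_eq_left_of_natDegree_lt] <;> simp; omega
    have hmon : (X ^ l + X : k[X]).Monic := monic_X_pow_add (by rw [degree_X]; exact_mod_cast hl)
    have hcard := card_fiber_add_pow hl hk (add_pow_of_card hk) (c := 0) (by simp; omega)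
    refine (eq_of_monic_of_dvd_of_natDegree_le (monic_prod_of_monic _ _ fun w _ => monic_X_sub_C w)
      hmon (Finset.prod_dvd_of_coprime ?_ ?_) ?_)
    · exact fun a _ b _ hab => (pairwise_coprime_X_sub_C Function.injective_id) hab
    · intro w hw
      simp only [mem_filter, mem_univ, true_and] at hw
      rw [dvd_iff_isRoot]
      simpa using hw
    · rw [hdeg, natDegree_prod_of_monic _ _ fun w _ => monic_X_sub_C w]
      simp [hcard]
  have := congrArg (aeval y) h1
  simpa using this

namespace Valuation

section

variable {K Γ : Type} [Field K] [LinearOrderedCommGroupWithZero Γ] (v : Valuation K Γ) {l : ℕ}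
  {x : K}

theorem map_pow_add_self_of_lt (hl : 2 ≤ l) (hx : v x < 1) : v (x ^ l + x) = v x := by
  rcases eq_or_ne x 0 with rfl | h0
  · rw [zero_pow (by omega), add_zero]
  · refine map_add_eq_of_lt_right v ?_
    rw [map_pow]
    exact pow_lt_self_of_lt_one₀ (by simpa [zero_lt_iff] using h0) hx (by omega)

theorem map_pow_add_self_of_one_lt (hl : 2 ≤ l) (hx : 1 < v x) : v (x ^ l + x) = v x ^ l := by
  rw [← map_pow]
  refine map_add_eq_of_lt_left v ?_
  rw [map_pow]
  exact lt_self_pow₀ hx (by omega)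

theorem map_pow_add_self_le (hx : v x ≤ 1) : v (x ^ l + x) ≤ 1 :=
  v.map_add_le (by rw [map_pow]; exact pow_le_one' hx l) hx

theorem map_le_one_of_pow_add_self (hl : 2 ≤ l) (h : v (x ^ l + x) ≤ 1) : v x ≤ 1 := by
  by_contra! hx
  rw [v.map_pow_add_self_of_one_lt hl hx] at h
  exact (one_lt_pow₀ hx (by omega)).not_ge h

theorem one_lt_of_pow_add_self (h : 1 < v (x ^ l + x)) : 1 < v x := by
  by_contra! hx
  exact (v.map_pow_add_self_le hx).not_gt h

end

variable {k K Γ : Type} [Field k] [Fintype k] [Field K] [Algebra k K]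
  [LinearOrderedCommGroupWithZero Γ] (v : Valuation K Γ)

theorem map_algebraMap_of_fintype {c : k} (hc : c ≠ 0) : v (algebraMap k K c) = 1 := by
  have h := FiniteField.pow_card_sub_one_eq_one c hc
  have hcard : Fintype.card k - 1 ≠ 0 := by have := Fintype.one_lt_card (α := k); omega
  have h2 : v (algebraMap k K c) ^ (Fintype.card k - 1) = 1 := by
    rw [← map_pow, ← map_pow, h, map_one, map_one]
  exact (pow_eq_one_iff_of_nonneg zero_le hcard).1 h2

theorem map_algebraMap_le_of_fintype (c : k) : v (algebraMap k K c) ≤ 1 := by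
  rcases eq_or_ne c 0 with rfl | hc
  · simp
  · exact (v.map_algebraMap_of_fintype hc).le

/-- An element with `v x = 1` at which `y ^ l + y` vanishes is congruent to a nonzero root of that
polynomial. -/
theorem exists_root_of_pow_add_self_lt {l : ℕ} (hl : 2 ≤ l) (hk : Fintype.card k = l ^ 2) {x : K}
    (hx : v x = 1) (hT : v (x ^ l + x) < 1) :
    ∃ c : k, c ≠ 0 ∧ c ^ l + c = 0 ∧ v (x - algebraMap k K c) = v (x ^ l + x) := by
  classical
  have hprod := add_pow_eq_prod (k := k) hl hk x
  have hex : ∃ c : k, c ^ l + c = 0 ∧ v (x - algebraMap k K c) < 1 := by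
    by_contra! hcon
    have : 1 ≤ v (x ^ l + x) := by
      rw [hprod, map_prod]
      exact Finset.one_le_prod' fun c hc' => hcon c (Finset.mem_filter.1 hc').2
    exact this.not_gt hT
  obtain ⟨c, hc, hlt⟩ := hex
  refine ⟨c, ?_, hc, ?_⟩
  · rintro rfl
    simp [hx] at hlt
  · rw [← v.map_pow_add_self_of_lt hl hlt, sub_pow_of_card hk]
    have h0 : algebraMap k K c ^ l + algebraMap k K c = 0 := by
      rw [← map_pow, ← map_add, hc, map_zero]
    congr 1
    linear_combination -h0

end Valuation

open scoped WithZero in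
/-- A chain `x 0, …, x m` in the Garcia–Stichtenoth tower over the field with `l ^ 2` elements,
with a discrete valuation `w` at a rational place that is a pole of `x 0` and totally ramified
over the field generated by `x 0`. -/
structure Tower (k K : Type) [Field k] [Fintype k] [Field K] [Algebra k K] (l m : ℕ) where
  three_le : 3 ≤ l
  card_eq : Fintype.card k = l ^ 2
  x : ℕ → K
  rel : ∀ j < m, x (j + 1) ^ l + x (j + 1) = x j ^ (l + 1) / (x j ^ l + x j)
  w : Valuation K ℤᵐ⁰
  one_lt_w : 1 < w (x 0)
  w_last : w (x m) = WithZero.exp 1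
  lead : ℤ → K →ₗ[k] k
  lead_spec : ∀ {n f}, w f ≤ WithZero.exp n → lead n f = 0 → w f ≤ WithZero.exp (n - 1)

namespace Tower

variable {k K Γ : Type} [Field k] [Fintype k] [Field K] [Algebra k K] {l m : ℕ}
  [LinearOrderedCommGroupWithZero Γ] (X : Tower k K l m) (v : Valuation K Γ)

include X

theorem two_le : 2 ≤ l := by have := X.three_le; omega

variable {v}

theorem step_of_one_lt {j : ℕ} (hj : j < m) (h : 1 < v (X.x j)) :
    1 < v (X.x (j + 1)) ∧ v (X.x (j + 1)) ^ l = v (X.x j) := by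
  have h0 : v (X.x j) ≠ 0 := (zero_lt_one.trans h).ne'
  have hU : v (X.x (j + 1) ^ l + X.x (j + 1)) = v (X.x j) := by
    rw [X.rel j hj, map_div₀, v.map_pow_add_self_of_one_lt X.two_le h, map_pow, pow_succ,
      mul_div_cancel_left₀ _ (pow_ne_zero l h0)]
  have h1 : 1 < v (X.x (j + 1)) := v.one_lt_of_pow_add_self (l := l) (hU ▸ h)
  exact ⟨h1, by rw [← hU, v.map_pow_add_self_of_one_lt X.two_le h1]⟩

theorem pow_of_one_lt {i : ℕ} (h : 1 < v (X.x i)) {a : ℕ} (ha : i + a ≤ m) :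
    1 < v (X.x (i + a)) ∧ v (X.x (i + a)) ^ l ^ a = v (X.x i) := by
  induction a with
  | zero => simpa using h
  | succ a ih =>
    obtain ⟨h1, h2⟩ := ih (by omega)
    obtain ⟨h3, h4⟩ := X.step_of_one_lt (j := i + a) (by omega) h1
    refine ⟨h3, ?_⟩
    rw [← h2, ← h4, ← pow_mul, pow_succ']
    rfl

theorem one_lt {i j : ℕ} (h : 1 < v (X.x i)) (hij : i ≤ j) (hj : j ≤ m) : 1 < v (X.x j) := by
  obtain ⟨a, rfl⟩ := Nat.exists_eq_add_of_le hij
  exact (X.pow_of_one_lt h hj).1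

theorem ne_zero {j : ℕ} (hj : j ≤ m) : X.x j ≠ 0 :=
  X.w.ne_zero_iff.1 (zero_lt_one.trans (X.one_lt X.one_lt_w (Nat.zero_le j) hj)).ne'

theorem pow_add_self_ne_zero {j : ℕ} (hj : j ≤ m) : X.x j ^ l + X.x j ≠ 0 := by
  have h := X.one_lt X.one_lt_w (Nat.zero_le j) hj
  rw [← X.w.ne_zero_iff, X.w.map_pow_add_self_of_one_lt X.two_le h]
  exact pow_ne_zero _ (zero_lt_one.trans h).ne'

theorem pow_add_self_inv {j : ℕ} (hj : j < m) :
    (X.x j)⁻¹ ^ l + (X.x j)⁻¹ = (X.x (j + 1) ^ l + X.x (j + 1))⁻¹ := by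
  have h1 := X.ne_zero hj.le
  have h2 := X.pow_add_self_ne_zero hj.le
  rw [X.rel j hj, inv_pow]
  field_simp
  ring

/-- Behaviour at a zero of `x j`. -/
theorem step_of_lt_one {j : ℕ} (hj : j < m) (h : v (X.x j) < 1) :
    v (X.x (j + 1) ^ l + X.x (j + 1)) = v (X.x j) ^ l := by
  have h0 : v (X.x j) ≠ 0 := v.ne_zero_iff.2 (X.ne_zero hj.le)
  rw [X.rel j hj, map_div₀, v.map_pow_add_self_of_lt X.two_le h, map_pow, pow_succ,
    mul_div_cancel_right₀ _ h0]

theorem pow_of_lt_one {i : ℕ} (hi : i ≤ m) (h : ∀ j ≤ i, v (X.x j) < 1) {j : ℕ} (hj : j ≤ i) :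
    v (X.x j) = v (X.x 0) ^ l ^ j := by
  induction j with
  | zero => simp
  | succ j ih =>
    rw [← v.map_pow_add_self_of_lt X.two_le (h _ hj),
      X.step_of_lt_one (by omega) (h j (by omega)), ih (by omega), ← pow_mul, pow_succ]

/-- At the first index where a zero of `x 0` is not a zero of `x i`, the function `x i` is
congruent to a nonzero root of `y ^ l + y`. -/
theorem exists_root {i : ℕ} (hi : i < m) (h : ∀ j ≤ i, v (X.x j) < 1) (hi' : 1 ≤ v (X.x (i + 1))) :
    ∃ c : k, c ≠ 0 ∧ c ^ l + c = 0 ∧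
      v (X.x (i + 1) - algebraMap k K c) = v (X.x 0) ^ l ^ (i + 1) ∧
      v (X.x (i + 1) ^ l + X.x (i + 1)) = v (X.x 0) ^ l ^ (i + 1) ∧ v (X.x (i + 1)) = 1 := by
  have hT := X.step_of_lt_one hi (h i le_rfl)
  rw [X.pow_of_lt_one hi.le h le_rfl, ← pow_mul, ← pow_succ] at hT
  have hlt : v (X.x 0) ^ l ^ (i + 1) < 1 :=
    pow_lt_one₀ zero_le (h 0 (by omega)) (pow_ne_zero _ (by have := X.three_le; omega))
  have h1 : v (X.x (i + 1)) = 1 :=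
    le_antisymm (v.map_le_one_of_pow_add_self X.two_le (hT ▸ hlt.le)) hi'
  obtain ⟨c, hc, hc', hval⟩ := v.exists_root_of_pow_add_self_lt X.two_le X.card_eq h1 (hT ▸ hlt)
  exact ⟨c, hc, hc', hval.trans hT, hT, h1⟩

end Tower

/-- An auxiliary rational function: it vanishes doubly at the origin, vanishes at infinity and
equals `c ^ 2` at the nonzero roots `c` of `y ^ l + y`. -/
def squareAtRoots {K : Type} [Field K] (l : ℕ) (x : K) : K :=
  x ^ 2 / (1 + x ^ (l - 1) + (x ^ (l - 1)) ^ 2)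

section

variable {K Γ : Type} [Field K] [LinearOrderedCommGroupWithZero Γ] {v : Valuation K Γ} {l : ℕ}
  {x : K}

theorem map_squareAtRoots_of_lt (hl : 3 ≤ l) (hx : v x < 1) :
    v (squareAtRoots l x) = v x ^ 2 := by
  have h1 : v (x ^ (l - 1)) < 1 := by
    rw [map_pow]; exact pow_lt_one₀ zero_le hx (by omega)
  have h2 : v (1 + x ^ (l - 1)) = 1 := by rw [v.map_one_add_of_lt h1]
  rw [squareAtRoots, map_div₀, map_pow, Valuation.map_add_eq_of_lt_left, h2, div_one]
  rw [h2, map_pow]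
  exact pow_lt_one₀ zero_le h1 two_ne_zero

theorem map_squareAtRoots_of_one_lt (hl : 3 ≤ l) (hx : 1 < v x) :
    v (squareAtRoots l x) ≤ (v x)⁻¹ := by
  have h0 : 0 < v x := zero_lt_one.trans hx
  have h1 : 1 < v (x ^ (l - 1)) := by
    rw [map_pow]; exact one_lt_pow₀ hx (by omega)
  have h2 : v (1 + x ^ (l - 1)) = v (x ^ (l - 1)) :=
    v.map_add_eq_of_lt_right (by rwa [map_one])
  have h3 : v (1 + x ^ (l - 1) + (x ^ (l - 1)) ^ 2) = v (x ^ (l - 1)) ^ 2 := by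
    rw [← map_pow]
    refine v.map_add_eq_of_lt_right ?_
    rw [h2, map_pow v _ 2]
    exact lt_self_pow₀ h1 one_lt_two
  rw [squareAtRoots, map_div₀, h3, map_pow, map_pow, ← pow_mul, div_le_iff₀ (pow_pos h0 _),
    ← div_eq_inv_mul, le_div_iff₀ h0, ← pow_succ]
  exact pow_le_pow_right₀ hx.le (by omega)

theorem map_squareAtRoots_sub (hl : 3 ≤ l) {c : K} (hx : v x = 1) (hc : v c = 1)
    (hlt : v (x ^ l + x) < 1) (h : v (x - c) = v (x ^ l + x)) :
    v (squareAtRoots l x - c ^ 2) ≤ v (x ^ l + x) := by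
  set z := x ^ (l - 1) with hz
  have hT : v (z + 1) = v (x ^ l + x) := by
    have : x ^ l + x = x * (z + 1) := by
      rw [hz, mul_add, ← pow_succ', Nat.sub_add_cancel (by omega), mul_one]
    rw [this, map_mul, hx, one_mul]
  have hz1 : v z = 1 := by rw [hz, map_pow, hx, one_pow]
  have hd : v (1 + z + z ^ 2) = 1 := by
    have : 1 + z + z ^ 2 = 1 + z * (z + 1) := by ring
    rw [this, v.map_one_add_of_lt]
    rwa [map_mul, hz1, one_mul, hT]
  have hd0 : 1 + z + z ^ 2 ≠ 0 := by rw [← v.ne_zero_iff, hd]; exact one_ne_zero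
  have he : squareAtRoots l x - c ^ 2
      = ((x - c) * (x + c) - c ^ 2 * z * (z + 1)) / (1 + z + z ^ 2) := by
    rw [squareAtRoots, ← hz]
    field_simp
    ring
  rw [he, map_div₀, hd, div_one]
  refine v.map_sub_le ?_ ?_
  · rw [map_mul, h]
    exact mul_le_of_le_one_right' (v.map_add_le hx.le hc.le)
  · rw [map_mul, map_mul, map_pow, hc, hz1, hT, one_pow, one_mul, one_mul]

end

namespace Tower

variable {k K Γ : Type} [Field k] [Fintype k] [Field K] [Algebra k K] {l m : ℕ}
  [LinearOrderedCommGroupWithZero Γ] (X : Tower k K l m) {v : Valuation K Γ}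

include X

theorem map_next_of_root {i : ℕ} (hi : i < m) (h1 : v (X.x i) = 1)
    (hlt : v (X.x i ^ l + X.x i) < 1) :
    1 < v (X.x (i + 1)) ∧ v (X.x (i + 1)) ^ l = (v (X.x i ^ l + X.x i))⁻¹ := by
  have hU : v (X.x (i + 1) ^ l + X.x (i + 1)) = (v (X.x i ^ l + X.x i))⁻¹ := by
    rw [X.rel i hi, map_div₀, map_pow, h1, one_pow, one_div]
  have h3 : 1 < v (X.x (i + 1)) := by
    refine v.one_lt_of_pow_add_self (l := l) ?_
    rw [hU]
    exact (one_lt_inv₀ (zero_lt_iff.2 (v.ne_zero_iff.2 (X.pow_add_self_ne_zero hi.le)))).2 hlt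
  exact ⟨h3, by rw [← hU, v.map_pow_add_self_of_one_lt X.two_le h3]⟩

/-- The poles of `x (i + j)` and `(x (i - j))⁻¹` cancel when `x i` is congruent to a nonzero root
of `y ^ l + y`. -/
theorem map_reflect_le {i : ℕ} {c : k} (hc : c ^ l + c = 0) (h1 : v (X.x i) = 1)
    (hlt : v (X.x i ^ l + X.x i) < 1)
    (hval : v (X.x i - algebraMap k K c) = v (X.x i ^ l + X.x i))
    (hsmall : ∀ j < i, v (X.x j) < 1) {j : ℕ} (hj : j < i) (hm : i + (j + 1) ≤ m) :
    v (X.x (i + (j + 1)) + algebraMap k K c ^ 2 * (X.x (i - (j + 1)))⁻¹) ≤ 1 := by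
  set ω := algebraMap k K c with hω
  have hωl : ω ^ l = -ω := by
    rw [eq_neg_iff_add_eq_zero, hω, ← map_pow, ← map_add, hc, map_zero]
  have hω1 : v ω ≤ 1 := v.map_algebraMap_le_of_fintype c
  have hmul (y : K) : (ω ^ 2 * y) ^ l + ω ^ 2 * y = ω ^ 2 * (y ^ l + y) := by
    rw [mul_pow, ← pow_mul, mul_comm 2, pow_mul, hωl]; ring
  have hsub {y : K} (hy : 1 < v y) : v (y ^ 2 / (y ^ l + y)) ≤ 1 := by
    rw [map_div₀, v.map_pow_add_self_of_one_lt X.two_le hy, map_pow]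
    exact div_le_one_of_le₀ (pow_le_pow_right₀ hy.le X.two_le) zero_le
  have hred {j : ℕ} (hj : j < i) (hm : i + (j + 1) ≤ m)
      (h : v (X.x (i + j) ^ (l + 1) / (X.x (i + j) ^ l + X.x (i + j)) +
        ω ^ 2 * (X.x (i - j) ^ l + X.x (i - j))⁻¹) ≤ 1) :
      v (X.x (i + (j + 1)) + ω ^ 2 * (X.x (i - (j + 1)))⁻¹) ≤ 1 := by
    refine v.map_le_one_of_pow_add_self X.two_le ?_
    rw [← X.rel _ (by omega), show i - j = i - (j + 1) + 1 by omega,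
      ← X.pow_add_self_inv (by omega), ← hmul] at h
    rw [add_pow_of_card X.card_eq]
    convert h using 2
    rw [add_assoc i j 1]
    ring
  induction j with
  | zero =>
    refine hred hj hm ?_
    have hT0 := X.pow_add_self_ne_zero (j := i) (by omega)
    have he : X.x (i + 0) ^ (l + 1) / (X.x (i + 0) ^ l + X.x (i + 0)) +
        ω ^ 2 * (X.x (i - 0) ^ l + X.x (i - 0))⁻¹ =
        (X.x i - ω) * (-ω + ω * (X.x i - ω) ^ (l - 1) + (X.x i - ω) ^ l) /
          (X.x i ^ l + X.x i) := by
      have hp : (X.x i - ω) * (X.x i - ω) ^ (l - 1) = X.x i ^ l + ω := by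
        rw [← pow_succ', Nat.sub_add_cancel (by have := X.three_le; omega),
          sub_pow_of_card X.card_eq, hωl, sub_neg_eq_add]
      have hp' : (X.x i - ω) ^ l = X.x i ^ l + ω := by
        rw [sub_pow_of_card X.card_eq, hωl, sub_neg_eq_add]
      rw [add_zero, Nat.sub_zero, hp', ← div_eq_mul_inv, ← add_div]
      congr 1
      linear_combination (-ω) * hp
    rw [he, map_div₀, map_mul, hval]
    refine div_le_of_le_mul₀ zero_le zero_le ?_
    rw [one_mul]
    have hx : v (X.x i - ω) ≤ 1 := hval ▸ hlt.le
    refine mul_le_of_le_one_right' (v.map_add_le (v.map_add_le ?_ ?_) ?_)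
    · rwa [v.map_neg]
    · rw [map_mul, map_pow]; exact mul_le_one' hω1 (pow_le_one' hx _)
    · rw [map_pow]; exact pow_le_one' hx _
  | succ j ih =>
    have hgt : 1 < v (X.x (i + (j + 1))) :=
      X.one_lt (X.map_next_of_root (by omega) h1 hlt).1 (by omega) (by omega)
    have h0 : X.x (i - (j + 1)) ≠ 0 := X.ne_zero (by omega)
    have hgt' : 1 < v (X.x (i - (j + 1)))⁻¹ := by
      rw [map_inv₀]
      exact (one_lt_inv₀ (zero_lt_iff.2 (v.ne_zero_iff.2 h0))).2 (hsmall _ (by omega))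
    refine hred hj hm ?_
    have hT := X.pow_add_self_ne_zero (j := i + (j + 1)) (by omega)
    have hT' := X.pow_add_self_ne_zero (j := i - (j + 1)) (by omega)
    have e1 (y : K) (hy : y ^ l + y ≠ 0) :
        y ^ (l + 1) / (y ^ l + y) = y - y ^ 2 / (y ^ l + y) := by
      field_simp
      ring
    have e2 (y : K) (h0 : y ≠ 0) (hy : y ^ l + y ≠ 0) :
        (y ^ l + y)⁻¹ = y⁻¹ - y⁻¹ ^ 2 / (y⁻¹ ^ l + y⁻¹) := by
      have : y⁻¹ ^ l + y⁻¹ = (y ^ l + y) / (y ^ l * y) := by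
        rw [inv_pow]
        field_simp
        ring
      rw [this]
      field_simp
      ring
    have e3 (a b c d : K) : a - b + ω ^ 2 * (c - d) = a + ω ^ 2 * c - (b + ω ^ 2 * d) := by ring
    rw [e1 _ hT, e2 _ h0 hT', e3]
    refine v.map_sub_le (ih (by omega) (by omega)) (v.map_add_le (hsub hgt) ?_)
    rw [map_mul, map_pow]
    exact mul_le_one' (pow_le_one' hω1 _) (hsub hgt')

end Tower

namespace Tower

open Finset

variable {k K Γ : Type} [Field k] [Fintype k] [Field K] [Algebra k K] {l m : ℕ}
  [LinearOrderedCommGroupWithZero Γ] (X : Tower k K l m) {v : Valuation K Γ}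

/-- A summand of the correction to `x j`, cancelling its pole at the zeros of `x 0` at which
`x i` is a nonzero root of `y ^ l + y`. -/
def term (j i : ℕ) : K := squareAtRoots l (X.x i) ^ l ^ m * (X.x (2 * i - j))⁻¹

/-- The function `x j` with its poles of order larger than one over the zeros of `x 0` removed. -/
def y (j : ℕ) : K := X.x j + ∑ i ∈ range j with j ≤ 2 * i, X.term j i

theorem pos {j : ℕ} (hj : j ≤ m) : 0 < v (X.x j) :=
  zero_lt_iff.2 (v.ne_zero_iff.2 (X.ne_zero hj))

include X in
theorem l_pos : 0 < l := by have := X.three_le; omega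

theorem map_term_le_of_small {i j : ℕ} (hi : i ≤ m) (hsmall : ∀ s ≤ i, v (X.x s) < 1)
    (hj : i < j) : v (X.term j i) ≤ 1 := by
  have h2 : X.x (2 * i - j) ≠ 0 := X.ne_zero (by omega)
  have hpos : 0 < v (X.x (2 * i - j)) := X.pos (by omega)
  rw [term, map_mul, map_inv₀, ← div_eq_mul_inv, div_le_one₀ hpos, map_pow,
    map_squareAtRoots_of_lt X.three_le (hsmall i le_rfl), X.pow_of_lt_one hi hsmall le_rfl,
    X.pow_of_lt_one hi hsmall (show 2 * i - j ≤ i by omega), ← pow_mul, ← pow_mul]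
  refine pow_le_pow_right_of_le_one' (hsmall 0 (by omega)).le ?_
  have h3 : l ^ (2 * i - j) ≤ l ^ i := Nat.pow_le_pow_right X.l_pos (by omega)
  have h4 : 1 ≤ 2 * l ^ m := by have := Nat.pow_pos (n := m) X.l_pos; omega
  exact h3.trans (Nat.le_mul_of_pos_right _ h4)

/-- At the zero `v` of `x 0`, the first of the `x s` not vanishing is `x i`, congruent to the
nonzero root `c` of `y ^ l + y`. -/
structure IsRootAt (v : Valuation K Γ) (i : ℕ) (c : k) : Prop where
  pos : 0 < i
  le : i ≤ m
  small : ∀ s < i, v (X.x s) < 1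
  ne_zero : c ≠ 0
  root : c ^ l + c = 0
  val : v (X.x i) = 1
  val_pow_add : v (X.x i ^ l + X.x i) = v (X.x 0) ^ l ^ i
  val_sub : v (X.x i - algebraMap k K c) = v (X.x 0) ^ l ^ i

theorem exists_isRootAt (h : v (X.x 0) < 1) :
    (∀ s ≤ m, v (X.x s) < 1) ∨ ∃ i c, X.IsRootAt v i c := by
  classical
  by_cases hall : ∀ s ≤ m, v (X.x s) < 1
  · exact .inl hall
  · right
    push Not at hall
    obtain ⟨hm, h1⟩ := Nat.find_spec hall
    have hmin : ∀ s < Nat.find hall, v (X.x s) < 1 := by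
      intro s hs
      by_contra! hcon
      exact Nat.find_min hall hs ⟨by omega, hcon⟩
    obtain ⟨i, hi⟩ : ∃ i, Nat.find hall = i + 1 := by
      refine Nat.exists_eq_add_one_of_ne_zero fun h0 => ?_
      rw [h0] at h1
      exact h1.not_gt h
    rw [hi] at hm h1 hmin
    obtain ⟨c, hc0, hc, hs, hp, hv⟩ := X.exists_root (by omega) (fun s hs => hmin s (by omega)) h1
    exact ⟨i + 1, c, by omega, hm, hmin, hc0, hc, hv, hp, hs⟩

namespace IsRootAt

variable {X} {i : ℕ} {c : k} (H : X.IsRootAt v i c)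

include H

theorem lt_one : v (X.x 0) ^ l ^ i < 1 :=
  pow_lt_one₀ zero_le (H.small 0 H.pos) (pow_ne_zero _ X.l_pos.ne')

theorem pow_of_lt {s : ℕ} (hs : s < i) : v (X.x s) = v (X.x 0) ^ l ^ s :=
  X.pow_of_lt_one (by have := H.le; omega) (fun t ht => H.small t (by omega)) le_rfl

theorem next (hi : i < m) :
    1 < v (X.x (i + 1)) ∧ v (X.x (i + 1)) ^ l = (v (X.x 0) ^ l ^ i)⁻¹ := by
  rw [← H.val_pow_add]
  exact X.map_next_of_root hi H.val (H.val_pow_add ▸ H.lt_one)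

theorem one_lt {s : ℕ} (his : i < s) (hs : s ≤ m) : 1 < v (X.x s) :=
  X.one_lt (H.next (by omega)).1 (by omega) hs

theorem le_map {s : ℕ} (hs : s ≤ m) : v (X.x 0) ^ l ^ i ≤ v (X.x s) := by
  rcases lt_trichotomy s i with hsi | rfl | hsi
  · rw [H.pow_of_lt hsi]
    exact pow_le_pow_right_of_le_one' (H.small 0 H.pos).le (Nat.pow_le_pow_right X.l_pos hsi.le)
  · rw [H.val]; exact H.lt_one.le
  · exact H.lt_one.le.trans (H.one_lt hsi hs).le

theorem map_term_le_of_gt {i' j : ℕ} (hi : i < i') (hi' : i' ≤ m) (hj : i' < j) :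
    v (X.term j i') ≤ 1 := by
  have hpos : 0 < v (X.x (2 * i' - j)) := X.pos (by omega)
  rw [term, map_mul, map_inv₀, ← div_eq_mul_inv, div_le_one₀ hpos, map_pow]
  refine le_trans ?_ (H.le_map (by omega))
  have h1 := H.one_lt hi hi'
  refine (pow_le_pow_left₀ zero_le (map_squareAtRoots_of_one_lt X.three_le h1) _).trans ?_
  rw [inv_pow, inv_le_comm₀ (pow_pos (zero_lt_one.trans h1) _) (pow_pos (X.pos (by omega)) _)]
  obtain ⟨a, rfl⟩ := Nat.exists_eq_add_of_lt hi
  obtain ⟨h2, h3⟩ := H.next (by omega)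
  have h4 := (X.pow_of_one_lt h2 (a := a) (by omega)).2
  rw [← h3, ← h4, ← pow_mul, ← pow_succ]
  rw [show i + 1 + a = i + a + 1 by omega]
  exact pow_le_pow_right₀ h1.le (Nat.pow_le_pow_right X.l_pos (by omega))

theorem map_x_add_term_le {j : ℕ} (hij : i < j) (hj : j ≤ 2 * i) (hm : j ≤ m) :
    v (X.x j + X.term j i) ≤ 1 := by
  have hlt := H.lt_one
  rw [← H.val_pow_add] at hlt
  have hval : v (X.x i - algebraMap k K c) = v (X.x i ^ l + X.x i) := by
    rw [H.val_sub, H.val_pow_add]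
  have hrefl := X.map_reflect_le H.root H.val hlt hval H.small (j := j - i - 1)
    (by omega) (by omega)
  rw [show i + (j - i - 1 + 1) = j by omega, show i - (j - i - 1 + 1) = 2 * i - j by omega]
    at hrefl
  have hh := map_squareAtRoots_sub X.three_le H.val (v.map_algebraMap_of_fintype H.ne_zero)
    hlt hval
  set ω := algebraMap k K c with hω
  have hω2 : (ω ^ 2) ^ l ^ m = ω ^ 2 := by
    have hωl : ω ^ l = -ω := by
      rw [eq_neg_iff_add_eq_zero, hω, ← map_pow, ← map_add, H.root, map_zero]
    have (n : ℕ) : (ω ^ 2) ^ l ^ n = ω ^ 2 := by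
      induction n with
      | zero => simp
      | succ n ih => rw [pow_succ l, pow_mul, ih, ← pow_mul, mul_comm, pow_mul, hωl, neg_sq]
    exact this m
  have hfrob (a b : K) : (a - b) ^ l ^ m = a ^ l ^ m - b ^ l ^ m := by
    have (n : ℕ) : (a - b) ^ l ^ n = a ^ l ^ n - b ^ l ^ n := by
      induction n with
      | zero => simp
      | succ n ih => rw [pow_succ, pow_mul, ih, sub_pow_of_card X.card_eq, pow_mul, pow_mul]
    exact this m
  have he : X.x j + X.term j i = (X.x j + ω ^ 2 * (X.x (2 * i - j))⁻¹) +
      (squareAtRoots l (X.x i) - ω ^ 2) ^ l ^ m * (X.x (2 * i - j))⁻¹ := by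
    rw [hfrob, hω2, term]; ring
  rw [he]
  refine v.map_add_le hrefl ?_
  have hpos : 0 < v (X.x (2 * i - j)) := X.pos (by omega)
  rw [map_mul, map_inv₀, ← div_eq_mul_inv, div_le_one₀ hpos, map_pow]
  refine le_trans ?_ (H.le_map (by omega))
  rw [← H.val_pow_add]
  refine (pow_le_pow_left₀ zero_le hh _).trans ?_
  exact pow_le_of_le_one zero_le hlt.le (pow_ne_zero _ X.l_pos.ne')

theorem map_term_le {j i' : ℕ} (hi' : i' < j) (hj : j ≤ m) (hne : i' ≠ i) :
    v (X.term j i') ≤ 1 := by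
  rcases lt_or_gt_of_ne hne with h | h
  · exact X.map_term_le_of_small (by omega) (fun s hs => H.small s (by omega)) hi'
  · exact H.map_term_le_of_gt h (by omega) hi'

theorem map_y_le_one {j : ℕ} (hj : j ≤ 2 * i) (hm : j ≤ m) : v (X.y j) ≤ 1 := by
  rw [y]
  rcases lt_or_ge i j with hij | hij
  · have hmem : i ∈ (range j).filter fun i => j ≤ 2 * i := by simp; omega
    rw [← add_sum_erase _ _ hmem, ← add_assoc]
    refine v.map_add_le (H.map_x_add_term_le hij hj hm) (v.map_sum_le fun i' hi' => ?_)
    simp only [mem_erase, mem_filter, mem_range] at hi'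
    exact H.map_term_le hi'.2.1 hm hi'.1
  · refine v.map_add_le ?_ (v.map_sum_le fun i' hi' => ?_)
    · rcases hij.lt_or_eq with h | rfl
      · exact (H.small _ h).le
      · exact H.val.le
    · simp only [mem_filter, mem_range] at hi'
      exact H.map_term_le hi'.1 hm (by omega)

theorem map_y_le {j : ℕ} (hj : 2 * i < j) (hm : j ≤ m) : v (X.y j) ≤ v (X.x j) := by
  refine v.map_add_le le_rfl (v.map_sum_le fun i' hi' => ?_)
  simp only [mem_filter, mem_range] at hi'
  exact (H.map_term_le hi'.1 hm (by omega)).trans (H.one_lt (by omega) hm).le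

theorem map_x_two_mul_le (hm : 2 * i ≤ m) : v (X.x 0) * v (X.x (2 * i)) ≤ 1 := by
  have h0 := H.pos
  have hlt := H.lt_one
  rw [← H.val_pow_add] at hlt
  have hrefl := X.map_reflect_le H.root H.val hlt (by rw [H.val_sub, H.val_pow_add]) H.small
    (j := i - 1) (by omega) (by omega)
  rw [show i + (i - 1 + 1) = 2 * i by omega, show i - (i - 1 + 1) = 0 by omega] at hrefl
  have hpos : 0 < v (X.x 0) := X.pos (by omega)
  rw [mul_comm, ← le_div_iff₀ hpos, one_div]
  have he : X.x (2 * i) = (X.x (2 * i) + algebraMap k K c ^ 2 * (X.x 0)⁻¹) -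
      algebraMap k K c ^ 2 * (X.x 0)⁻¹ := by ring
  rw [he]
  have h1 : 1 ≤ (v (X.x 0))⁻¹ := (one_le_inv₀ hpos).2 (H.small 0 h0).le
  refine v.map_sub_le (hrefl.trans h1) ?_
  rw [map_mul, map_pow, v.map_algebraMap_of_fintype H.ne_zero, one_pow, one_mul, map_inv₀]

end IsRootAt

/-- The products of the `y j` have at most simple poles, relative to `x 0`, at the zeros
of `x 0`. -/
theorem map_prod_y_le (h : v (X.x 0) < 1) {a : ℕ → ℕ} (ha : ∀ j, a j < l) :
    v (X.x 0 * ∏ j ∈ range m, X.y (j + 1) ^ a j) ≤ 1 := by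
  rw [map_mul, map_prod]
  rcases X.exists_isRootAt h with hall | ⟨i, c, H⟩
  · refine mul_le_one' h.le (prod_le_one' fun j hj => ?_)
    rw [mem_range] at hj
    rw [map_pow]
    refine pow_le_one' (v.map_add_le (hall _ (by omega)).le (v.map_sum_le fun i hi => ?_)) _
    simp only [mem_filter, mem_range] at hi
    exact X.map_term_le_of_small (by omega) (fun s hs => hall s (by omega)) (by omega)
  · have hle : ∀ n ≤ m, n ≤ 2 * i → ∏ j ∈ range n, v (X.y (j + 1) ^ a j) ≤ 1 := by
      refine fun n hn hni => prod_le_one' fun j hj => ?_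
      rw [mem_range] at hj
      rw [map_pow]
      exact pow_le_one' (H.map_y_le_one (by omega) (by omega)) _
    have hge : ∀ n, 2 * i + n ≤ m →
        v (X.x 0) * (∏ j ∈ range (2 * i + n), v (X.y (j + 1) ^ a j)) * v (X.x (2 * i + n)) ≤ 1 := by
      intro n
      induction n with
      | zero =>
        intro hm
        have h1 := H.map_x_two_mul_le hm
        have h2 := hle (2 * i) hm le_rfl
        rw [add_zero, mul_right_comm]
        exact mul_le_one' h1 h2
      | succ n ih =>
        intro hm
        refine le_trans ?_ (ih (by omega))
        have hj : i < 2 * i + n + 1 := by omega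
        have hgt := H.one_lt hj hm
        rw [← add_assoc, prod_range_succ, ← mul_assoc, mul_assoc]
        refine mul_le_mul_right ?_ _
        have hpow : v (X.x (2 * i + n + 1)) ^ l = v (X.x (2 * i + n)) := by
          have h0 := H.pos
          rcases (show i < 2 * i + n by omega) with h'
          exact (X.step_of_one_lt (by omega) (H.one_lt h' (by omega))).2
        rw [map_pow, ← hpow]
        refine (mul_le_mul_left (pow_le_pow_left₀ zero_le (H.map_y_le (by omega) hm) _) _).trans ?_
        exact (pow_succ (v (X.x (2 * i + n + 1))) _).symm.trans_le (pow_le_pow_right₀ hgt.le (ha _))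
    rcases le_total m (2 * i) with hm | hm
    · exact mul_le_one' h.le (hle m le_rfl hm)
    · obtain ⟨n, rfl⟩ := Nat.exists_eq_add_of_le hm
      refine le_trans ?_ (hge n le_rfl)
      refine le_mul_of_one_le_right' ?_
      have h0 := H.pos
      exact (H.one_lt (show i < 2 * i + n by omega) le_rfl).le

end Tower

open Polynomial in
theorem exists_sum_of_mem_adjoin {R A : Type} [CommRing R] [Nontrivial R] [CommRing A] [Algebra R A]
    {l : ℕ} (hl : 2 ≤ l) {x : A} {u : R} (h : x ^ l + x = algebraMap R A u) {f : A}
    (hf : f ∈ Algebra.adjoin R {x}) :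
    ∃ c : ℕ → R, f = ∑ a ∈ Finset.range l, algebraMap R A (c a) * x ^ a := by
  rw [Algebra.adjoin_singleton_eq_range_aeval] at hf
  obtain ⟨p, rfl⟩ := hf
  set Q : R[X] := X ^ l + (X - C u) with hQ
  have hlow : (X - C u : R[X]).degree < (l : WithBot ℕ) := by
    rw [degree_X_sub_C]; exact_mod_cast hl
  have hmon : Q.Monic := monic_X_pow_add hlow
  have hdeg : Q.natDegree = l := by
    rw [hQ, natDegree_add_eq_left_of_natDegree_lt] <;> simp; omega
  have hQ0 : aeval x Q = 0 := by simp [hQ, ← h]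
  refine ⟨(p %ₘ Q).coeff, ?_⟩
  have hlt : (p %ₘ Q).natDegree < l := by
    rw [← hdeg]
    refine natDegree_modByMonic_lt p hmon ?_
    rintro h1
    rw [h1, natDegree_one] at hdeg
    omega
  have := aeval_eq_sum_range' hlt x
  simp only [Algebra.smul_def] at this
  rw [← this]
  conv_lhs => rw [← modByMonic_add_div p Q]
  simp [hQ0]

namespace Valuation

theorem exists_map_sum_eq {K Γ : Type} [Field K] [LinearOrderedCommGroupWithZero Γ]
    (v : Valuation K Γ) {n : ℕ} (hn : 0 < n) (t : ℕ → K)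
    (hne : ∀ a < n, ∀ b < n, t a ≠ 0 → v (t a) = v (t b) → a = b) :
    ∃ a < n, v (∑ a ∈ Finset.range n, t a) = v (t a) ∧ ∀ b < n, v (t b) ≤ v (t a) := by
  obtain ⟨a, ha, hmax⟩ := (Finset.range n).exists_max_image (fun a => v (t a))
    ⟨0, Finset.mem_range.2 hn⟩
  simp only [Finset.mem_range] at ha hmax
  refine ⟨a, ha, ?_, hmax⟩
  rcases eq_or_ne (t a) 0 with h0 | h0
  · rw [h0, map_zero, Finset.sum_eq_zero, map_zero]
    intro b hb
    have := hmax b (Finset.mem_range.1 hb)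
    rwa [h0, map_zero, le_zero_iff, v.zero_iff] at this
  · refine v.map_sum_eq_of_lt (Finset.mem_range.2 ha) fun b hb => ?_
    simp only [Finset.mem_sdiff, Finset.mem_range, Finset.mem_singleton] at hb
    exact lt_of_le_of_ne (hmax b hb.1) fun he => hb.2 (hne a ha b hb.1 h0 he.symm).symm

end Valuation

namespace Tower

open Finset WithZero

variable {k K Γ : Type} [Field k] [Fintype k] [Field K] [Algebra k K] {l m : ℕ}
  [LinearOrderedCommGroupWithZero Γ] (X : Tower k K l m) {v : Valuation K Γ}

/-- The field generated by `x 0, …, x j`. -/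
def L : ℕ → IntermediateField k K
  | 0 => IntermediateField.adjoin k {X.x 0}
  | j + 1 => (IntermediateField.adjoin (L j) {X.x (j + 1)}).restrictScalars k

theorem L_le_succ (j : ℕ) : X.L j ≤ X.L (j + 1) := fun f hf =>
  (IntermediateField.adjoin (X.L j) {X.x (j + 1)}).algebraMap_mem ⟨f, hf⟩

theorem L_mono : Monotone X.L := monotone_nat_of_le_succ X.L_le_succ

theorem x_mem_L (j : ℕ) : X.x j ∈ X.L j := by
  cases j with
  | zero => exact IntermediateField.mem_adjoin_simple_self k _
  | succ j => exact IntermediateField.mem_adjoin_simple_self (X.L j) _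

theorem x_mem_L_of_le {i j : ℕ} (h : i ≤ j) : X.x i ∈ X.L j := X.L_mono h (X.x_mem_L i)

theorem exists_sum_of_mem_L {j : ℕ} (hj : j < m) {f : K} (hf : f ∈ X.L (j + 1)) :
    ∃ c : ℕ → K, (∀ a, c a ∈ X.L j) ∧ f = ∑ a ∈ range l, c a * X.x (j + 1) ^ a := by
  have hu : X.x j ^ (l + 1) / (X.x j ^ l + X.x j) ∈ X.L j :=
    div_mem (pow_mem (X.x_mem_L j) _) (add_mem (pow_mem (X.x_mem_L j) _) (X.x_mem_L j))
  have hrel : X.x (j + 1) ^ l + X.x (j + 1) = algebraMap (X.L j) K ⟨_, hu⟩ := X.rel j hj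
  have hinteg : IsIntegral (X.L j) (X.x (j + 1)) := by
    refine ⟨Polynomial.X ^ l + (Polynomial.X - Polynomial.C ⟨_, hu⟩),
      Polynomial.monic_X_pow_add ?_, ?_⟩
    · rw [Polynomial.degree_X_sub_C]; exact_mod_cast X.two_le
    · simp [Polynomial.eval₂_add, Polynomial.eval₂_sub, ← hrel]
  have hmem : f ∈ (IntermediateField.adjoin (X.L j) {X.x (j + 1)}).toSubalgebra := hf
  rw [IntermediateField.adjoin_simple_toSubalgebra_of_isAlgebraic hinteg.isAlgebraic] at hmem
  obtain ⟨c, hc⟩ := exists_sum_of_mem_adjoin X.two_le hrel hmem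
  exact ⟨fun a => c a, fun a => (c a).2, hc⟩

/-- Nonzero elements of the rational function field have the same order at all poles of `x 0`. -/
theorem exists_zpow_of_mem_L_zero {f : K} (hf : f ∈ X.L 0) (h0 : f ≠ 0) :
    ∃ d : ℤ, ∀ {Γ : Type} [LinearOrderedCommGroupWithZero Γ] (v : Valuation K Γ),
      1 < v (X.x 0) → v f = v (X.x 0) ^ d := by
  obtain ⟨r, s, rfl⟩ := IntermediateField.mem_adjoin_simple_iff k f |>.1 hf
  have hr : r ≠ 0 := by rintro rfl; simp at h0
  have hs : s ≠ 0 := by rintro rfl; simp at h0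
  refine ⟨r.natDegree - s.natDegree, fun v hv => ?_⟩
  have : v.IsTrivialOn k := ⟨fun c hc => v.map_algebraMap_of_fintype hc⟩
  rw [map_div₀,
    Polynomial.valuation_aeval_eq_valuation_X_pow_natDegree_of_one_lt_valuation_X _ hv hr,
    Polynomial.valuation_aeval_eq_valuation_X_pow_natDegree_of_one_lt_valuation_X _ hv hs,
    zpow_sub₀ (zero_lt_one.trans hv).ne', zpow_natCast, zpow_natCast]

theorem pow_last {j : ℕ} (h : 1 < v (X.x 0)) (hj : j ≤ m) :
    v (X.x m) ^ l ^ (m - j) = v (X.x j) := by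
  have := (X.pow_of_one_lt (X.one_lt h (Nat.zero_le j) hj) (a := m - j) (by omega)).2
  rwa [Nat.add_sub_cancel' hj] at this

theorem w_x {j : ℕ} (hj : j ≤ m) : X.w (X.x j) = exp ((l : ℤ) ^ (m - j)) := by
  rw [← X.pow_last X.one_lt_w hj, X.w_last, ← exp_nsmul]
  simp

theorem exists_map_sum_eq_of_order {j : ℕ} (hj : j < m)
    (hord : ∀ c ∈ X.L j, c ≠ 0 → ∃ e : ℤ, X.w c = exp (e * l ^ (m - j)))
    (c : ℕ → K) (hc : ∀ a, c a ∈ X.L j) :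
    ∃ a < l, X.w (∑ a ∈ range l, c a * X.x (j + 1) ^ a) = X.w (c a * X.x (j + 1) ^ a) ∧
      ∀ b < l, X.w (c b * X.x (j + 1) ^ b) ≤ X.w (c a * X.x (j + 1) ^ a) := by
  have hx0 : X.x (j + 1) ≠ 0 := X.ne_zero hj
  have hw (a : ℕ) (h0 : c a ≠ 0) : ∃ e : ℤ, X.w (c a * X.x (j + 1) ^ a) =
      exp ((e * l + a) * l ^ (m - (j + 1))) := by
    obtain ⟨e, he⟩ := hord _ (hc a) h0
    refine ⟨e, ?_⟩
    rw [map_mul, map_pow, he, X.w_x hj, ← exp_nsmul, ← exp_add,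
      show m - j = m - (j + 1) + 1 by omega]
    congr 1
    simp only [nsmul_eq_mul]
    ring
  refine X.w.exists_map_sum_eq X.l_pos _ fun a ha b hb h0 hab => ?_
  have ha0 : c a ≠ 0 := left_ne_zero_of_mul h0
  have hb0 : c b ≠ 0 := by
    rintro hb0
    rw [hb0, zero_mul, map_zero, X.w.zero_iff] at hab
    exact h0 hab
  obtain ⟨e, he⟩ := hw a ha0
  obtain ⟨e', he'⟩ := hw b hb0
  rw [he, he', exp_inj] at hab
  have hl0 : (l : ℤ) ^ (m - (j + 1)) ≠ 0 := pow_ne_zero _ (by exact_mod_cast X.l_pos.ne')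
  have h1 := mul_right_cancel₀ hl0 hab
  have h2 : ((a : ℤ) - b) = (e' - e) * l := by linarith
  have h3 : (l : ℤ) ∣ a - b := ⟨e' - e, by linarith⟩
  have h4 : (a : ℤ) - b = 0 := Int.eq_zero_of_abs_lt_dvd h3 (by rw [abs_lt]; omega)
  omega

theorem exists_order {j : ℕ} (hj : j ≤ m) {f : K} (hf : f ∈ X.L j) (h0 : f ≠ 0) :
    ∃ e : ℤ, X.w f = exp (e * l ^ (m - j)) := by
  induction j generalizing f with
  | zero =>
    obtain ⟨d, hd⟩ := X.exists_zpow_of_mem_L_zero hf h0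
    refine ⟨d, ?_⟩
    rw [hd X.w X.one_lt_w, X.w_x hj, ← exp_zsmul, smul_eq_mul]
  | succ j ih =>
    obtain ⟨c, hc, rfl⟩ := X.exists_sum_of_mem_L hj hf
    obtain ⟨a, ha, hsum, -⟩ := X.exists_map_sum_eq_of_order hj
      (fun c hc hc0 => ih (by omega) hc hc0) c hc
    have h1 : c a * X.x (j + 1) ^ a ≠ 0 := by
      rw [← X.w.ne_zero_iff, ← hsum, X.w.ne_zero_iff]; exact h0
    obtain ⟨e, he⟩ := ih (by omega) (hc a) (left_ne_zero_of_mul h1)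
    refine ⟨e * l + a, ?_⟩
    rw [hsum, map_mul, map_pow, he, X.w_x hj, ← exp_nsmul, ← exp_add,
      show m - j = m - (j + 1) + 1 by omega]
    congr 1
    simp only [nsmul_eq_mul]
    ring

theorem map_mul_pow_le {j : ℕ} (hj : j < m) {c : ℕ → K} (hc : ∀ a, c a ∈ X.L j) {a : ℕ}
    (ha : a < l) : X.w (c a * X.x (j + 1) ^ a) ≤
      X.w (∑ a ∈ range l, c a * X.x (j + 1) ^ a) := by
  obtain ⟨b, -, hsum, hb⟩ := X.exists_map_sum_eq_of_order hj
    (fun c hc hc0 => X.exists_order hj.le hc hc0) c hc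
  rw [hsum]
  exact hb a ha

theorem eq_zero_of_sum_eq_zero {j : ℕ} (hj : j < m) {c : ℕ → K} (hc : ∀ a, c a ∈ X.L j)
    (h : ∑ a ∈ range l, c a * X.x (j + 1) ^ a = 0) {a : ℕ} (ha : a < l) : c a = 0 := by
  have := X.map_mul_pow_le hj hc ha
  rw [h, map_zero, le_zero_iff, X.w.zero_iff] at this
  exact (mul_eq_zero.1 this).resolve_right (pow_ne_zero _ (X.ne_zero hj))

/-- Total ramification: an order bound at one pole of `x 0` holds at all of them. -/
theorem map_lt_of_w_lt (hv : 1 < v (X.x 0)) {j : ℕ} (hj : j ≤ m) {f : K} (hf : f ∈ X.L j) {d : ℤ}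
    (h : X.w f < exp d) : v f < v (X.x m) ^ d := by
  have hm : 1 < v (X.x m) := X.one_lt hv (Nat.zero_le _) le_rfl
  have hm0 : v (X.x m) ≠ 0 := (zero_lt_one.trans hm).ne'
  induction j generalizing f d with
  | zero =>
    rcases eq_or_ne f 0 with rfl | h0
    · rw [map_zero]; exact zpow_pos (zero_lt_one.trans hm) _
    obtain ⟨e, he⟩ := X.exists_zpow_of_mem_L_zero hf h0
    rw [he X.w X.one_lt_w, X.w_x hj, ← exp_zsmul, exp_lt_exp, smul_eq_mul] at h
    rw [he v hv, ← X.pow_last hv hj, ← zpow_natCast, ← zpow_mul]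
    refine zpow_lt_zpow_right₀ hm ?_
    rw [mul_comm]
    exact_mod_cast h
  | succ j ih =>
    obtain ⟨c, hc, rfl⟩ := X.exists_sum_of_mem_L hj hf
    refine v.map_sum_lt (zpow_ne_zero _ hm0) fun a ha => ?_
    have h1 := (X.map_mul_pow_le hj hc (mem_range.1 ha)).trans_lt h
    rw [map_mul, map_pow, X.w_x hj, ← exp_nsmul,
      ← lt_div_iff₀ (zero_lt_iff.2 exp_ne_zero), ← exp_sub] at h1
    have h2 := ih (by omega) (hc a) h1
    rw [map_mul, map_pow, ← X.pow_last hv hj, ← lt_div_iff₀ (pow_pos (pow_pos (zero_lt_one.trans hm)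
      _) _), ← pow_mul, ← zpow_natCast (v (X.x m)) (l ^ (m - (j + 1)) * a), ← zpow_sub₀ hm0]
    convert h2 using 3
    push_cast
    simp [mul_comm]

end Tower

theorem Nat.digit_eq_zero {l n s b : ℕ} (hl : 0 < l) (hb : b < l ^ n) (hs : n ≤ s) :
    b / l ^ s % l = 0 := by
  rw [Nat.div_eq_of_lt (hb.trans_le (Nat.pow_le_pow_right hl hs)), Nat.zero_mod]

theorem Nat.digit_add_of_lt {l n s b a : ℕ} (hl : 0 < l) (hs : s < n) :
    (b + a * l ^ n) / l ^ s % l = b / l ^ s % l := by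
  obtain ⟨t, rfl⟩ := Nat.exists_eq_add_of_lt hs
  rw [show a * l ^ (s + t + 1) = l ^ s * (a * l ^ t * l) by ring,
    Nat.add_mul_div_left _ _ (Nat.pow_pos hl), Nat.add_mul_mod_self_right]

namespace Tower

open Finset

variable {k K Γ : Type} [Field k] [Fintype k] [Field K] [Algebra k K] {l m : ℕ}
  [LinearOrderedCommGroupWithZero Γ] (X : Tower k K l m) {v : Valuation K Γ}

/-- The products of the `t 1, …, t m` with exponents the base `l` digits of `b`. -/
def digitProd (l m : ℕ) (t : ℕ → K) (b : ℕ) : K := ∏ s ∈ range m, t (s + 1) ^ (b / l ^ s % l)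

theorem digitProd_add (t : ℕ → K) {l : ℕ} (hl : 0 < l) {j b a : ℕ} (hj : j < m) (hb : b < l ^ j)
    (ha : a < l) : digitProd l m t (b + a * l ^ j) = digitProd l m t b * t (j + 1) ^ a := by
  obtain ⟨n, rfl⟩ := Nat.exists_eq_add_of_lt hj
  have hlt : b + a * l ^ j < l ^ (j + 1) := by
    calc b + a * l ^ j < l ^ j + a * l ^ j := by omega
      _ = (a + 1) * l ^ j := by ring
      _ ≤ l * l ^ j := Nat.mul_le_mul_right _ ha
      _ = l ^ (j + 1) := by ring
  have hdig : (b + a * l ^ j) / l ^ j % l = a := by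
    rw [Nat.add_mul_div_right _ _ (Nat.pow_pos hl), Nat.div_eq_of_lt hb, zero_add,
      Nat.mod_eq_of_lt ha]
  have hsplit (f : ℕ → K) : ∏ s ∈ range (j + n + 1), f s =
      (∏ s ∈ range j, f s) * (f j * ∏ s ∈ range n, f (j + (1 + s))) := by
    rw [show j + n + 1 = j + (1 + n) by ring, prod_range_add, prod_range_add, prod_range_one,
      add_zero]
  rw [digitProd, digitProd, hsplit, hsplit, hdig, Nat.digit_eq_zero hl hb le_rfl, pow_zero,
    one_mul, prod_congr rfl fun s hs => by rw [Nat.digit_add_of_lt hl (mem_range.1 hs)],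
    mul_assoc, mul_comm (t (j + 1) ^ a)]
  congr 2
  refine prod_congr rfl fun s _ => ?_
  rw [Nat.digit_eq_zero hl hb (by omega), Nat.digit_eq_zero hl hlt (by omega)]

/-- The standard basis of the function field over the rational function field. -/
def mon (b : ℕ) : K := digitProd l m X.x b

/-- The span of the first `n` basis elements over the rational function field. -/
def sp (n : ℕ) : Submodule (X.L 0) K := Submodule.span (X.L 0) (X.mon '' Set.Iio n)

theorem sp_mono : Monotone X.sp := fun _ _ h =>
  Submodule.span_mono (Set.image_mono (Set.Iio_subset_Iio h))

theorem mon_mem_sp {b n : ℕ} (h : b < n) : X.mon b ∈ X.sp n :=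
  Submodule.subset_span ⟨b, h, rfl⟩

theorem mon_mem_L {b j : ℕ} (h : b < l ^ j) : X.mon b ∈ X.L j := by
  rw [mon, digitProd]
  refine prod_mem fun s _ => ?_
  rcases lt_or_ge s j with hs | hs
  · exact pow_mem (X.x_mem_L_of_le hs) _
  · rw [Nat.digit_eq_zero X.l_pos h hs, pow_zero]; exact one_mem _

theorem mul_pow_mem_sp {n j a : ℕ} (hn : n ≤ l ^ j) (hj : j < m) (ha : a < l) {f : K}
    (hf : f ∈ X.sp n) : f * X.x (j + 1) ^ a ∈ X.sp (n + a * l ^ j) := by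
  induction hf using Submodule.span_induction with
  | mem f hf =>
    obtain ⟨b, hb, rfl⟩ := hf
    have hb' : b < n := hb
    rw [mon, ← digitProd_add X.x X.l_pos hj (hb'.trans_le hn) ha]
    exact X.mon_mem_sp (by omega)
  | zero => rw [zero_mul]; exact zero_mem _
  | add f g _ _ hf hg => rw [add_mul]; exact add_mem hf hg
  | smul c f _ hf => rw [smul_mul_assoc]; exact Submodule.smul_mem _ _ hf

theorem mem_sp_of_mem_L {j : ℕ} (hj : j ≤ m) {f : K} (hf : f ∈ X.L j) : f ∈ X.sp (l ^ j) := by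
  induction j generalizing f with
  | zero =>
    have h1 : X.mon 0 = 1 := by simp [mon, digitProd]
    have := Submodule.smul_mem (X.sp (l ^ 0)) (⟨f, hf⟩ : X.L 0) (X.mon_mem_sp (b := 0) (by simp))
    rwa [h1, Algebra.smul_def, mul_one] at this
  | succ j ih =>
    obtain ⟨c, hc, rfl⟩ := X.exists_sum_of_mem_L hj hf
    refine sum_mem fun a ha => ?_
    rw [mem_range] at ha
    refine X.sp_mono ?_ (X.mul_pow_mem_sp le_rfl hj ha (ih (by omega) (hc a)))
    calc l ^ j + a * l ^ j = (a + 1) * l ^ j := by ring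
      _ ≤ l * l ^ j := Nat.mul_le_mul_right _ ha
      _ = l ^ (j + 1) := by ring

theorem exists_sum_of_mem_sp {n j a : ℕ} (hj : j < m) (hn : n < l ^ j) (ha : a < l) {f : K}
    (hf : f ∈ X.sp (n + a * l ^ j)) :
    ∃ c : ℕ → K, (∀ b, c b ∈ X.L j) ∧ c a ∈ X.sp n ∧
      f = ∑ b ∈ range l, c b * X.x (j + 1) ^ b := by
  induction hf using Submodule.span_induction with
  | mem f hf =>
    obtain ⟨b, hb, rfl⟩ := hf
    replace hb : b < n + a * l ^ j := hb
    have hlj : 0 < l ^ j := Nat.pow_pos X.l_pos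
    have hr : b % l ^ j < l ^ j := Nat.mod_lt _ hlj
    have hdec : b % l ^ j + b / l ^ j * l ^ j = b := by rw [mul_comm]; exact Nat.mod_add_div _ _
    have hq : b / l ^ j ≤ a := by
      refine Nat.lt_succ_iff.1 (Nat.div_lt_of_lt_mul (hb.trans ?_))
      rw [Nat.mul_succ, mul_comm]
      omega
    have hm : X.mon b = X.mon (b % l ^ j) * X.x (j + 1) ^ (b / l ^ j) := by
      rw [mon, mon, ← digitProd_add X.x X.l_pos hj hr (hq.trans_lt ha), hdec]
    refine ⟨fun i => if i = b / l ^ j then X.mon (b % l ^ j) else 0, fun i => ?_, ?_, ?_⟩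
    · dsimp only
      split_ifs
      · exact X.mon_mem_L hr
      · exact zero_mem _
    · dsimp only
      split_ifs with h
      · subst h
        exact X.mon_mem_sp (by omega)
      · exact zero_mem _
    · simp only [ite_mul, zero_mul, sum_ite_eq', mem_range, hq.trans_lt ha, if_true, hm]
  | zero => exact ⟨0, fun _ => zero_mem _, zero_mem _, by simp⟩
  | add f g _ _ hf hg =>
    obtain ⟨c, hc, hca, hcs⟩ := hf
    obtain ⟨d, hd, hda, hds⟩ := hg
    exact ⟨c + d, fun b => add_mem (hc b) (hd b), add_mem hca hda, by
      simp only [Pi.add_apply, add_mul, sum_add_distrib, ← hcs, ← hds]⟩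
  | smul r f _ hf =>
    obtain ⟨c, hc, hca, hcs⟩ := hf
    refine ⟨r • c, fun b => ?_, Submodule.smul_mem _ _ hca, ?_⟩
    · rw [Pi.smul_apply, Algebra.smul_def]
      exact mul_mem (X.L_mono (Nat.zero_le j) r.2) (hc b)
    · simp only [Pi.smul_apply, smul_mul_assoc, ← smul_sum, ← hcs]

theorem mon_notMem_sp {b : ℕ} (hb : b < l ^ m) : X.mon b ∉ X.sp b := by
  have key : ∀ j ≤ m, ∀ b < l ^ j, X.mon b ∉ X.sp b := by
    intro j
    induction j with
    | zero =>
      intro _ b hb h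
      obtain rfl : b = 0 := by simpa using hb
      simp [sp, mon, digitProd] at h
    | succ j ih =>
      intro hj b hb h
      have hlj : 0 < l ^ j := Nat.pow_pos X.l_pos
      have ha : b / l ^ j < l := Nat.div_lt_of_lt_mul (by rwa [← pow_succ])
      have hr : b % l ^ j < l ^ j := Nat.mod_lt _ hlj
      have hdec : b % l ^ j + b / l ^ j * l ^ j = b := by rw [mul_comm]; exact Nat.mod_add_div _ _
      have hm : X.mon b = X.mon (b % l ^ j) * X.x (j + 1) ^ (b / l ^ j) := by
        rw [mon, mon, ← digitProd_add X.x X.l_pos hj hr ha, hdec]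
      have h' : X.mon b ∈ X.sp (b % l ^ j + b / l ^ j * l ^ j) := by rwa [hdec]
      obtain ⟨c, hc, hca, hsum⟩ := X.exists_sum_of_mem_sp hj hr ha h'
      refine ih (by omega) _ hr ?_
      have h0 := X.eq_zero_of_sum_eq_zero hj
        (c := fun a => c a - if a = b / l ^ j then X.mon (b % l ^ j) else 0) (fun a => ?_) ?_ ha
      · rw [if_pos rfl, sub_eq_zero] at h0
        rwa [← h0]
      · refine sub_mem (hc a) ?_
        split_ifs
        · exact X.mon_mem_L hr
        · exact zero_mem _
      · simp only [sub_mul, sum_sub_distrib, ← hsum, ite_mul, zero_mul, sum_ite_eq', mem_range,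
          ha, if_true, ← hm, sub_self]
  exact key m le_rfl b hb

theorem y_sub_mem_L (j : ℕ) : X.y (j + 1) - X.x (j + 1) ∈ X.L j := by
  rw [y, add_sub_cancel_left]
  refine sum_mem fun i hi => ?_
  simp only [mem_filter, mem_range] at hi
  have h1 : X.x i ∈ X.L j := X.x_mem_L_of_le (by omega)
  refine mul_mem (pow_mem (div_mem (pow_mem h1 _) ?_) _) (inv_mem (X.x_mem_L_of_le (by omega)))
  exact add_mem (add_mem (one_mem _) (pow_mem h1 _)) (pow_mem (pow_mem h1 _) _)

theorem digitProd_y_sub_mem {b : ℕ} (hb : b < l ^ m) :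
    digitProd l m X.y b - X.mon b ∈ X.sp b := by
  have key : ∀ j ≤ m, ∀ b < l ^ j, digitProd l m X.y b - X.mon b ∈ X.sp b := by
    intro j
    induction j with
    | zero =>
      intro _ b hb
      obtain rfl : b = 0 := by simpa using hb
      simp [mon, digitProd]
    | succ j ih =>
      intro hj b hb
      have hlj : 0 < l ^ j := Nat.pow_pos X.l_pos
      have ha : b / l ^ j < l := Nat.div_lt_of_lt_mul (by rwa [← pow_succ])
      have hr : b % l ^ j < l ^ j := Nat.mod_lt _ hlj
      have hdec : b % l ^ j + b / l ^ j * l ^ j = b := by rw [mul_comm]; exact Nat.mod_add_div _ _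
      have hm (t : ℕ → K) : digitProd l m t b =
          digitProd l m t (b % l ^ j) * t (j + 1) ^ (b / l ^ j) := by
        rw [← digitProd_add t X.l_pos hj hr ha, hdec]
      set b0 := b % l ^ j
      set a := b / l ^ j
      have h1 := ih (by omega) b0 hr
      have hy : X.y (j + 1) = (X.y (j + 1) - X.x (j + 1)) + X.x (j + 1) := by ring
      have hd := X.y_sub_mem_L j
      set d := X.y (j + 1) - X.x (j + 1)
      have hYL : digitProd l m X.y b0 ∈ X.L j := by
        rw [digitProd]
        refine prod_mem fun s _ => ?_
        rcases lt_or_ge s j with hs | hs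
        · refine pow_mem ?_ _
          have := add_mem (X.L_mono hs.le (X.y_sub_mem_L s)) (X.x_mem_L_of_le hs)
          rwa [sub_add_cancel] at this
        · rw [Nat.digit_eq_zero X.l_pos hr hs, pow_zero]; exact one_mem _
      have he : digitProd l m X.y b - X.mon b =
          (digitProd l m X.y b0 - X.mon b0) * X.x (j + 1) ^ a +
            ∑ s ∈ range a, (digitProd l m X.y b0 * (d ^ (a - s) * (a.choose s : K))) *
              X.x (j + 1) ^ s := by
        rw [mon, hm, hm, hy, add_comm d, add_pow, sum_range_succ, mul_add, mul_sum, mon]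
        simp only [Nat.sub_self, pow_zero, mul_one, Nat.choose_self, Nat.cast_one]
        rw [sub_mul, add_comm, add_sub_right_comm]
        congr 1
        exact sum_congr rfl fun s _ => by ring
      rw [he, ← hdec]
      refine add_mem (X.mul_pow_mem_sp hr.le hj ha h1) (sum_mem fun s hs => ?_)
      rw [mem_range] at hs
      have hcL : digitProd l m X.y b0 * (d ^ (a - s) * (a.choose s : K)) ∈ X.L j :=
        mul_mem hYL (mul_mem (pow_mem hd _) (natCast_mem _ _))
      refine X.sp_mono ?_ (X.mul_pow_mem_sp le_rfl hj (hs.trans ha)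
        (X.mem_sp_of_mem_L (by omega) hcL))
      calc l ^ j + s * l ^ j = (s + 1) * l ^ j := by ring
        _ ≤ a * l ^ j := Nat.mul_le_mul_right _ hs
        _ ≤ b0 + a * l ^ j := Nat.le_add_left _ _
  exact key m le_rfl b hb

end Tower

/-- The elements of a field that are integral at all valuation rings of a given set. -/
def regularSubalgebra (k : Type) {K : Type} [Field k] [Fintype k] [Field K] [Algebra k K]
    (S : Set (ValuationSubring K)) : Subalgebra k K where
  carrier := {f | ∀ A ∈ S, f ∈ A}
  mul_mem' hf hg A hA := mul_mem (hf A hA) (hg A hA)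
  add_mem' hf hg A hA := add_mem (hf A hA) (hg A hA)
  algebraMap_mem' c A _ :=
    A.mem_of_valuation_le_one _ (A.valuation.map_algebraMap_le_of_fintype c)

theorem Polynomial.aeval_mem_of_mem {k A : Type} [Field k] [CommRing A] [Algebra k A]
    (S : Subalgebra k A) {x : A} (hx : x ∈ S) (p : Polynomial k) : aeval x p ∈ S :=
  Algebra.adjoin_le (Set.singleton_subset_iff.2 hx) (aeval_mem_adjoin_singleton k x)

namespace Tower

open Finset WithZero Polynomial

variable {k K Γ : Type} [Field k] [Fintype k] [Field K] [Algebra k K] {l m : ℕ}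
  [LinearOrderedCommGroupWithZero Γ] (X : Tower k K l m) {v : Valuation K Γ}

theorem map_prod_mul_le {i : ℕ} (hi : 1 < v (X.x i)) {a : ℕ → ℕ} (ha : ∀ s, a s < l) {n : ℕ}
    (hn : i + n ≤ m) :
    v (∏ s ∈ range n, X.x (i + s + 1) ^ a s) * v (X.x (i + n)) ≤ v (X.x i) := by
  induction n with
  | zero => simp
  | succ n ih =>
    have h1 := X.one_lt hi (Nat.le_add_right i n) (by omega)
    obtain ⟨h2, h3⟩ := X.step_of_one_lt (j := i + n) (by omega) h1
    refine le_trans ?_ (ih (by omega))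
    rw [prod_range_succ, map_mul, mul_assoc, map_pow]
    refine mul_le_mul_right ?_ _
    rw [← h3, ← add_assoc, ← pow_succ]
    exact pow_le_pow_right₀ h2.le (ha n)

theorem map_prod_le {i : ℕ} (hi : 1 < v (X.x i)) {a : ℕ → ℕ} (ha : ∀ s, a s < l) {n : ℕ}
    (hn : i + n ≤ m) : v (∏ s ∈ range n, X.x (i + s + 1) ^ a s) ≤ v (X.x i) := by
  refine le_trans ?_ (X.map_prod_mul_le hi ha hn)
  exact le_mul_of_one_le_right' (X.one_lt hi (Nat.le_add_right i n) hn).le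

theorem map_mon_le (h : 1 < v (X.x 0)) (b : ℕ) : v (X.mon b) ≤ v (X.x 0) := by
  have := X.map_prod_le h (a := fun s => b / l ^ s % l) (fun s => Nat.mod_lt _ X.l_pos) (n := m)
    (by omega)
  rw [mon, digitProd]
  simpa only [zero_add] using this

theorem map_prod_x_le (h : v (X.x 0) = 1) {a : ℕ → ℕ} (ha : ∀ s, a s < l) :
    v ((X.x 0 ^ l + X.x 0) * ∏ s ∈ range m, X.x (s + 1) ^ a s) ≤ 1 := by
  rcases (v.map_pow_add_self_le (l := l) h.le).lt_or_eq with hT | hT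
  · rcases Nat.eq_zero_or_pos m with rfl | hm
    · simpa using hT.le
    obtain ⟨n, rfl⟩ := Nat.exists_eq_succ_of_ne_zero hm.ne'
    obtain ⟨h1, h2⟩ := X.map_next_of_root hm h hT
    rw [zero_add] at h1 h2
    have h3 := X.map_prod_le h1 (a := fun s => a (s + 1)) (fun s => ha _) (n := n) (by omega)
    rw [prod_range_succ', map_mul, map_mul, zero_add, map_pow]
    have h4 : v (X.x 1) * v (X.x 1) ^ a 0 ≤ v (X.x 1) ^ l := by
      rw [← pow_succ']
      exact pow_le_pow_right₀ h1.le (ha 0)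
    have h5 : v (X.x 0 ^ l + X.x 0) ≠ 0 := v.ne_zero_iff.2 (X.pow_add_self_ne_zero hm.le)
    calc _ ≤ v (X.x 0 ^ l + X.x 0) * (v (X.x 1) * v (X.x 1) ^ a 0) := by
          gcongr
          simpa only [add_comm 1] using h3
      _ ≤ v (X.x 0 ^ l + X.x 0) * v (X.x 1) ^ l := by gcongr
      _ = 1 := by rw [h2, mul_inv_cancel₀ h5]
  · have key : ∀ j ≤ m, v (X.x j) = 1 ∧ v (X.x j ^ l + X.x j) = 1 := by
      intro j
      induction j with
      | zero => exact fun _ => ⟨h, hT⟩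
      | succ j ih =>
        intro hj
        obtain ⟨h1, h2⟩ := ih (by omega)
        have h3 : v (X.x (j + 1) ^ l + X.x (j + 1)) = 1 := by
          rw [X.rel j hj, map_div₀, map_pow, h1, h2]; simp
        refine ⟨le_antisymm (v.map_le_one_of_pow_add_self X.two_le h3.le) ?_, h3⟩
        by_contra! h4
        rw [v.map_pow_add_self_of_lt X.two_le h4] at h3
        exact h4.ne h3
    rw [map_mul, hT, one_mul, map_prod, prod_eq_one fun s hs => ?_]
    rw [map_pow, (key (s + 1) (mem_range.1 hs)).1, one_pow]

/-- The functions regular at the zeros of `x 0`. -/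
def regZero : Subalgebra k K := regularSubalgebra k {A | A.valuation (X.x 0) < 1}

/-- The functions whose only poles are poles of `x 0`. -/
def regFin : Subalgebra k K := regularSubalgebra k {A | X.x 0 ∈ A}

theorem x_zero_mem_regZero : X.x 0 ∈ X.regZero := fun A hA =>
  A.mem_of_valuation_le_one _ (le_of_lt hA)

theorem x_zero_mem_regFin : X.x 0 ∈ X.regFin := fun _ hA => hA

theorem inv_aeval_mem_regZero {s : k[X]} (hs : s.coeff 0 ≠ 0) :
    (aeval (X.x 0) s)⁻¹ ∈ X.regZero := by
  intro A hA
  have hA' : A.valuation (X.x 0) < 1 := hA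
  refine A.mem_of_valuation_le_one _ ?_
  have h1 : aeval (X.x 0) s = X.x 0 * aeval (X.x 0) s.divX + algebraMap k K (s.coeff 0) := by
    conv_lhs => rw [← X_mul_divX_add s]
    rw [map_add, map_mul, aeval_X, aeval_C]
  have h2 : A.valuation (aeval (X.x 0) s.divX) ≤ 1 :=
    A.valuation_le_one ⟨_, aeval_mem_of_mem _ X.x_zero_mem_regZero s.divX A hA⟩
  have h3 : A.valuation (X.x 0 * aeval (X.x 0) s.divX) < 1 := by
    rw [map_mul]
    exact mul_lt_one_of_lt_of_le hA' h2
  have h4 := A.valuation.map_algebraMap_of_fintype hs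
  rw [h1, map_inv₀, A.valuation.map_add_eq_of_lt_right (by rwa [h4]), h4, inv_one]

theorem x_zero_ne_zero : X.x 0 ≠ 0 := X.ne_zero (Nat.zero_le m)

theorem transcendental : Transcendental k (X.x 0) := by
  have : X.w.IsTrivialOn k := ⟨fun c hc => X.w.map_algebraMap_of_fintype hc⟩
  exact X.w.transcendental_of_ne_one k _ X.x_zero_ne_zero X.one_lt_w.ne'

theorem exists_principal_part {c : K} (hc : c ∈ X.L 0) :
    ∃ p : k[X], ∃ r ∈ X.regZero, c = aeval (X.x 0)⁻¹ p + X.x 0 * r := by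
  have hx := X.x_zero_ne_zero
  obtain ⟨r, s, rfl⟩ := IntermediateField.mem_adjoin_simple_iff k c |>.1 hc
  rcases eq_or_ne s 0 with rfl | hs0
  · exact ⟨0, 0, zero_mem _, by simp⟩
  obtain ⟨t, ht, hXt⟩ := exists_eq_pow_rootMultiplicity_mul_and_not_dvd s hs0 0
  rw [C_0, sub_zero] at ht hXt
  rw [X_dvd_iff] at hXt
  have hinv := X.inv_aeval_mem_regZero hXt
  have ht0 : aeval (X.x 0) t ≠ 0 := by
    refine fun h0 => hXt ?_
    rw [transcendental_iff.1 X.transcendental t h0, coeff_zero]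
  have key : ∀ (e : ℕ) (r : k[X]), ∃ p : k[X], ∃ g ∈ X.regZero,
      aeval (X.x 0) r / (X.x 0 ^ e * aeval (X.x 0) t) = aeval (X.x 0)⁻¹ p + X.x 0 * g := by
    have hdec (r : k[X]) : ∃ a : k, ∃ r' : k[X], r = C a * t + Polynomial.X * r' := by
      refine ⟨r.coeff 0 / t.coeff 0, (r - C (r.coeff 0 / t.coeff 0) * t).divX, ?_⟩
      have := X_mul_divX_add (r - C (r.coeff 0 / t.coeff 0) * t)
      rw [coeff_sub, coeff_C_mul, div_mul_cancel₀ _ hXt, sub_self, C_0, add_zero] at this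
      rw [this]
      ring
    intro e
    induction e with
    | zero =>
      intro r
      obtain ⟨a, r', rfl⟩ := hdec r
      refine ⟨C a, aeval (X.x 0) r' * (aeval (X.x 0) t)⁻¹,
        mul_mem (aeval_mem_of_mem _ X.x_zero_mem_regZero _) hinv, ?_⟩
      simp only [map_add, map_mul, aeval_C, aeval_X]
      field_simp
    | succ e ih =>
      intro r
      obtain ⟨a, r', rfl⟩ := hdec r
      obtain ⟨p, g, hg, h⟩ := ih r'
      refine ⟨C a * Polynomial.X ^ (e + 1) + p, g, hg, ?_⟩
      rw [map_add (aeval (X.x 0)⁻¹), add_assoc, ← h]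
      simp only [map_add, map_mul, map_pow, aeval_C, aeval_X, inv_pow]
      field_simp
      ring
  have := key (s.rootMultiplicity 0) r
  rw [ht, map_mul, map_pow, aeval_X]
  exact this

end Tower

namespace Tower

open Finset WithZero Polynomial

variable {k K : Type} [Field k] [Fintype k] [Field K] [Algebra k K] {l m : ℕ}
  (X : Tower k K l m)

theorem x_zero_mul_digitProd_mem (b : ℕ) : X.x 0 * digitProd l m X.y b ∈ X.regZero := fun A hA =>
  A.mem_of_valuation_le_one _
    (X.map_prod_y_le hA (a := fun s => b / l ^ s % l) fun _ => Nat.mod_lt _ X.l_pos)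

theorem aeval_inv_mem_L (p : k[X]) : aeval (X.x 0)⁻¹ p ∈ X.L 0 :=
  aeval_mem_of_mem (X.L 0).toSubalgebra ((X.L 0).inv_mem (X.x_mem_L 0)) p

theorem exists_truncation {n : ℕ} (hn : n ≤ l ^ m) {f : K} (hf : f ∈ X.sp n) :
    ∃ p : ℕ → k[X], f + ∑ b ∈ range n, aeval (X.x 0)⁻¹ (p b) * X.mon b ∈ X.regZero := by
  induction n generalizing f with
  | zero =>
    refine ⟨0, ?_⟩
    have : f = 0 := by simpa [sp] using hf
    simp [this, zero_mem]
  | succ n ih =>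
    have hins : Set.Iio (n + 1) = insert n (Set.Iio n) := by ext i; simp
    rw [sp, hins, Set.image_insert_eq, Submodule.mem_span_insert] at hf
    obtain ⟨c, f', hf', rfl⟩ := hf
    obtain ⟨q, r, hr, hc⟩ := X.exists_principal_part c.2
    have hrL : X.x 0 * r ∈ X.L 0 := by
      rw [← sub_eq_of_eq_add' hc]
      exact sub_mem c.2 (X.aeval_inv_mem_L q)
    have h1 : f' - X.x 0 * r * (digitProd l m X.y n - X.mon n) ∈ X.sp n :=
      sub_mem hf' (Submodule.smul_mem (X.sp n) ⟨_, hrL⟩ (X.digitProd_y_sub_mem hn))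
    obtain ⟨p, hp⟩ := ih (by omega) h1
    refine ⟨fun b => if b = n then -q else p b, ?_⟩
    have h2 : c • X.mon n = (c : K) * X.mon n := rfl
    have h3 := add_mem hp (mul_mem hr (X.x_zero_mul_digitProd_mem n))
    convert h3 using 1
    have h4 : ∑ b ∈ range n, aeval (X.x 0)⁻¹ (if b = n then -q else p b) * X.mon b =
        ∑ b ∈ range n, aeval (X.x 0)⁻¹ (p b) * X.mon b :=
      sum_congr rfl fun b hb => by rw [if_neg (mem_range.1 hb).ne]
    dsimp only
    rw [sum_range_succ, if_pos rfl, h2, hc, map_neg, h4]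
    ring

/-- The constants, `x 0`, its inverse, and all further generators. -/
def gens : Set K := insert (X.x 0)⁻¹ (X.x '' Set.Iic m)

theorem x_mem_adjoin_gens {j : ℕ} (hj : j ≤ m) : X.x j ∈ Algebra.adjoin k X.gens :=
  Algebra.subset_adjoin (Set.mem_insert_of_mem _ ⟨j, hj, rfl⟩)

theorem mon_mem_adjoin_gens (b : ℕ) : X.mon b ∈ Algebra.adjoin k X.gens := by
  rw [mon, digitProd]
  exact prod_mem fun s hs => pow_mem (X.x_mem_adjoin_gens (mem_range.1 hs)) _

theorem w_aeval_inv_le (p : k[X]) : X.w (aeval (X.x 0)⁻¹ p) ≤ 1 := by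
  have : aeval (X.x 0)⁻¹ p ∈ regularSubalgebra k {A | A = X.w.valuationSubring} := by
    refine aeval_mem_of_mem _ ?_ p
    rintro A rfl
    refine (X.w.mem_valuationSubring_iff _).2 ?_
    rw [map_inv₀]
    exact inv_le_one_of_one_le₀ X.one_lt_w.le
  exact (X.w.mem_valuationSubring_iff _).1 (this _ rfl)

theorem exists_regFin_of_lt {a : ℕ} (ha : a < l ^ m) : ∃ f ∈ Algebra.adjoin k X.gens,
    f ∈ X.regFin ∧ X.w f ≤ X.w (X.x 0) ^ (l + 2) ∧
    f - (X.x 0 ^ l + X.x 0) * X.x 0 * X.mon a ∈ X.sp a := by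
  have hL : X.x 0 ∈ X.L 0 := X.x_mem_L 0
  obtain ⟨p, hp⟩ := X.exists_truncation ha.le (Submodule.smul_mem (X.sp a)
    ⟨_, neg_mem hL⟩ (X.digitProd_y_sub_mem ha))
  set S := ∑ b ∈ range a, aeval (X.x 0)⁻¹ (p b) * X.mon b with hS
  have hG : X.x 0 * X.mon a + S ∈ X.regZero := by
    have := add_mem hp (X.x_zero_mul_digitProd_mem a)
    convert this using 1
    rw [Algebra.smul_def]
    simp only [IntermediateField.algebraMap_apply]
    ring
  have hx : X.x 0 ∈ Algebra.adjoin k X.gens := X.x_mem_adjoin_gens (Nat.zero_le m)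
  have hSg : S ∈ Algebra.adjoin k X.gens := sum_mem fun b _ => mul_mem
    (aeval_mem_of_mem _ (Algebra.subset_adjoin (Set.mem_insert _ _)) _) (X.mon_mem_adjoin_gens b)
  have hTL : X.x 0 ^ l + X.x 0 ∈ X.L 0 := add_mem (pow_mem hL _) hL
  refine ⟨(X.x 0 ^ l + X.x 0) * (X.x 0 * X.mon a + S), ?_, ?_, ?_, ?_⟩
  · exact mul_mem (add_mem (pow_mem hx _) hx) (add_mem (mul_mem hx (X.mon_mem_adjoin_gens a)) hSg)
  · intro A hA
    have hA' : X.x 0 ∈ A := hA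
    rcases ((A.valuation_le_one_iff _).2 hA').lt_or_eq with h | h
    · exact mul_mem (add_mem (pow_mem hA' _) hA') (hG A h)
    · have hT (b : ℕ) : (X.x 0 ^ l + X.x 0) * X.mon b ∈ A := A.mem_of_valuation_le_one _
        (X.map_prod_x_le h (a := fun s => b / l ^ s % l) fun _ => Nat.mod_lt _ X.l_pos)
      have hinv : (X.x 0)⁻¹ ∈ regularSubalgebra k {B | B = A} := by
        rintro B rfl
        exact B.mem_of_valuation_le_one _ (by rw [map_inv₀, h, inv_one])
      rw [mul_add, hS, mul_sum, mul_left_comm]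
      refine add_mem (mul_mem hA' (hT a)) (sum_mem fun b _ => ?_)
      rw [mul_left_comm]
      exact mul_mem (aeval_mem_of_mem _ hinv _ A rfl) (hT b)
  · have h1 := X.one_lt_w
    rw [map_mul, X.w.map_pow_add_self_of_one_lt X.two_le h1, pow_add]
    gcongr
    refine X.w.map_add_le ?_ (X.w.map_sum_le fun b _ => ?_)
    · rw [map_mul, pow_two]
      gcongr
      exact X.map_mon_le h1 a
    · rw [map_mul]
      calc _ ≤ 1 * X.w (X.x 0) := mul_le_mul' (X.w_aeval_inv_le _) (X.map_mon_le h1 b)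
        _ ≤ X.w (X.x 0) ^ 2 := by rw [one_mul]; exact le_self_pow₀ h1.le two_ne_zero
  · rw [mul_assoc, ← mul_sub, add_sub_cancel_left]
    refine Submodule.smul_mem (X.sp a) ⟨_, hTL⟩ (sum_mem fun b hb => ?_)
    exact Submodule.smul_mem (X.sp a) ⟨_, X.aeval_inv_mem_L _⟩ (X.mon_mem_sp (mem_range.1 hb))

/-- A basis of the functions regular away from the poles of `x 0`, up to finite codimension. -/
theorem exists_regFin_family : ∃ F : ℕ → K, (∀ a < l ^ m, F a ∈ Algebra.adjoin k X.gens ∧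
      F a ∈ X.regFin ∧ X.w (F a) ≤ X.w (X.x 0) ^ (l + 2)) ∧
    ∀ q : ℕ → k[X], ∑ a ∈ range (l ^ m), aeval (X.x 0) (q a) * F a = 0 →
      ∀ a < l ^ m, q a = 0 := by
  choose! F hF using fun a (ha : a < l ^ m) => X.exists_regFin_of_lt ha
  refine ⟨F, fun a ha => ⟨(hF a ha).1, (hF a ha).2.1, (hF a ha).2.2.1⟩, fun q hq => ?_⟩
  have hL (p : k[X]) : aeval (X.x 0) p ∈ X.L 0 :=
    aeval_mem_of_mem (X.L 0).toSubalgebra (X.x_mem_L 0) p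
  have key : ∀ n ≤ l ^ m, ∑ a ∈ range n, aeval (X.x 0) (q a) * F a = 0 → ∀ a < n, q a = 0 := by
    intro n
    induction n with
    | zero => exact fun _ _ a ha => absurd ha (Nat.not_lt_zero a)
    | succ n ih =>
      intro hn h
      have hT : (X.x 0 ^ l + X.x 0) * X.x 0 ≠ 0 :=
        mul_ne_zero (X.pow_add_self_ne_zero (Nat.zero_le m)) X.x_zero_ne_zero
      have hTL : (X.x 0 ^ l + X.x 0) * X.x 0 ∈ X.L 0 :=
        mul_mem (add_mem (pow_mem (X.x_mem_L 0) _) (X.x_mem_L 0)) (X.x_mem_L 0)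
      have hFs {b : ℕ} (hb : b < n) : F b ∈ X.sp n := by
        have h1 := add_mem (X.sp_mono hb.le (hF b (by omega)).2.2.2) (Submodule.smul_mem (X.sp n)
          ⟨_, hTL⟩ (X.mon_mem_sp hb))
        rwa [Algebra.smul_def, IntermediateField.algebraMap_apply, sub_add_cancel] at h1
      have hqn : q n = 0 := by
        by_contra hne
        have h0 : aeval (X.x 0) (q n) ≠ 0 := fun h0 =>
          hne (transcendental_iff.1 X.transcendental _ h0)
        rw [sum_range_succ, add_comm] at h
        have h1 : aeval (X.x 0) (q n) * F n ∈ X.sp n := by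
          rw [eq_neg_of_add_eq_zero_left h]
          exact neg_mem (sum_mem fun b hb =>
            Submodule.smul_mem (X.sp n) ⟨_, hL _⟩ (hFs (mem_range.1 hb)))
        have h2 : F n ∈ X.sp n := by
          have := Submodule.smul_mem (X.sp n) ⟨_, inv_mem (hL (q n))⟩ h1
          rwa [Algebra.smul_def, IntermediateField.algebraMap_apply,
            inv_mul_cancel_left₀ h0] at this
        have h3 := sub_mem h2 (hF n hn).2.2.2
        rw [sub_sub_cancel] at h3
        have h4 := Submodule.smul_mem (X.sp n) ⟨_, inv_mem hTL⟩ h3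
        rw [Algebra.smul_def, IntermediateField.algebraMap_apply, inv_mul_cancel_left₀ hT] at h4
        exact X.mon_notMem_sp hn h4
      rw [sum_range_succ, hqn, map_zero, zero_mul, add_zero] at h
      intro a ha
      rcases Nat.lt_succ_iff_lt_or_eq.1 ha with h1 | rfl
      · exact ih (by omega) h a h1
      · exact hqn
  exact key _ le_rfl hq

end Tower

namespace Tower

open Finset WithZero Polynomial

variable {k K : Type} [Field k] [Fintype k] [Field K] [Algebra k K] {l m : ℕ}
  (X : Tower k K l m)

theorem eq_zero_of_w_lt_one {f : K} (hL : f ∈ X.L m) (hf : f ∈ X.regFin) (hw : X.w f < 1) :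
    f = 0 := by
  by_contra h0
  have : X.w.IsTrivialOn k := ⟨fun c hc => X.w.map_algebraMap_of_fintype hc⟩
  refine X.w.transcendental_of_ne_one k f h0 hw.ne ?_
  have hall (A : ValuationSubring K) : f ∈ A := by
    by_cases hA : X.x 0 ∈ A
    · exact hf A hA
    · have h1 : 1 < A.valuation (X.x 0) := by
        rwa [← not_le, A.valuation_le_one_iff]
      have h2 := X.map_lt_of_w_lt (v := A.valuation) h1 le_rfl hL (d := 0) (by simpa using hw)
      exact A.mem_of_valuation_le_one _ (by simpa using h2.le)
  have hcl : Subring.closure (Set.range (algebraMap k K)) =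
      (⊥ : Subalgebra k K).toSubring := by
    rw [← RingHom.coe_range, Subring.closure_eq]
    ext
    simp [Algebra.mem_bot]
  have hmem : f ∈ (integralClosure (Subring.closure (Set.range (algebraMap k K))) K).toSubring := by
    rw [← iInf_valuationSubring_superset, Subring.mem_iInf]
    exact fun V => hall V.1
  rw [hcl] at hmem
  have h1 : IsIntegral (⊥ : Subalgebra k K) f := hmem
  exact (isIntegral_trans (R := k) f h1).isAlgebraic

end Tower

/-- The affine rational points of the tower over the non-roots of `y ^ l + y`. -/
def towerPoints (k : Type) [Field k] (l m : ℕ) : Set (ℕ → k) :=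
  {α | α 0 ^ l + α 0 ≠ 0 ∧
    (∀ j < m, α (j + 1) ^ l + α (j + 1) = α j ^ (l + 1) / (α j ^ l + α j)) ∧ ∀ j, m < j → α j = 0}

namespace towerPoints

variable {k : Type} [Field k] {l m : ℕ}

theorem pow_add_self_ne_zero (hl : l ≠ 0) {α : ℕ → k} (hα : α ∈ towerPoints k l m) {j : ℕ}
    (hj : j ≤ m) : α j ^ l + α j ≠ 0 ∧ α j ≠ 0 := by
  have hne {c : k} (hc : c ^ l + c ≠ 0) : c ≠ 0 := by
    rintro rfl
    simp [hl] at hc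
  induction j with
  | zero => exact ⟨hα.1, hne hα.1⟩
  | succ j ih =>
    obtain ⟨h1, h2⟩ := ih (by omega)
    have h3 : α (j + 1) ^ l + α (j + 1) ≠ 0 := by
      rw [hα.2.1 j hj]
      exact div_ne_zero (pow_ne_zero _ h2) h1
    exact ⟨h3, hne h3⟩

variable [Fintype k]

theorem card_fiber (hl : 2 ≤ l) (hk : Fintype.card k = l ^ 2) (a : k) :
    Nat.card {y : k // y ^ l + y = a ^ (l + 1) / (a ^ l + a)} = l := by
  classical
  have hfix (c : k) : (c ^ l) ^ l = c := by
    rw [← pow_mul, ← pow_two, ← hk, FiniteField.pow_card]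
  have hc : (a ^ (l + 1) / (a ^ l + a)) ^ l = a ^ (l + 1) / (a ^ l + a) := by
    rw [div_pow, add_pow_of_card hk, hfix, add_comm a, pow_succ, mul_pow, hfix, mul_comm]
  rw [Nat.card_eq_fintype_card, Fintype.card_subtype]
  exact card_fiber_add_pow hl hk (fun _ _ => add_pow_of_card hk _ _) hc

/-- Points at level `m + 1` are points at level `m` together with a new coordinate. -/
def succEquiv (k : Type) [Field k] (l m : ℕ) : towerPoints k l (m + 1) ≃
    Σ α : towerPoints k l m, {y : k // y ^ l + y = α.1 m ^ (l + 1) / (α.1 m ^ l + α.1 m)} where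
  toFun α := ⟨⟨Function.update α.1 (m + 1) 0, by
    obtain ⟨α, h1, h2, h3⟩ := α
    refine ⟨by simpa using h1, fun j hj => ?_, fun j hj => ?_⟩
    · simpa [Function.update_of_ne, hj.ne, (Nat.lt_succ_of_lt hj).ne] using h2 j (by omega)
    · rcases eq_or_ne j (m + 1) with rfl | hne
      · simp
      · simpa [Function.update_of_ne, hne] using h3 j (by omega)⟩,
    ⟨α.1 (m + 1), by simpa using α.2.2.1 m (by omega)⟩⟩
  invFun β := ⟨Function.update β.1.1 (m + 1) β.2.1, by
    obtain ⟨⟨α, h1, h2, h3⟩, y, hy⟩ := β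
    refine ⟨by simpa using h1, fun j hj => ?_, fun j hj => ?_⟩
    · rcases Nat.lt_succ_iff_lt_or_eq.1 hj with hj | rfl
      · simpa [Function.update_of_ne, hj.ne, (Nat.lt_succ_of_lt hj).ne] using h2 j hj
      · simpa using hy
    · simpa [Function.update_of_ne, hj.ne'] using h3 j (by omega)⟩
  left_inv α := by simp
  right_inv β := by
    obtain ⟨⟨α, h1, h2, h3⟩, y, hy⟩ := β
    have : Function.update α (m + 1) 0 = α := by
      rw [← h3 (m + 1) (by omega), Function.update_eq_self]
    exact Sigma.subtype_ext (Subtype.ext (by simpa using this)) (by simp)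

theorem finite_and_card (hl : 2 ≤ l) (hk : Fintype.card k = l ^ 2) :
    Finite (towerPoints k l m) ∧ Nat.card (towerPoints k l m) = (l ^ 2 - l) * l ^ m := by
  classical
  induction m with
  | zero =>
    let e : towerPoints k l 0 ≃ {c : k // ¬ c ^ l + c = 0} :=
      { toFun := fun α => ⟨α.1 0, α.2.1⟩
        invFun := fun c => ⟨Function.update 0 0 c.1, by simpa using c.2, by simp, fun j hj => by
          simp [Function.update_of_ne, hj.ne']⟩
        left_inv := fun α => by
          ext j
          rcases Nat.eq_zero_or_pos j with rfl | hj
          · simp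
          · simp [Function.update_of_ne, hj.ne', α.2.2.2 j hj]
        right_inv := fun c => by simp }
    refine ⟨Finite.of_equiv _ e.symm, ?_⟩
    rw [Nat.card_congr e, Nat.card_eq_fintype_card, Fintype.card_subtype_compl, hk,
      Fintype.card_subtype, card_fiber_add_pow hl hk (fun _ _ => add_pow_of_card hk _ _)
        (zero_pow (by omega)), pow_zero, mul_one]
  | succ m ih =>
    obtain ⟨_, ih⟩ := ih
    refine ⟨Finite.of_equiv _ (succEquiv k l m).symm, ?_⟩
    have := Fintype.ofFinite (towerPoints k l m)
    rw [Nat.card_congr (succEquiv k l m), Nat.card_sigma,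
      Finset.sum_congr rfl fun α _ => card_fiber hl hk _, Finset.sum_const, Finset.card_univ,
      ← Nat.card_eq_fintype_card, ih, smul_eq_mul, pow_succ l m,
      mul_assoc]

end towerPoints

namespace Tower

open Finset WithZero Polynomial

variable {k K : Type} [Field k] [Fintype k] [Field K] [Algebra k K] {l m : ℕ}
  (X : Tower k K l m)

/-- The generator `x j` together with its values at the rational points. -/
def coord (j : ℕ) : K × (towerPoints k l m → k) := (X.x j, fun α => α.1 j)

variable {X} in
theorem coord_identity {j : ℕ} (hj : j ≤ m) :
    (X.coord j ^ l + X.coord j) * (X.coord j ^ l + X.coord j)⁻¹ = 1 ∧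
      X.coord j * (X.coord j)⁻¹ = 1 := by
  have hl : l ≠ 0 := X.l_pos.ne'
  refine ⟨Prod.ext (mul_inv_cancel₀ (X.pow_add_self_ne_zero hj)) (_root_.funext fun α => ?_),
    Prod.ext (mul_inv_cancel₀ (X.ne_zero hj)) (_root_.funext fun α => ?_)⟩
  · exact mul_inv_cancel₀ (towerPoints.pow_add_self_ne_zero hl α.2 hj).1
  · exact mul_inv_cancel₀ (towerPoints.pow_add_self_ne_zero hl α.2 hj).2

theorem coord_succ {j : ℕ} (hj : j < m) :
    X.coord (j + 1) ^ l + X.coord (j + 1) =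
      X.coord j ^ (l + 1) * (X.coord j ^ l + X.coord j)⁻¹ :=
  Prod.ext ((X.rel j hj).trans (div_eq_mul_inv _ _))
    (_root_.funext fun α => (α.2.2.1 j hj).trans (div_eq_mul_inv _ _))

theorem coord_inv {j : ℕ} (hj : j ≤ m) :
    (X.coord j)⁻¹ = (X.coord j ^ (l - 1) + 1) * (X.coord j ^ l + X.coord j)⁻¹ := by
  obtain ⟨h1, h2⟩ := coord_identity (X := X) hj
  have h3 : X.coord j ^ l = X.coord j ^ (l - 1) * X.coord j := by
    rw [← pow_succ, Nat.sub_add_cancel X.l_pos]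
  calc (X.coord j)⁻¹ = (X.coord j)⁻¹ * 1 := (mul_one _).symm
    _ = (X.coord j)⁻¹ * ((X.coord j ^ l + X.coord j) * (X.coord j ^ l + X.coord j)⁻¹) := by rw [h1]
    _ = (X.coord j * (X.coord j)⁻¹) * (X.coord j ^ (l - 1) + 1) *
        (X.coord j ^ l + X.coord j)⁻¹ := by rw [h3]; ring
    _ = _ := by rw [h2, one_mul]

theorem coord_succ_inv {j : ℕ} (hj : j < m) :
    (X.coord (j + 1) ^ l + X.coord (j + 1))⁻¹ = (X.coord j)⁻¹ ^ l + (X.coord j)⁻¹ := by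
  obtain ⟨h1, h2⟩ := coord_identity (X := X) hj.le
  obtain ⟨h3, -⟩ := coord_identity (X := X) (j := j + 1) hj
  have h4 : (X.coord (j + 1) ^ l + X.coord (j + 1)) *
      ((X.coord j)⁻¹ ^ l + (X.coord j)⁻¹) = 1 := by
    rw [X.coord_succ hj]
    calc _ = (X.coord j ^ l + X.coord j)⁻¹ * ((X.coord j * (X.coord j)⁻¹) ^ l * X.coord j +
          X.coord j ^ l * (X.coord j * (X.coord j)⁻¹)) := by rw [mul_pow]; ring
      _ = (X.coord j ^ l + X.coord j) * (X.coord j ^ l + X.coord j)⁻¹ := by rw [h2]; ring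
      _ = 1 := h1
  calc _ = (X.coord (j + 1) ^ l + X.coord (j + 1))⁻¹ * ((X.coord (j + 1) ^ l + X.coord (j + 1)) *
        ((X.coord j)⁻¹ ^ l + (X.coord j)⁻¹)) := by rw [h4, mul_one]
    _ = (X.coord (j + 1) ^ l + X.coord (j + 1)) * (X.coord (j + 1) ^ l + X.coord (j + 1))⁻¹ *
        ((X.coord j)⁻¹ ^ l + (X.coord j)⁻¹) := by ring
    _ = _ := by rw [h3, one_mul]

/-- The functions generated by the coordinates and the inverse of `x 0 ^ l + x 0`, together with
their values at the rational points. -/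
def W : ℕ → Subalgebra k (K × (towerPoints k l m → k))
  | 0 => Algebra.adjoin k {X.coord 0, (X.coord 0 ^ l + X.coord 0)⁻¹}
  | j + 1 => (Algebra.adjoin (W j) {X.coord (j + 1)}).restrictScalars k

theorem W_le_succ (j : ℕ) : X.W j ≤ X.W (j + 1) := fun f hf =>
  (Algebra.adjoin (X.W j) {X.coord (j + 1)}).algebraMap_mem ⟨f, hf⟩

theorem W_mono : Monotone X.W := monotone_nat_of_le_succ X.W_le_succ

theorem coord_mem_W {i j : ℕ} (h : i ≤ j) : X.coord i ∈ X.W j := by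
  refine X.W_mono h ?_
  cases i with
  | zero => exact Algebra.subset_adjoin (Set.mem_insert _ _)
  | succ i =>
    exact Algebra.subset_adjoin (R := X.W i) (s := {X.coord (i + 1)}) (Set.mem_singleton _)

theorem coord_inv_mem_W {j : ℕ} (hj : j ≤ m) :
    (X.coord j ^ l + X.coord j)⁻¹ ∈ X.W j ∧ (X.coord j)⁻¹ ∈ X.W j := by
  have h2 {j : ℕ} (hj : j ≤ m) (h : (X.coord j ^ l + X.coord j)⁻¹ ∈ X.W j) :
      (X.coord j)⁻¹ ∈ X.W j := by
    rw [X.coord_inv hj]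
    exact mul_mem (add_mem (pow_mem (X.coord_mem_W le_rfl) _) (one_mem _)) h
  induction j with
  | zero =>
    have : (X.coord 0 ^ l + X.coord 0)⁻¹ ∈ X.W 0 :=
      Algebra.subset_adjoin (Set.mem_insert_of_mem _ rfl)
    exact ⟨this, h2 hj this⟩
  | succ j ih =>
    have h3 := X.W_le_succ j (ih (by omega)).2
    have : (X.coord (j + 1) ^ l + X.coord (j + 1))⁻¹ ∈ X.W (j + 1) := by
      rw [X.coord_succ_inv hj]
      exact add_mem (pow_mem h3 _) h3
    exact ⟨this, h2 hj this⟩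

theorem exists_sum_of_mem_W {j : ℕ} (hj : j < m) {f : K × (towerPoints k l m → k)}
    (hf : f ∈ X.W (j + 1)) : ∃ c : ℕ → K × (towerPoints k l m → k), (∀ a, c a ∈ X.W j) ∧
      f = ∑ a ∈ range l, c a * X.coord (j + 1) ^ a := by
  have hu : X.coord j ^ (l + 1) * (X.coord j ^ l + X.coord j)⁻¹ ∈ X.W j :=
    mul_mem (pow_mem (X.coord_mem_W le_rfl) _) (X.coord_inv_mem_W hj.le).1
  have hrel : X.coord (j + 1) ^ l + X.coord (j + 1) = algebraMap (X.W j) _ ⟨_, hu⟩ :=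
    X.coord_succ hj
  obtain ⟨c, hc⟩ := exists_sum_of_mem_adjoin X.two_le hrel hf
  exact ⟨fun a => c a, fun a => (c a).2, hc⟩

theorem exists_pow_mul_eq_aeval {f : K × (towerPoints k l m → k)} (hf : f ∈ X.W 0) :
    ∃ (N : ℕ) (p : k[X]), (X.coord 0 ^ l + X.coord 0) ^ N * f = aeval (X.coord 0) p := by
  have h1 := (coord_identity (X := X) (Nat.zero_le m)).1
  have hT : X.coord 0 ^ l + X.coord 0 =
      aeval (X.coord 0) (Polynomial.X ^ l + Polynomial.X : k[X]) := by simp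
  set T := X.coord 0 ^ l + X.coord 0
  induction hf using Algebra.adjoin_induction with
  | mem f hf =>
    rcases hf with rfl | rfl
    · exact ⟨0, Polynomial.X, by simp⟩
    · exact ⟨1, 1, by rw [pow_one, h1, map_one]⟩
  | algebraMap c => exact ⟨0, C c, by simp⟩
  | add f g _ _ hf hg =>
    obtain ⟨N, p, h⟩ := hf
    obtain ⟨M, q, h'⟩ := hg
    refine ⟨N + M, (Polynomial.X ^ l + Polynomial.X) ^ M * p +
      (Polynomial.X ^ l + Polynomial.X) ^ N * q, ?_⟩
    rw [map_add, map_mul, map_mul, ← h, ← h', map_pow, map_pow, ← hT]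
    ring
  | mul f g _ _ hf hg =>
    obtain ⟨N, p, h⟩ := hf
    obtain ⟨M, q, h'⟩ := hg
    refine ⟨N + M, p * q, ?_⟩
    rw [map_mul, ← h, ← h']
    ring

theorem W_fst {j : ℕ} (hj : j ≤ m) {f : K × (towerPoints k l m → k)} (hf : f ∈ X.W j) :
    f.1 ∈ X.L j ∧ (f.1 = 0 → f = 0) := by
  induction j generalizing f with
  | zero =>
    obtain ⟨N, p, h⟩ := X.exists_pow_mul_eq_aeval hf
    have h1 : (X.x 0 ^ l + X.x 0) ^ N * f.1 = aeval (X.x 0) p := by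
      have := congrArg (AlgHom.fst k K (towerPoints k l m → k)) h
      rwa [← aeval_algHom_apply] at this
    have hT := pow_ne_zero N (X.pow_add_self_ne_zero (Nat.zero_le m))
    refine ⟨?_, fun h0 => ?_⟩
    · rw [← mul_inv_cancel_left₀ hT f.1, mul_left_comm, h1]
      have hx := X.x_mem_L 0
      exact mul_mem (inv_mem (pow_mem (add_mem (pow_mem hx _) hx) _))
        (aeval_mem_of_mem (X.L 0).toSubalgebra hx p)
    · rw [h0, mul_zero] at h1
      rw [transcendental_iff.1 X.transcendental p h1.symm, map_zero] at h
      have h2 := (coord_identity (X := X) (Nat.zero_le m)).1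
      rw [← one_mul f, ← one_pow N, ← h2, mul_pow, mul_right_comm, h, zero_mul]
  | succ j ih =>
    obtain ⟨c, hc, rfl⟩ := X.exists_sum_of_mem_W hj hf
    have h1 : (∑ a ∈ range l, c a * X.coord (j + 1) ^ a).1 =
        ∑ a ∈ range l, (c a).1 * X.x (j + 1) ^ a := by
      rw [Prod.fst_sum]; rfl
    have hcL (a : ℕ) := (ih (by omega) (hc a)).1
    rw [h1]
    refine ⟨sum_mem fun a _ => mul_mem (X.L_le_succ j (hcL a)) (pow_mem (X.x_mem_L _) _),
      fun h0 => sum_eq_zero fun a ha => ?_⟩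
    rw [(ih (by omega) (hc a)).2 (X.eq_zero_of_sum_eq_zero hj hcL h0 (mem_range.1 ha)), zero_mul]

theorem exists_lift {f : K} (hf : f ∈ Algebra.adjoin k X.gens) : ∃ F ∈ X.W m, F.1 = f := by
  have : Algebra.adjoin k X.gens ≤ (X.W m).map (AlgHom.fst k K (towerPoints k l m → k)) := by
    refine Algebra.adjoin_le ?_
    rintro _ (rfl | ⟨j, hj, rfl⟩)
    · exact ⟨_, X.W_mono (Nat.zero_le m) (X.coord_inv_mem_W (Nat.zero_le m)).2, rfl⟩
    · exact ⟨_, X.coord_mem_W hj, rfl⟩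
  exact this hf

end Tower

/-- An algebra of functions separating the points of a finite set takes all values on it. -/
theorem surjective_of_separates_points {k O P : Type} [Field k] [CommRing O] [Algebra k O]
    [Finite P] (ev : O →ₐ[k] (P → k)) (h : ∀ α β, α ≠ β → ∃ f, ev f α ≠ ev f β) :
    Function.Surjective ev := by
  classical
  have := Fintype.ofFinite P
  have hinj : Function.Injective fun α : P =>
      (((Pi.evalAlgHom k (fun _ : P => k) α).comp ev : O →ₐ[k] k) : O →* k) := by
    intro α β hαβ
    by_contra hne
    obtain ⟨f, hf⟩ := h α β hne
    exact hf (DFunLike.congr_fun hαβ f)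
  have hlin := (linearIndependent_monoidHom O k).comp _ hinj
  rw [← AlgHom.coe_toLinearMap, ← LinearMap.range_eq_top]
  by_contra hne
  obtain ⟨φ, hφ0, hφ⟩ := Submodule.exists_le_ker_of_lt_top _ (lt_top_iff_ne_top.2 hne)
  rw [Fintype.linearIndependent_iff] at hlin
  have hz := hlin (fun α => φ (Pi.single α 1)) (by
    ext f
    have h1 : φ (ev f) = 0 := hφ ⟨f, rfl⟩
    rw [LinearMap.pi_apply_eq_sum_univ φ] at h1
    simp only [Finset.sum_apply, Pi.smul_apply, smul_eq_mul, Pi.zero_apply]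
    rw [← h1]
    refine Finset.sum_congr rfl fun α _ => ?_
    have h2 : (fun j => if α = j then (1 : k) else 0) = Pi.single α 1 := by
      ext j
      simp [Pi.single_apply, eq_comm]
    rw [h2, smul_eq_mul, mul_comm]
    rfl)
  refine hφ0 (LinearMap.pi_ext' fun α => LinearMap.ext_ring ?_)
  simpa using hz α

namespace Tower

open Finset WithZero Polynomial

variable {k K : Type} [Field k] [Fintype k] [Field K] [Algebra k K] {l m : ℕ}
  (X : Tower k K l m)

theorem pow_add_self_mem_regFin : X.x 0 ^ l + X.x 0 ∈ X.regFin :=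
  add_mem (pow_mem X.x_zero_mem_regFin _) X.x_zero_mem_regFin

/-- The functions with poles only at the poles of `x 0` and at the roots of `y ^ l + y`. -/
def regAffine : Subalgebra k K where
  carrier := {f | ∃ N : ℕ, (X.x 0 ^ l + X.x 0) ^ N * f ∈ X.regFin}
  mul_mem' := by
    rintro f g ⟨N, hf⟩ ⟨M, hg⟩
    refine ⟨N + M, ?_⟩
    rw [pow_add, mul_mul_mul_comm]
    exact mul_mem hf hg
  add_mem' := by
    rintro f g ⟨N, hf⟩ ⟨M, hg⟩
    refine ⟨N + M, ?_⟩
    have hT := X.pow_add_self_mem_regFin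
    rw [mul_add, pow_add, mul_assoc, mul_left_comm, mul_assoc _ _ g]
    exact add_mem (mul_mem (pow_mem hT _) hf) (mul_mem (pow_mem hT _) hg)
  algebraMap_mem' c := ⟨0, by simp⟩

theorem mem_regAffine_of_pow_add_self {f : K} (hf : f ^ l + f ∈ X.regAffine) :
    f ∈ X.regAffine := by
  obtain ⟨N, hN⟩ := hf
  refine ⟨N, fun A hA => A.mem_of_valuation_le_one _ ?_⟩
  have h1 := (A.valuation_le_one_iff _).2 (X.pow_add_self_mem_regFin A hA)
  have h2 := (A.valuation_le_one_iff _).2 (hN A hA)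
  rw [map_mul, map_pow] at h2 ⊢
  rcases le_or_gt (A.valuation f) 1 with h3 | h3
  · exact mul_le_one' (pow_le_one' h1 N) h3
  · refine le_trans ?_ h2
    rw [A.valuation.map_pow_add_self_of_one_lt X.two_le h3]
    gcongr
    exact le_self_pow₀ h3.le X.l_pos.ne'

theorem x_mem_regAffine {j : ℕ} (hj : j ≤ m) :
    X.x j ∈ X.regAffine ∧ (X.x j ^ l + X.x j)⁻¹ ∈ X.regAffine := by
  induction j with
  | zero =>
    refine ⟨⟨0, by simpa using X.x_zero_mem_regFin⟩, ⟨1, ?_⟩⟩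
    rw [pow_one, mul_inv_cancel₀ (X.pow_add_self_ne_zero hj)]
    exact one_mem _
  | succ j ih =>
    obtain ⟨h1, h2⟩ := ih (by omega)
    have h3 : (X.x j)⁻¹ ∈ X.regAffine := by
      have : (X.x j)⁻¹ = (X.x j ^ (l - 1) + 1) * (X.x j ^ l + X.x j)⁻¹ :=
        congrArg Prod.fst (X.coord_inv (j := j) (by omega))
      rw [this]
      exact mul_mem (add_mem (pow_mem h1 _) (one_mem _)) h2
    refine ⟨X.mem_regAffine_of_pow_add_self ?_, ?_⟩
    · rw [X.rel j hj, div_eq_mul_inv]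
      exact mul_mem (pow_mem h1 _) h2
    · rw [← X.pow_add_self_inv hj]
      exact add_mem (pow_mem h3 _) h3

/-- The functions whose only pole is the pole of `x 0`, together with their values. -/
def O : Subalgebra k (K × (towerPoints k l m → k)) :=
  X.W m ⊓ X.regFin.comap (AlgHom.fst k K (towerPoints k l m → k))

/-- The function underlying an element of `O`. -/
def toK : X.O →ₐ[k] K := (AlgHom.fst k K (towerPoints k l m → k)).comp X.O.val

theorem toK_injective : Function.Injective X.toK := by
  rw [injective_iff_map_eq_zero]
  intro f hf
  exact Subtype.ext ((X.W_fst le_rfl f.2.1).2 hf)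

instance : IsDomain X.O := X.toK_injective.isDomain X.toK.toRingHom

/-- The values of an element of `O` at the rational points. -/
def ev : X.O →ₐ[k] (towerPoints k l m → k) :=
  (AlgHom.snd k K (towerPoints k l m → k)).comp X.O.val

theorem ev_surjective : Function.Surjective X.ev := by
  have := (towerPoints.finite_and_card (m := m) X.two_le X.card_eq).1
  refine surjective_of_separates_points X.ev fun α β hne => ?_
  have h0 : X.coord 0 ∈ X.O := ⟨X.coord_mem_W (Nat.zero_le m), X.x_zero_mem_regFin⟩
  by_cases h : α.1 0 = β.1 0
  · obtain ⟨j, hj⟩ : ∃ j, α.1 j ≠ β.1 j := by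
      by_contra! h1
      exact hne (Subtype.ext (_root_.funext h1))
    have hjm : j ≤ m := by
      by_contra! h1
      rw [α.2.2.2 j h1, β.2.2.2 j h1] at hj
      exact hj rfl
    obtain ⟨N, hN⟩ := (X.x_mem_regAffine hjm).1
    have hf : (X.coord 0 ^ l + X.coord 0) ^ N * X.coord j ∈ X.O :=
      ⟨mul_mem (pow_mem (add_mem (pow_mem h0.1 _) h0.1) _) (X.coord_mem_W hjm), hN⟩
    refine ⟨⟨_, hf⟩, ?_⟩
    change (α.1 0 ^ l + α.1 0) ^ N * α.1 j ≠ (β.1 0 ^ l + β.1 0) ^ N * β.1 j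
    rw [← h]
    exact fun h2 => hj (mul_left_cancel₀ (pow_ne_zero _ α.2.1) h2)
  · exact ⟨⟨_, h0⟩, h⟩

/-- The elements of `O` of bounded pole order. -/
def V (n : ℤ) : Submodule k X.O where
  carrier := {f | X.w (X.toK f) ≤ exp n}
  add_mem' {f g} hf hg := by
    rw [Set.mem_ofPred_eq, map_add]
    exact X.w.map_add_le hf hg
  zero_mem' := by simp
  smul_mem' c f hf := by
    rw [Set.mem_ofPred_eq, map_smul, Algebra.smul_def, map_mul]
    exact (mul_le_mul' (X.w.map_algebraMap_le_of_fintype c) hf).trans_eq (one_mul _)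

theorem exists_linearIndependent_V (n : ℕ) : ∃ (ι : Type) (_ : Fintype ι) (b : ι → X.O),
    n + 1 ≤ Fintype.card ι + (l + 3) * l ^ m ∧ LinearIndependent k b ∧ ∀ i, b i ∈ X.V n := by
  obtain ⟨F, hF, hind⟩ := X.exists_regFin_family
  have hlift (a : Fin (l ^ m)) : ∃ f : X.O, X.toK f = F a := by
    obtain ⟨h1, h2, -⟩ := hF a a.2
    obtain ⟨f, hf, hfa⟩ := X.exists_lift h1
    exact ⟨⟨f, hf, by rw [← hfa] at h2; exact h2⟩, hfa⟩
  choose G hG using hlift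
  let z : X.O := ⟨X.coord 0, X.coord_mem_W (Nat.zero_le m), X.x_zero_mem_regFin⟩
  have hz : X.toK z = X.x 0 := rfl
  have hM : 0 < l ^ m := Nat.pow_pos X.l_pos
  set J := n / l ^ m - (l + 1) with hJ
  refine ⟨Fin (l ^ m) × Fin J, inferInstance, fun i => z ^ (i.2 : ℕ) * G i.1, ?_, ?_, ?_⟩
  · rw [Fintype.card_prod, Fintype.card_fin, Fintype.card_fin]
    have h1 : n < l ^ m * (n / l ^ m + 1) := Nat.lt_mul_div_succ n hM
    have h2 : n / l ^ m ≤ J + (l + 1) := by omega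
    have h3 : l ^ m * (n / l ^ m + 1) ≤ l ^ m * (J + (l + 1) + 1) :=
      Nat.mul_le_mul_left _ (Nat.succ_le_succ h2)
    nlinarith
  · rw [Fintype.linearIndependent_iff]
    intro c hc
    let q : ℕ → k[X] := fun a => if ha : a < l ^ m then
      ∑ i : Fin J, C (c (⟨a, ha⟩, i)) * Polynomial.X ^ (i : ℕ) else 0
    have hq (a : Fin (l ^ m)) : q a = ∑ i : Fin J, C (c (a, i)) * Polynomial.X ^ (i : ℕ) := by
      simp [q]
    have hq0 : ∀ a < l ^ m, q a = 0 := by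
      refine hind q ?_
      rw [← Fin.sum_univ_eq_sum_range fun a => aeval (X.x 0) (q a) * F a]
      have h1 := congrArg X.toK hc
      rw [map_zero, map_sum, Fintype.sum_prod_type] at h1
      rw [← h1]
      refine sum_congr rfl fun a _ => ?_
      rw [hq, map_sum, sum_mul]
      refine sum_congr rfl fun i _ => ?_
      have h3 : X.toK (c (a, i) • (z ^ (i : ℕ) * G a)) = c (a, i) • (X.x 0 ^ (i : ℕ) * F a) := by
        rw [map_smul, map_mul, map_pow, hz, hG]
      refine Eq.trans ?_ h3.symm
      rw [Algebra.smul_def]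
      simp [mul_assoc]
    rintro ⟨a, i⟩
    have h2 := congrArg (fun p => coeff p i) ((hq a).symm.trans (hq0 a a.2))
    simpa [finsetSum_coeff, coeff_C_mul, coeff_X_pow, Fin.val_inj] using h2
  · rintro ⟨a, i⟩
    change X.w (X.toK (z ^ (i : ℕ) * G a)) ≤ exp (n : ℤ)
    rw [map_mul, map_mul, map_pow, map_pow, hz, hG]
    calc X.w (X.x 0) ^ (i : ℕ) * X.w (F a) ≤ X.w (X.x 0) ^ (i : ℕ) * X.w (X.x 0) ^ (l + 2) := by
          gcongr
          exact (hF a a.2).2.2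
      _ = exp (((i + (l + 2) : ℕ) : ℤ) * (l : ℤ) ^ m) := by
          rw [← pow_add, X.w_x (Nat.zero_le m), Nat.sub_zero, ← exp_nsmul, nsmul_eq_mul]
      _ ≤ exp (n : ℤ) := by
          rw [exp_le_exp]
          have h1 : (i : ℕ) + (l + 2) ≤ n / l ^ m := by have := i.2; omega
          exact_mod_cast (Nat.mul_le_mul_right _ h1).trans (Nat.div_mul_le_self n _)

theorem exp_add_one_le {a : ℤᵐ⁰} {n : ℤ} (h : ¬ a ≤ exp n) : exp (n + 1) ≤ a := by
  rw [not_le] at h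
  have h0 : a ≠ 0 := (zero_lt_iff.1 (zero_le.trans_lt h))
  rw [← exp_log h0, exp_lt_exp] at h
  rw [← exp_log h0, exp_le_exp]
  omega

/-- The one-point data of the tower. -/
def orderDomain : OrderDomain k (towerPoints k l m) X.O ((l + 3) * l ^ m) where
  V := X.V
  mono a b hab f hf := le_trans (show X.w (X.toK f) ≤ exp a from hf) (exp_le_exp.2 hab)
  eq_zero f hf := by
    refine X.toK_injective ?_
    rw [map_zero]
    refine X.eq_zero_of_w_lt_one (X.W_fst le_rfl f.2.1).1 f.2.2 ?_
    exact lt_of_le_of_lt (show X.w (X.toK f) ≤ exp (-1) from hf)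
      (by rw [← exp_zero, exp_lt_exp]; simp)
  exists_mem f := by
    rcases eq_or_ne (X.w (X.toK f)) 0 with h | h
    · exact ⟨0, show X.w (X.toK f) ≤ _ by rw [h]; exact zero_le⟩
    · refine ⟨(log (X.w (X.toK f))).toNat, show X.w (X.toK f) ≤ _ from ?_⟩
      conv_lhs => rw [← exp_log h]
      rw [exp_le_exp]
      exact Int.self_le_toNat _
  mul_mem {a b f f'} hf hf' := by
    change X.w (X.toK (f * f')) ≤ exp (a + b)
    rw [map_mul, map_mul, exp_add]
    exact mul_le_mul' hf hf'
  mul_notMem {a b f f'} hf hf' h := by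
    change X.w (X.toK (f * f')) ≤ exp (a + b + 1) at h
    rw [map_mul, map_mul] at h
    have := (mul_le_mul' (exp_add_one_le hf) (exp_add_one_le hf')).trans h
    rw [← exp_add, exp_le_exp] at this
    omega
  lead n := X.lead n ∘ₗ X.toK.toLinearMap
  lead_spec hf h := X.lead_spec hf h
  exists_linearIndependent := X.exists_linearIndependent_V
  ev := X.ev
  ev_surjective := X.ev_surjective

end Tower

/-- An additive map commuting with the multiplication by scalars, as a linear map. -/
def AddMonoidHom.toLinearMapOfAlgebra {k A : Type} [Field k] [Ring A] [Algebra k A] (φ : A →+ k)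
    (h : ∀ c f, φ (algebraMap k A c * f) = c * φ f) : A →ₗ[k] k where
  __ := φ
  map_smul' c f := by
    rw [Algebra.smul_def]
    exact h c f

namespace LaurentSeries

open WithZero

variable {k : Type} [Field k]

theorem le_exp_sub_one_of_lt {a : ℤᵐ⁰} {n : ℤ} (h : a < exp n) : a ≤ exp (n - 1) := by
  rcases eq_or_ne a 0 with rfl | h0
  · exact zero_le
  · rw [← exp_log h0, exp_lt_exp] at h
    rw [← exp_log h0, exp_le_exp]
    omega

theorem exists_coe_X_mul_iff {f : LaurentSeries k} :
    Valued.v f < (1 : ℤᵐ⁰) ↔ ∃ F : PowerSeries k, F ∈ Ideal.span {PowerSeries.X} ∧ f = F := by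
  constructor
  · intro h
    obtain ⟨F, rfl⟩ := (val_le_one_iff_eq_coe k f).1 h.le
    refine ⟨F, ?_, rfl⟩
    rw [Ideal.mem_span_singleton, PowerSeries.X_dvd_iff,
      ← PowerSeries.coeff_zero_eq_constantCoeff_apply]
    have h1 : Valued.v (F : LaurentSeries k) ≤ exp (-1 : ℤ) := le_exp_sub_one_of_lt h
    have := (valuation_le_iff_coeff_lt_eq_zero k).1 h1 0 one_pos
    rwa [show (0 : ℤ) = (0 : ℕ) from rfl, coeff_coe_powerSeries] at this
  · rintro ⟨F, hF, rfl⟩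
    rw [Ideal.mem_span_singleton] at hF
    obtain ⟨G, rfl⟩ := hF
    rw [PowerSeries.coe_mul, map_mul]
    have h1 := valuation_X_pow k 1
    rw [pow_one] at h1
    rw [h1]
    calc _ ≤ exp (-((1 : ℕ) : ℤ)) * (1 : ℤᵐ⁰) :=
          mul_le_mul' le_rfl ((val_le_one_iff_eq_coe k _).2 ⟨G, rfl⟩)
      _ < 1 := by rw [mul_one, ← exp_zero, exp_lt_exp]; simp

/-- Hensel's lemma for the equation `y ^ l + y = u`. -/
theorem exists_pow_add_self {l : ℕ} (hl : 2 ≤ l) {u : LaurentSeries k}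
    (hu : Valued.v u < (1 : ℤᵐ⁰)) :
    ∃ y : LaurentSeries k, Valued.v y < (1 : ℤᵐ⁰) ∧ y ^ l + y = u := by
  obtain ⟨U, hU, rfl⟩ := exists_coe_X_mul_iff.1 hu
  let p : Polynomial (PowerSeries k) := Polynomial.X ^ l + (Polynomial.X - Polynomial.C U)
  have hp : p.Monic := Polynomial.monic_X_pow_add (by
    rw [Polynomial.degree_X_sub_C]; exact_mod_cast hl)
  obtain ⟨Y, hY, hY0⟩ := HenselianRing.is_henselian
    (I := Ideal.span {(PowerSeries.X : PowerSeries k)}) p hp 0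
    (by simpa [p, show l ≠ 0 by omega] using hU)
    (by simp [p, Polynomial.derivative_X_pow, show l - 1 ≠ 0 by omega])
  refine ⟨Y, exists_coe_X_mul_iff.2 ⟨Y, by simpa using hY0, rfl⟩, ?_⟩
  have h1 : Y ^ l + Y = U := by
    have : Y ^ l + (Y - U) = 0 := by simpa [p] using hY
    linear_combination this
  rw [← h1, PowerSeries.coe_add, PowerSeries.coe_pow]

theorem exists_succ {l : ℕ} (hl : 2 ≤ l)
    (f : {f : LaurentSeries k // f ≠ 0 ∧ Valued.v f < (1 : ℤᵐ⁰)}) :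
    ∃ g : {f : LaurentSeries k // f ≠ 0 ∧ Valued.v f < (1 : ℤᵐ⁰)},
      g.1 ^ l + g.1 = f.1 ^ (l + 1) / (f.1 ^ l + f.1) := by
  obtain ⟨f, h0, h1⟩ := f
  have hv := Valuation.map_pow_add_self_of_lt Valued.v hl h1
  have hv0 : (Valued.v f : ℤᵐ⁰) ≠ 0 := Valued.v.ne_zero_iff.2 h0
  have hu : (Valued.v (f ^ (l + 1) / (f ^ l + f)) : ℤᵐ⁰) = Valued.v f ^ l := by
    rw [map_div₀, hv, map_pow, pow_succ, mul_div_cancel_right₀ _ hv0]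
  obtain ⟨g, hg, hgu⟩ := exists_pow_add_self hl (u := f ^ (l + 1) / (f ^ l + f))
    (hu ▸ pow_lt_one₀ zero_le h1 (by omega))
  refine ⟨⟨g, ?_, hg⟩, hgu⟩
  rintro rfl
  rw [← hgu, zero_pow (by omega), add_zero, map_zero] at hu
  exact pow_ne_zero _ hv0 hu.symm

theorem exists_tower [Fintype k] {l : ℕ} (hl : 3 ≤ l) (hk : Fintype.card k = l ^ 2) (m : ℕ) :
    Nonempty (Tower k (LaurentSeries k) l m) := by
  choose s hs using exists_succ (k := k) (l := l) (by omega)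
  have hX :
      (Valued.v ((PowerSeries.X : PowerSeries k) : LaurentSeries k) : ℤᵐ⁰) = exp (-1 : ℤ) := by
    simpa using valuation_X_pow k 1
  let y₀ : {f : LaurentSeries k // f ≠ 0 ∧ Valued.v f < (1 : ℤᵐ⁰)} :=
    ⟨(PowerSeries.X : PowerSeries k), by
      rw [← (Valued.v : Valuation (LaurentSeries k) ℤᵐ⁰).ne_zero_iff, hX]; exact exp_ne_zero, by
      rw [hX, ← exp_zero, exp_lt_exp]; simp⟩
  let y : ℕ → {f : LaurentSeries k // f ≠ 0 ∧ Valued.v f < (1 : ℤᵐ⁰)} := fun n => s^[n] y₀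
  refine ⟨{
    three_le := hl
    card_eq := hk
    x := fun j => (y (m - j)).1⁻¹
    rel := fun j hj => ?_
    w := Valued.v
    one_lt_w := ?_
    w_last := ?_
    lead := fun n => (HahnSeries.coeff.addMonoidHom (-n)).toLinearMapOfAlgebra fun c f => by
      rw [algebraMap_apply, HahnSeries.C_mul_eq_smul]
      exact HahnSeries.coeff_smul
    lead_spec := fun {n f} hf h => ?_ }⟩
  · have h1 := hs (y (m - (j + 1)))
    have h2 : s (y (m - (j + 1))) = y (m - j) := by
      rw [show m - j = m - (j + 1) + 1 by omega]
      exact (Function.iterate_succ_apply' s _ _).symm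
    rw [h2] at h1
    have hne (i : ℕ) : (y i).1 ^ l + (y i).1 ≠ 0 := by
      rw [← (Valued.v : Valuation (LaurentSeries k) ℤᵐ⁰).ne_zero_iff,
        Valuation.map_pow_add_self_of_lt Valued.v (by omega) (y i).2.2, Valuation.ne_zero_iff]
      exact (y i).2.1
    have ha := (y (m - j)).2.1
    have hb := (y (m - (j + 1))).2.1
    have ha' := hne (m - j)
    have hb' := hne (m - (j + 1))
    generalize (y (m - j)).1 = a at *
    generalize (y (m - (j + 1))).1 = b at *
    have e (c : LaurentSeries k) (hc : c ≠ 0) : c⁻¹ ^ l + c⁻¹ = (c ^ l + c) / c ^ (l + 1) := by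
      have := pow_ne_zero l hc
      rw [inv_pow, pow_succ]
      field_simp
      exact add_comm _ _
    rw [e b hb, e a ha, ← inv_div, ← h1, inv_pow]
    field_simp
  · exact (one_lt_inv₀ (zero_lt_iff.2 ((Valuation.ne_zero_iff _).2 (y _).2.1))).2 (y _).2.2
      |>.trans_eq (map_inv₀ _ _).symm
  · rw [map_inv₀, Nat.sub_self]
    change (Valued.v ((PowerSeries.X : PowerSeries k) : LaurentSeries k) : ℤᵐ⁰)⁻¹ = _
    rw [hX, ← exp_neg, neg_neg]
  · change f.coeff (-n) = 0 at h
    rw [show n = -(-n) by ring] at hf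
    rw [show n - 1 = -(-n + 1) by ring, valuation_le_iff_coeff_lt_eq_zero]
    intro i hi
    rcases (Int.lt_add_one_iff.1 hi).lt_or_eq with h2 | rfl
    · exact (valuation_le_iff_coeff_lt_eq_zero k).1 hf i h2
    · exact h

end LaurentSeries

theorem exists_evaluationPair (k : Type) [Field k] [Fintype k] (l : ℕ) (hl : 3 ≤ l)
    (hk : Fintype.card k = l ^ 2) (m : ℕ) :
    ∃ (P : Type) (_ : Fintype P), Fintype.card P = (l ^ 2 - l) * l ^ m ∧
      Nonempty (EvaluationPair k P (2 * l ^ m) ((4 * l + 16) * l ^ m)) := by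
  obtain ⟨X⟩ := LaurentSeries.exists_tower hl hk m
  obtain ⟨hfin, hcard⟩ := towerPoints.finite_and_card (m := m) X.two_le hk
  have := Fintype.ofFinite (towerPoints k l m)
  refine ⟨towerPoints k l m, this, by rw [← hcard, Nat.card_eq_fintype_card], ?_⟩
  have h := X.orderDomain.evaluationPair (2 * l ^ m)
  rw [show 2 * (2 * ((l + 3) * l ^ m) + 2 * l ^ m) = (4 * l + 16) * l ^ m by ring] at h
  exact ⟨h⟩

/-- For `q = 8`, `q = 9`, and every prime power `q ≥ 16`, there exist constants `κ, τ > 0`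
and an infinite sequence of `(n_j, t_j, 2, n_j − t_j)`-arithmetic secret sharing schemes
for `F_q^{k_j}` over `F_q` with uniformity, `n_j → ∞`, `k_j ≥ κ n_j` and `t_j ≥ τ n_j`. -/
theorem stmt0 (q : ℕ) (hq : q = 8 ∨ q = 9 ∨ (IsPrimePow q ∧ 16 ≤ q))
    (F : Type) [Field F] [Fintype F] (hF : Fintype.card F = q) :
    ∃ (κ τ : ℝ), 0 < κ ∧ 0 < τ ∧
      ∃ (n k t : ℕ → ℕ)
        (C : ∀ j, Submodule F ((Fin (k j) → F) × (Fin (n j) → F))),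
        Tendsto n atTop atTop ∧
        ∀ j, IsASSS (t j) 2 (n j - t j) (C j) ∧ IsUniform (t j) (C j) ∧
          κ * (n j : ℝ) ≤ (k j : ℝ) ∧ τ * (n j : ℝ) ≤ (t j : ℝ) := by
  exact exists_isASSS_sequence F (by omega) exists_evaluationPair
end

section
/- Let C be an (n,t,d,r)-arithmetic secret sharing scheme for F_q^k over F_q. Then C, viewed as an n-code for F_q^k, is (r − (d−1)t)-reconstructing; consequently dt + k ≤ r. In particular, if k = 1, d = 2 and r = n − t, then 3t + 1 ≤ n. -/
open Filter

/-- A disconnected code has a codeword with any prescribed secret whose shares vanish on any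
set of at most `t` coordinates. -/
theorem IsDisconnected.exists_mem_eq_zero {F : Type} [Field F] {k n t : ℕ}
    {C : Submodule F ((Fin k → F) × (Fin n → F))} (hC : IsDisconnected t C) (ht : 1 ≤ t)
    (S : Finset (Fin n)) (hS : S.card ≤ t) (s : Fin k → F) :
    ∃ c ∈ C, c.1 = s ∧ ∀ i ∈ S, c.2 i = 0 := by
  rcases hC with h | ⟨-, htn, h⟩
  · omega
  obtain ⟨A, hSA, -, hA⟩ := Finset.exists_subsuperset_card_eq (Finset.subset_univ S) hS
    (by simpa using htn.le)
  obtain ⟨c, hc, hcs, hcA⟩ := h A hA s 0 C.zero_mem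
  exact ⟨c, hc, hcs, fun i hi => by simpa using hcA i (hSA hi)⟩

/-- A set of at most `j * t` coordinates is killed by a product of `j` codewords with secret `1`. -/
theorem IsDisconnected.exists_prod_eq_zero {F : Type} [Field F] {k n t : ℕ}
    {C : Submodule F ((Fin k → F) × (Fin n → F))} (hC : IsDisconnected t C) (ht : 1 ≤ t)
    (j : ℕ) (S : Finset (Fin n)) (hS : S.card ≤ j * t) :
    ∃ f : Fin j → ((Fin k → F) × (Fin n → F)), (∀ i, f i ∈ C) ∧ (∏ i, f i).1 = 1 ∧
      ∀ i ∈ S, (∏ i, f i).2 i = 0 := by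
  induction j generalizing S with
  | zero =>
    have hS0 : S = ∅ := by simpa using hS
    exact ⟨Fin.elim0, fun i => i.elim0, by simp, by simp [hS0]⟩
  | succ j ih =>
    obtain ⟨B, hBS, hB⟩ := Finset.exists_subset_card_eq (min_le_right t S.card)
    obtain ⟨c, hc, hc1, hcB⟩ := hC.exists_mem_eq_zero ht B (hB.le.trans (min_le_left _ _)) 1
    have hdiff : (S \ B).card ≤ j * t := by
      rw [Finset.card_sdiff_of_subset hBS, hB]
      rw [add_mul, one_mul] at hS
      omega
    obtain ⟨f, hf, hf1, hfS⟩ := ih (S \ B) hdiff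
    refine ⟨Fin.cons c f, Fin.cases hc hf, ?_, fun i hi => ?_⟩
    · simp [Fin.prod_univ_succ, hc1, hf1]
    · rw [Fin.prod_univ_succ]
      by_cases hiB : i ∈ B
      · simp [hcB i hiB]
      · simp only [Fin.cons_zero, Fin.cons_succ, Prod.snd_mul, Pi.mul_apply]
        rw [hfS i (Finset.mem_sdiff.2 ⟨hi, hiB⟩), mul_zero]

/-- If the `(e + 1)`-st power of a `t`-disconnected code is `r`-reconstructing, then the code
itself is `(r - e * t)`-reconstructing. -/
theorem IsReconstructing.of_codePow {F : Type} [Field F] {k n t e r : ℕ}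
    {C : Submodule F ((Fin k → F) × (Fin n → F))} (hr : r ≤ n) (ht : 1 ≤ t)
    (hC : IsDisconnected t C) (hrec : IsReconstructing r (codePow (e + 1) C)) :
    IsReconstructing (r - e * t) C := by
  intro B hB c hc hcB
  obtain ⟨A, hBA, -, hA⟩ := Finset.exists_subsuperset_card_eq (n := r) (Finset.subset_univ B)
    (by omega) (by simpa using hr)
  obtain ⟨f, hf, hf1, hfA⟩ := hC.exists_prod_eq_zero ht e (A \ B) (by
    rw [Finset.card_sdiff_of_subset hBA, hA, hB]; omega)
  have hmem : c * ∏ i, f i ∈ codePow (e + 1) C :=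
    Submodule.subset_span ⟨Fin.cons c f, Fin.cases hc hf, by simp [Fin.prod_univ_succ]⟩
  have h := hrec A hA _ hmem fun i hi => by
    by_cases hiB : i ∈ B
    · simp [hcB i hiB]
    · rw [Prod.snd_mul, Pi.mul_apply, hfA i (Finset.mem_sdiff.2 ⟨hi, hiB⟩), mul_zero]
  simpa only [Prod.fst_mul, hf1, mul_one] using h

/-- If the shares in `B` determine the secret while those in `A`, with `|A| ≤ t`, say nothing
about it, then `B \ A` has at least `k` elements. -/
theorem IsDisconnected.le_card_sdiff {F : Type} [Field F] {k n t : ℕ}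
    {C : Submodule F ((Fin k → F) × (Fin n → F))} (hC : IsDisconnected t C) (ht : 1 ≤ t)
    (A B : Finset (Fin n)) (hA : A.card ≤ t)
    (hB : ∀ c ∈ C, (∀ i ∈ B, c.2 i = 0) → c.1 = 0) :
    k ≤ (B \ A).card := by
  choose g hgC hg1 hgA using fun j : Fin k =>
    hC.exists_mem_eq_zero ht A hA (Pi.single j (1 : F))
  have hli : LinearIndependent F fun (j : Fin k) (i : ↥(B \ A)) => (g j).2 i := by
    rw [Fintype.linearIndependent_iff]
    intro a ha
    have h := hB (∑ j, a j • g j) (C.sum_mem fun j _ => C.smul_mem _ (hgC j)) fun i hi => by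
      by_cases hiA : i ∈ A
      · simp [Prod.snd_sum, Finset.sum_apply, hgA _ i hiA]
      · simpa [Prod.snd_sum, Finset.sum_apply] using
          congrFun ha ⟨i, Finset.mem_sdiff.2 ⟨hi, hiA⟩⟩
    intro j
    simpa [Prod.fst_sum, Finset.sum_apply, hg1, Pi.single_apply] using congrFun h j
  simpa only [Fintype.card_fin, Module.finrank_fintype_fun_eq_card, Fintype.card_coe] using
    hli.fintype_card_le_finrank

/-- A nontrivial `t`-disconnected, `m`-reconstructing code for `F_q^k` has `t + k ≤ m`. -/
theorem IsDisconnected.add_le {F : Type} [Field F] {k n t m : ℕ}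
    {C : Submodule F ((Fin k → F) × (Fin n → F))} (hC : IsDisconnected t C) (ht : 1 ≤ t)
    (hk : 1 ≤ k) (hm : m ≤ n) (hrec : IsReconstructing m C) : t + k ≤ m := by
  obtain ⟨B, -, hB⟩ := Finset.exists_subset_card_eq
    (show m ≤ (Finset.univ : Finset (Fin n)).card by simpa using hm)
  obtain ⟨A, hAB, hA⟩ := Finset.exists_subset_card_eq (min_le_right t B.card)
  have h := hC.le_card_sdiff ht A B (hA.le.trans (min_le_left _ _)) (hrec B hB)
  rw [Finset.card_sdiff_of_subset hAB, hA, hB] at h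
  omega

/-- Let `C` be an `(n,t,d,r)`-arithmetic secret sharing scheme for `F_q^k` over `F_q`.
Then `C` is `(r − (d−1)t)`-reconstructing; consequently `dt + k ≤ r`. In particular,
if `k = 1`, `d = 2` and `r = n − t`, then `3t + 1 ≤ n`. -/
theorem stmt1 (F : Type) [Field F] [Fintype F] (k n t d r : ℕ)
    (hk : 1 ≤ k) (hn : 1 ≤ n) (hr : r ≤ n)
    (C : Submodule F ((Fin k → F) × (Fin n → F)))
    (hC : IsASSS t d r C) :
    IsReconstructing (r - (d - 1) * t) C ∧ d * t + k ≤ r ∧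
      (k = 1 → d = 2 → r = n - t → 3 * t + 1 ≤ n) := by
  obtain ⟨-, ht, hd, hdis, -, hrec⟩ := hC
  obtain ⟨e, rfl⟩ : ∃ e, d = e + 1 := ⟨d - 1, by omega⟩
  have hrecC : IsReconstructing (r - (e + 1 - 1) * t) C :=
    IsReconstructing.of_codePow hr ht hdis hrec
  have hle := hdis.add_le ht hk (by omega) hrecC
  have hbound : (e + 1) * t + k ≤ r := by
    rw [Nat.add_sub_cancel] at hle
    rw [add_mul, one_mul]
    omega
  refine ⟨hrecC, hbound, fun hk1 he hrn => ?_⟩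
  rw [he] at hbound
  omega
end

section
/- For all integers q ≥ 2 and s ≥ 2, one has R_q(s) ≤ 1/s. -/
open Filter

/-- The set of descendants of a set `A ⊆ S^n` of words: all words agreeing in each
coordinate with some word of `A`. -/
def descSet {S : Type*} {n : ℕ} (A : Set (Fin n → S)) : Set (Fin n → S) :=
  {x | ∀ i, ∃ a ∈ A, x i = a i}

/-- A `q`-ary `s`-frameproof code of length `n`: for every `A ⊆ C` with `|A| ≤ s`,
`desc(A) ∩ C = A`. -/
def IsFrameproof {S : Type*} {n : ℕ} (s : ℕ) (C : Set (Fin n → S)) : Prop :=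
  ∀ A ⊆ C, A.ncard ≤ s → descSet A ∩ C = A

/-- `M_q(n,s)`: the maximal size of a `q`-ary `s`-frameproof code of length `n`. -/
noncomputable def Mfp (q n s : ℕ) : ℕ :=
  sSup {M | ∃ C : Set (Fin n → Fin q), IsFrameproof s C ∧ C.ncard = M}

/-- `R_q(s) = limsup_{n→∞} log_q M_q(n,s) / n`. -/
noncomputable def Rfp (q s : ℕ) : ℝ :=
  limsup (fun n => Real.logb q (Mfp q n s) / (n : ℝ)) atTop

/-- Each word `x` of an `s`-frameproof code has a residue class modulo `s` such that `x` is the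
only codeword with its values at the coordinates in that class. -/
theorem IsFrameproof.exists_own_residue {S : Type*} {n s : ℕ} (hs : 0 < s)
    {C : Set (Fin n → S)} (hC : IsFrameproof s C) {x : Fin n → S} (hx : x ∈ C) :
    ∃ j : Fin s, ∀ y ∈ C, (∀ i : Fin n, (i : ℕ) % s = j → x i = y i) → x = y := by
  by_contra! h
  choose a haC hagree hne using h
  have hcard : (Set.range a).ncard ≤ s := by
    rw [← Set.image_univ]
    refine (Set.ncard_image_le Set.finite_univ).trans ?_
    simp [Set.ncard_univ]
  have hdesc := hC (Set.range a) (Set.range_subset_iff.2 haC) hcard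
  have hmem : x ∈ descSet (Set.range a) ∩ C :=
    ⟨fun i => ⟨_, ⟨⟨(i : ℕ) % s, Nat.mod_lt _ hs⟩, rfl⟩, hagree _ i rfl⟩, hx⟩
  rw [hdesc] at hmem
  obtain ⟨j, hj⟩ := hmem
  exact hne j hj.symm

theorem IsFrameproof.ncard_le {q n s : ℕ} (hq : 0 < q) (hs : 0 < s)
    {C : Set (Fin n → Fin q)} (hC : IsFrameproof s C) : C.ncard ≤ s * q ^ (n / s + 1) := by
  have : Nonempty (Fin s) := ⟨⟨0, hs⟩⟩
  choose! j hj using fun x (hx : x ∈ C) => hC.exists_own_residue hs hx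
  let g : (Fin n → Fin q) → Fin s × (Fin (n / s + 1) → Fin q) := fun x =>
    (j x, fun k => if h : (j x : ℕ) + s * k < n then x ⟨j x + s * k, h⟩ else ⟨0, hq⟩)
  have hg : Set.InjOn g C := by
    intro x hx y hy hxy
    obtain ⟨h₁, h₂⟩ := Prod.ext_iff.1 hxy
    change j x = j y at h₁
    refine hj x hx y hy fun i hi => ?_
    have hdecomp : (j x : ℕ) + s * ((i : ℕ) / s) = i := by
      rw [← hi]; exact Nat.mod_add_div _ _
    have hk : (i : ℕ) / s < n / s + 1 := Nat.lt_succ_of_le (Nat.div_le_div_right i.2.le)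
    have := congrFun h₂ ⟨(i : ℕ) / s, hk⟩
    simpa only [g, ← h₁, hdecomp, i.2, dite_true, Fin.eta] using this
  have := Set.ncard_le_ncard_of_injOn (t := Set.univ) g (fun _ _ => Set.mem_univ _) hg
  simpa [Set.ncard_univ] using this

theorem Mfp_le {q n s : ℕ} (hq : 0 < q) (hs : 0 < s) : Mfp q n s ≤ s * q ^ (n / s + 1) := by
  refine csSup_le' ?_
  rintro _ ⟨C, hC, rfl⟩
  exact hC.ncard_le hq hs

theorem logb_Mfp_le {q s : ℕ} (n : ℕ) (hq : 2 ≤ q) (hs : 0 < s) :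
    Real.logb q (Mfp q n s) ≤ Real.logb q s + 1 + (n : ℝ) / s := by
  have hq₁ : (1 : ℝ) < q := by exact_mod_cast hq
  have hs₁ : (1 : ℝ) ≤ s := by exact_mod_cast hs
  have hdiv : ((n / s : ℕ) : ℝ) ≤ (n : ℝ) / s := Nat.cast_div_le
  rcases Nat.eq_zero_or_pos (Mfp q n s) with h | h
  · have := Real.logb_nonneg hq₁ hs₁
    rw [h, Nat.cast_zero, Real.logb_zero]
    positivity
  · have hle : (Mfp q n s : ℝ) ≤ s * (q : ℝ) ^ (n / s + 1) := by
      exact_mod_cast Mfp_le (by omega) hs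
    calc Real.logb q (Mfp q n s) ≤ Real.logb q (s * (q : ℝ) ^ (n / s + 1)) :=
          Real.logb_le_logb_of_le hq₁ (by exact_mod_cast h) hle
      _ = Real.logb q s + ((n / s : ℕ) + 1) := by
          rw [Real.logb_mul (by positivity) (by positivity), Real.logb_pow,
            Real.logb_self_eq_one hq₁]
          push_cast
          ring
      _ ≤ Real.logb q s + 1 + (n : ℝ) / s := by linarith

/-- For all integers `q ≥ 2` and `s ≥ 2`, `R_q(s) ≤ 1/s`. -/
theorem stmt9 (q s : ℕ) (hq : 2 ≤ q) (hs : 2 ≤ s) : Rfp q s ≤ 1 / (s : ℝ) := by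
  have hq₁ : (1 : ℝ) < q := by exact_mod_cast hq
  have hlim : Tendsto (fun n : ℕ => (Real.logb q s + 1) / (n : ℝ) + 1 / s) atTop
      (nhds (1 / (s : ℝ))) := by
    simpa using (tendsto_const_div_atTop_nhds_zero_nat (Real.logb q s + 1)).add_const (1 / (s : ℝ))
  have hnonneg : ∀ n : ℕ, 0 ≤ Real.logb q (Mfp q n s) / (n : ℝ) := by
    intro n
    refine div_nonneg ?_ n.cast_nonneg
    rcases Nat.eq_zero_or_pos (Mfp q n s) with h | h
    · simp [h]
    · exact Real.logb_nonneg hq₁ (by exact_mod_cast h)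
  have hle : ∀ᶠ n : ℕ in atTop,
      Real.logb q (Mfp q n s) / (n : ℝ) ≤ (Real.logb q s + 1) / (n : ℝ) + 1 / s := by
    filter_upwards [eventually_gt_atTop 0] with n hn
    have hn₀ : (0 : ℝ) < n := by exact_mod_cast hn
    rw [div_le_iff₀ hn₀]
    refine (logb_Mfp_le n hq (by omega)).trans_eq ?_
    field_simp
  calc Rfp q s ≤ limsup (fun n : ℕ => (Real.logb q s + 1) / (n : ℝ) + 1 / s) atTop :=
        limsup_le_limsup hle
          (isBoundedUnder_of ⟨0, hnonneg⟩ : IsBoundedUnder (· ≥ ·) atTop _).isCoboundedUnder_le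
          hlim.isBoundedUnder_le
    _ = 1 / (s : ℝ) := hlim.limsup_eq
end

section
/- Let q be a prime power and s an integer with 2 ≤ s < q. Then R_q(s) ≥ 1 − H_q(1 − 1/s), where H_q(δ) = δ·log_q(q−1) − δ·log_q δ − (1−δ)·log_q(1−δ) is the q-ary entropy function (logarithms in base q). -/
open Filter

/-- The `q`-ary entropy function. -/
noncomputable def entropyQ (q : ℕ) (δ : ℝ) : ℝ :=
  δ * Real.logb q ((q : ℝ) - 1) - δ * Real.logb q δ - (1 - δ) * Real.logb q (1 - δ)

lemma card_agree_add_hammingDist {ι α : Type*} [Fintype ι] [DecidableEq α] (x y : ι → α) :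
    (Finset.univ.filter fun i => x i = y i).card + hammingDist x y = Fintype.card ι := by
  simpa [hammingDist] using Finset.card_filter_add_card_filter_not
    (s := Finset.univ) (fun i => x i = y i)

section Covering

variable {ι α : Type*} [Fintype ι] [Fintype α] [DecidableEq ι] [DecidableEq α]

/-- The weight enumerator of the whole space, centred at `a`. -/
lemma sum_pow_hammingDist (a : ι → α) (t : ℝ) :
    ∑ x : ι → α, t ^ hammingDist x a =
      (1 + ((Fintype.card α : ℝ) - 1) * t) ^ Fintype.card ι := by
  have hcoord (b : α) : ∑ c : α, (if c = b then 1 else t) =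
      1 + ((Fintype.card α : ℝ) - 1) * t := by
    have h (c : α) : (if c = b then (1 : ℝ) else t) = (if c = b then 1 - t else 0) + t := by
      split_ifs <;> ring
    simp only [h, Finset.sum_add_distrib, Finset.sum_ite_eq', Finset.mem_univ, if_true,
      Finset.sum_const, Finset.card_univ, nsmul_eq_mul]
    ring
  calc ∑ x : ι → α, t ^ hammingDist x a
      = ∑ x : ι → α, ∏ i, (if x i = a i then 1 else t) := by
        refine Finset.sum_congr rfl fun x _ => ?_
        rw [Finset.prod_ite, Finset.prod_const_one, one_mul, Finset.prod_const]
        rfl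
    _ = ∏ i, ∑ c : α, (if c = a i then 1 else t) := by
        rw [Finset.prod_univ_sum, Fintype.piFinset_univ]
    _ = _ := by simp [hcoord]

/-- Chernoff-type bound for the volume of a Hamming ball. -/
lemma card_ball_mul_rpow_le (a : ι → α) {t r : ℝ} (ht : 0 < t) (ht1 : t ≤ 1) :
    ((Finset.univ.filter fun x : ι → α => (hammingDist x a : ℝ) ≤ r).card : ℝ) * t ^ r ≤
      (1 + ((Fintype.card α : ℝ) - 1) * t) ^ Fintype.card ι := by
  rw [← sum_pow_hammingDist a t, ← nsmul_eq_mul, ← Finset.sum_const]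
  refine (Finset.sum_le_sum fun x hx => ?_).trans
    (Finset.sum_le_sum_of_subset_of_nonneg (Finset.subset_univ _) fun x _ _ => by positivity)
  rw [← Real.rpow_natCast]
  exact Real.rpow_le_rpow_of_exponent_ge ht ht1 (Finset.mem_filter.1 hx).2

/-- A maximal code with all distances greater than `r` has covering radius at most `r`. -/
lemma exists_separated_covering {r : ℝ} (hr : 0 ≤ r) :
    ∃ C : Finset (ι → α), (∀ x ∈ C, ∀ y ∈ C, x ≠ y → r < hammingDist x y) ∧
      ∀ x, ∃ y ∈ C, (hammingDist x y : ℝ) ≤ r := by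
  let P : Finset (ι → α) → Prop := fun C => ∀ x ∈ C, ∀ y ∈ C, x ≠ y → r < hammingDist x y
  have hempty : P ∅ := by simp [P]
  obtain ⟨C, -, hC⟩ := Finite.exists_le_maximal hempty
  refine ⟨C, hC.prop, fun x => ?_⟩
  by_contra! hx
  have hins : P (insert x C) := by
    intro u hu v hv huv
    rcases Finset.mem_insert.1 hu with rfl | huC <;> rcases Finset.mem_insert.1 hv with rfl | hvC
    · exact absurd rfl huv
    · exact hx v hvC
    · rw [hammingDist_comm]; exact hx u huC
    · exact hC.prop u huC v hvC huv
  have hxC : x ∈ C := hC.le_of_ge hins (Finset.subset_insert x C) (Finset.mem_insert_self x C)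
  have := hx x hxC
  rw [hammingDist_self, Nat.cast_zero] at this
  linarith

/-- The Gilbert–Varshamov bound. -/
lemma exists_separated_card_ge {t r : ℝ} (hr : 0 ≤ r) (ht : 0 < t) (ht1 : t ≤ 1) :
    ∃ C : Finset (ι → α), (∀ x ∈ C, ∀ y ∈ C, x ≠ y → r < hammingDist x y) ∧
      (Fintype.card α : ℝ) ^ Fintype.card ι * t ^ r ≤
        C.card * (1 + ((Fintype.card α : ℝ) - 1) * t) ^ Fintype.card ι := by
  obtain ⟨C, hsep, hcov⟩ := exists_separated_covering (ι := ι) (α := α) hr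
  refine ⟨C, hsep, ?_⟩
  have hunion : (Finset.univ : Finset (ι → α)) ⊆
      C.biUnion fun a => Finset.univ.filter fun x => (hammingDist x a : ℝ) ≤ r := by
    intro x _
    simpa using hcov x
  have hcard := (Finset.card_le_card hunion).trans Finset.card_biUnion_le
  rw [Finset.card_univ, Fintype.card_fun] at hcard
  have hcard' := (Nat.cast_le (α := ℝ)).2 hcard
  push_cast at hcard'
  refine (mul_le_mul_of_nonneg_right hcard' (by positivity)).trans ?_
  rw [Finset.sum_mul, ← nsmul_eq_mul]
  exact Finset.sum_le_card_nsmul _ _ _ fun a _ => card_ball_mul_rpow_le a ht ht1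

end Covering

/-- A code whose distances all exceed `(1 - 1/s) n` is `s`-frameproof. -/
lemma isFrameproof_of_lt_hammingDist {S : Type*} [Finite S] [DecidableEq S] {n s : ℕ}
    (hn : 0 < n) (hs : 0 < s) {C : Set (Fin n → S)}
    (hC : ∀ x ∈ C, ∀ y ∈ C, x ≠ y → (1 - 1 / (s : ℝ)) * n < hammingDist x y) :
    IsFrameproof s C := by
  intro A hA hAs
  refine Set.Subset.antisymm ?_ fun x hx => ⟨fun i => ⟨x, hx, rfl⟩, hA hx⟩
  rintro x ⟨hxd, hxC⟩
  by_contra hxA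
  have hfin : A.Finite := Set.toFinite A
  lift A to Finset (Fin n → S) using hfin
  rw [Set.ncard_coe_finset] at hAs
  have hunion : (Finset.univ : Finset (Fin n)) ⊆
      A.biUnion fun a => Finset.univ.filter fun i => x i = a i := by
    intro i _
    simpa using hxd i
  have hcard := (Finset.card_le_card hunion).trans Finset.card_biUnion_le
  rw [Finset.card_univ, Fintype.card_fin] at hcard
  have hcard' := (Nat.cast_le (α := ℝ)).2 hcard
  push_cast at hcard'
  have hs' : (0 : ℝ) < s := by exact_mod_cast hs
  have hn' : (0 : ℝ) < n := by exact_mod_cast hn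
  have hlt : ∀ a ∈ A, ((Finset.univ.filter fun i => x i = a i).card : ℝ) < n / s := by
    intro a ha
    have hd := hC x hxC a (hA ha) (by rintro rfl; exact hxA ha)
    have hsum := card_agree_add_hammingDist x a
    rw [Fintype.card_fin] at hsum
    have hsum' : ((Finset.univ.filter fun i => x i = a i).card : ℝ) + hammingDist x a = n := by
      exact_mod_cast hsum
    have : (1 - 1 / (s : ℝ)) * n = n - n / s := by ring
    linarith
  have hne : A.Nonempty := by
    obtain ⟨a, ha, -⟩ := hxd ⟨0, hn⟩
    exact ⟨a, ha⟩
  have hstrict := Finset.sum_lt_sum_of_nonempty hne hlt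
  rw [Finset.sum_const, nsmul_eq_mul] at hstrict
  have hle : (A.card : ℝ) * (n / s) ≤ s * (n / s) :=
    mul_le_mul_of_nonneg_right (by exact_mod_cast hAs) (by positivity)
  rw [mul_div_cancel₀ _ hs'.ne'] at hle
  linarith

lemma ncard_code_le (q n : ℕ) (C : Set (Fin n → Fin q)) : C.ncard ≤ q ^ n := by
  simpa [Nat.card_eq_fintype_card] using Set.ncard_le_card C

lemma IsFrameproof.ncard_le_Mfp {q n s : ℕ} {C : Set (Fin n → Fin q)} (hC : IsFrameproof s C) :
    C.ncard ≤ Mfp q n s :=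
  le_csSup ⟨q ^ n, by rintro _ ⟨C, -, rfl⟩; exact ncard_code_le q n C⟩ ⟨C, hC, rfl⟩

lemma Mfp_le_pow (q n s : ℕ) : Mfp q n s ≤ q ^ n :=
  csSup_le' (by rintro _ ⟨C, -, rfl⟩; exact ncard_code_le q n C)

lemma entropyQ_one_sub_inv {q s : ℕ} (hs : 2 ≤ s) (hsq : s < q) :
    entropyQ q (1 - 1 / (s : ℝ)) =
      Real.logb q s - (1 - 1 / (s : ℝ)) * Real.logb q (((s : ℝ) - 1) / ((q : ℝ) - 1)) := by
  have h2 : (2 : ℝ) ≤ s := by exact_mod_cast hs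
  have hq : (s : ℝ) < q := by exact_mod_cast hsq
  have hs0 : (s : ℝ) ≠ 0 := by linarith
  have hs1 : (s : ℝ) - 1 ≠ 0 := by linarith
  have hq1 : (q : ℝ) - 1 ≠ 0 := by linarith
  have h : 1 - 1 / (s : ℝ) = (s - 1) / s := by field_simp
  rw [entropyQ, sub_sub_cancel, Real.logb_div hs1 hq1, one_div, Real.logb_inv,
    ← one_div, h, Real.logb_div hs1 hs0]
  field_simp
  ring

lemma one_sub_entropyQ_le_logb_Mfp_div {q s n : ℕ} (hs : 2 ≤ s) (hsq : s < q) (hn : 0 < n) :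
    1 - entropyQ q (1 - 1 / (s : ℝ)) ≤ Real.logb q (Mfp q n s) / n := by
  have h2 : (2 : ℝ) ≤ s := by exact_mod_cast hs
  have hq : (s : ℝ) < q := by exact_mod_cast hsq
  have hn' : (0 : ℝ) < n := by exact_mod_cast hn
  have hδ : 0 ≤ 1 - 1 / (s : ℝ) := by
    rw [sub_nonneg, div_le_one (by linarith)]; linarith
  set t : ℝ := ((s : ℝ) - 1) / ((q : ℝ) - 1) with ht_def
  have ht : 0 < t := div_pos (by linarith) (by linarith)
  have ht1 : t ≤ 1 := (div_le_one (by linarith)).2 (by linarith)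
  have hst : 1 + ((q : ℝ) - 1) * t = s := by
    rw [ht_def, mul_div_cancel₀ _ (by linarith)]; ring
  obtain ⟨C, hsep, hcard⟩ := exists_separated_card_ge (ι := Fin n) (α := Fin q)
    (mul_nonneg hδ hn'.le) ht ht1
  simp only [Fintype.card_fin, hst] at hcard
  have hfp : IsFrameproof s (C : Set (Fin n → Fin q)) :=
    isFrameproof_of_lt_hammingDist hn (by omega) (by simpa using hsep)
  have hCM := hfp.ncard_le_Mfp
  rw [Set.ncard_coe_finset] at hCM
  have hq0 : (0 : ℝ) < q := by linarith
  have hs0 : (0 : ℝ) < s := by linarith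
  have hmain : (q : ℝ) ^ n * t ^ ((1 - 1 / (s : ℝ)) * n) ≤ Mfp q n s * (s : ℝ) ^ n :=
    hcard.trans (mul_le_mul_of_nonneg_right (by exact_mod_cast hCM) (by positivity))
  have hleft : 0 < (q : ℝ) ^ n * t ^ ((1 - 1 / (s : ℝ)) * n) := by positivity
  have hM : (0 : ℝ) < Mfp q n s := pos_of_mul_pos_left (hleft.trans_le hmain) (by positivity)
  have hlog := Real.logb_le_logb_of_le (b := q) (by linarith) hleft hmain
  rw [Real.logb_mul (by positivity) (by positivity), Real.logb_mul hM.ne' (by positivity),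
    Real.logb_pow, Real.logb_pow, Real.logb_self_eq_one (by linarith),
    Real.logb_rpow_eq_mul_logb_of_pos ht] at hlog
  rw [entropyQ_one_sub_inv hs hsq, le_div_iff₀ hn', ← ht_def]
  linarith

lemma logb_Mfp_div_le_one {q : ℕ} (hq : 1 < q) (n s : ℕ) :
    Real.logb q (Mfp q n s) / n ≤ 1 := by
  have hq' : (1 : ℝ) < q := by exact_mod_cast hq
  refine div_le_one_of_le₀ ?_ (Nat.cast_nonneg n)
  rcases Nat.eq_zero_or_pos (Mfp q n s) with h | h
  · simp [h]
  · have hle : (Mfp q n s : ℝ) ≤ (q : ℝ) ^ n := by exact_mod_cast Mfp_le_pow q n s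
    have := Real.logb_le_logb_of_le hq' (by exact_mod_cast h) hle
    rwa [Real.logb_pow, Real.logb_self_eq_one hq', mul_one] at this

/-- Gilbert–Varshamov-type lower bound: for a prime power `q` and `2 ≤ s < q`,
`R_q(s) ≥ 1 − H_q(1 − 1/s)`. -/
theorem stmt10 (q s : ℕ) (hq : IsPrimePow q) (hs : 2 ≤ s) (hsq : s < q) :
    1 - entropyQ q (1 - 1 / (s : ℝ)) ≤ Rfp q s := by
  refine le_limsup_of_frequently_le ?_
    (isBoundedUnder_of ⟨1, fun n => logb_Mfp_div_le_one (by omega) n s⟩)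
  exact ((eventually_gt_atTop 0).mono fun n hn =>
    one_sub_entropyQ_le_logb_Mfp_div hs hsq hn).frequently
end

section
/- Let q be a prime power and let C ⊆ F_q^n be an F_q-linear code of dimension k and minimum distance d with 1 ≤ d < n. Set s = ⌊(n−1)/(n−d)⌋. Then |C| = q^k and for every subset A ⊆ C with |A| ≤ s one has desc(A) ∩ C = A; in particular, if s ≥ 2, then C is a q-ary s-frameproof code of length n of size q^k. -/
open Filter

/-- Two words at Hamming distance at least `d` agree in at most `n - d` coordinates. -/
theorem card_agree_le_of_le_hammingDist {S : Type*} [DecidableEq S] {n d : ℕ}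
    {x y : Fin n → S} (h : d ≤ hammingDist x y) :
    (Finset.univ.filter fun i => x i = y i).card ≤ n - d := by
  have key := Finset.card_filter_add_card_filter_not (s := Finset.univ) (fun i => x i = y i)
  rw [Finset.card_univ, Fintype.card_fin] at key
  simp only [hammingDist, ne_eq] at h
  omega

/-- A word at distance at least `d` from every word of a finite set `A` is a descendant of `A`
only if `n ≤ |A| (n - d)`. -/
theorem le_card_mul_of_mem_descSet {S : Type*} [DecidableEq S] {n d : ℕ}
    {A : Finset (Fin n → S)} {x : Fin n → S} (hx : x ∈ descSet (A : Set (Fin n → S)))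
    (hA : ∀ a ∈ A, d ≤ hammingDist x a) : n ≤ A.card * (n - d) := by
  have hcover : Finset.univ ⊆ A.biUnion fun a => Finset.univ.filter fun i => x i = a i := by
    intro i _
    simpa using hx i
  calc n = (Finset.univ : Finset (Fin n)).card := (Finset.card_fin n).symm
    _ ≤ _ := Finset.card_le_card hcover
    _ ≤ A.card * (n - d) :=
      Finset.card_biUnion_le_card_mul _ _ _ fun a ha => card_agree_le_of_le_hammingDist (hA a ha)

/-- A finite code of minimum distance at least `d` is `s`-frameproof when `s (n - d) < n`. -/
theorem isFrameproof_of_le_hammingDist {S : Type*} [DecidableEq S] {n d s : ℕ}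
    {C : Set (Fin n → S)} (hC : C.Finite)
    (hd : ∀ x ∈ C, ∀ y ∈ C, x ≠ y → d ≤ hammingDist x y) (hs : s * (n - d) < n) :
    IsFrameproof s C := by
  intro A hAC hA
  refine Set.Subset.antisymm ?_ fun a ha => ⟨fun i => ⟨a, ha, rfl⟩, hAC ha⟩
  rintro x ⟨hx, hxC⟩
  by_contra hxA
  lift A to Finset (Fin n → S) using hC.subset hAC
  rw [Set.ncard_coe_finset] at hA
  have hle := le_card_mul_of_mem_descSet hx fun a ha =>
    hd x hxC a (hAC ha) fun h => hxA (h ▸ ha)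
  exact (hle.trans (Nat.mul_le_mul_right _ hA)).not_gt hs

/-- A `q`-ary `[n,k,d]`-linear code `C` with `1 ≤ d < n` has `q^k` elements and is an
`s`-frameproof code with `s = ⌊(n−1)/(n−d)⌋`. -/
theorem stmt11 (q : ℕ) (F : Type) [Field F] [Fintype F] [DecidableEq F]
    (hF : Fintype.card F = q) (n k d : ℕ) (hd1 : 1 ≤ d) (hdn : d < n)
    (C : Submodule F (Fin n → F)) (hk : Module.finrank F C = k)
    (hmin : ∀ c ∈ C, c ≠ 0 → d ≤ hammingNorm c)
    (hex : ∃ c ∈ C, c ≠ 0 ∧ hammingNorm c = d) :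
    Nat.card C = q ^ k ∧
      (∀ A ⊆ (C : Set (Fin n → F)), A.ncard ≤ (n - 1) / (n - d) →
        descSet A ∩ (C : Set (Fin n → F)) = A) ∧
      (2 ≤ (n - 1) / (n - d) →
        IsFrameproof ((n - 1) / (n - d)) (C : Set (Fin n → F))) := by
  have hfp : IsFrameproof ((n - 1) / (n - d)) (C : Set (Fin n → F)) := by
    refine isFrameproof_of_le_hammingDist (d := d) (Set.toFinite _) (fun x hx y hy hxy => ?_) ?_
    · rw [hammingDist_eq_hammingNorm]
      refine hmin _ ?_ (by simpa [neg_add_eq_zero] using hxy)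
      exact C.add_mem (C.neg_mem hx) hy
    · have := Nat.div_mul_le_self (n - 1) (n - d)
      omega
  refine ⟨?_, hfp, fun _ => hfp⟩
  rw [Module.natCard_eq_pow_finrank (K := F), hk, Nat.card_eq_fintype_card, hF]
end
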